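/- There exist constants C₁ > 0 and α₁ > 0 such that for every m ≥ 0 and all a, a' ∈ [-2, 1/4] with h(a), h(a') ∈ [2^{−m−1} log 2, 2^{−m} log 2], one has |h(a) − h(a')| ≤ C₁ |a − a'|^{α₁}. -/

import Mathlib

open Filter Set MeasureTheory

/-- The quadratic family `f_a(x) = x² + a`. -/
noncomputable def fa (a : ℝ) : ℝ → ℝ := fun x => x ^ 2 + a

/-- The invariant interval `I_a`. -/
noncomputable def Ia (a : ℝ) : Set ℝ :=
  Set.Icc ((-1 - Real.sqrt (1 - 4 * a)) / 2) ((1 + Real.sqrt (1 - 4 * a)) / 2)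

/-- Topological entropy of `f_a` restricted to `I_a`. -/
noncomputable def h (a : ℝ) : ℝ := (Dynamics.coverEntropy (fa a) (Ia a)).toReal

namespace QuadraticEntropy

lemma fa_apply (a x : ℝ) : fa a x = x ^ 2 + a := rfl

lemma iter_succ (a : ℝ) (n : ℕ) (x : ℝ) :
    (fa a)^[n + 1] x = ((fa a)^[n] x) ^ 2 + a := by
  rw [Function.iterate_succ_apply', fa_apply]

lemma iter_add (a : ℝ) (m n : ℕ) (x : ℝ) :
    (fa a)^[m + n] x = (fa a)^[m] ((fa a)^[n] x) := Function.iterate_add_apply _ _ _ _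

lemma iter_neg (a : ℝ) (n : ℕ) (hn : 0 < n) (x : ℝ) : (fa a)^[n] (-x) = (fa a)^[n] x := by
  obtain ⟨m, rfl⟩ := Nat.exists_eq_add_of_lt hn
  rw [Nat.zero_add, iter_add, iter_add]
  congr 1
  simp [fa_apply]

lemma iter_abs (a : ℝ) (n : ℕ) (hn : 0 < n) (x : ℝ) : (fa a)^[n] |x| = (fa a)^[n] x := by
  rcases abs_choice x with hx | hx <;> rw [hx]
  exact iter_neg a n hn x

lemma continuous_fa (a : ℝ) : Continuous (fa a) := by
  unfold fa; fun_prop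

lemma continuous_iter (a : ℝ) (n : ℕ) : Continuous ((fa a)^[n]) := (continuous_fa a).iterate n

lemma exists_zero_between {a : ℝ} {n : ℕ} {x y : ℝ} (hxy : x < y)
    (hf : (fa a)^[n] x = (fa a)^[n] y) : ∃ i < n, ∃ z, x < z ∧ z < y ∧ (fa a)^[i] z = 0 := by
  classical
  have hex : ∃ n, (fa a)^[n] x = (fa a)^[n] y := ⟨n, hf⟩
  set i := Nat.find hex with hi
  have h1 : (fa a)^[i] x = (fa a)^[i] y := Nat.find_spec hex
  have hin : i ≤ n := Nat.find_min' hex hf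
  have hi0 : i ≠ 0 := by
    intro h0
    rw [h0] at h1
    exact hxy.ne h1
  obtain ⟨j, hj⟩ := Nat.exists_eq_succ_of_ne_zero hi0
  have h2 : (fa a)^[j] x ≠ (fa a)^[j] y := Nat.find_min hex (by omega)
  rw [hj, Nat.succ_eq_add_one, iter_succ, iter_succ] at h1
  have h3 : (fa a)^[j] x = -(fa a)^[j] y := by
    have : ((fa a)^[j] x - (fa a)^[j] y) * ((fa a)^[j] x + (fa a)^[j] y) = 0 := by linarith
    rcases mul_eq_zero.1 this with h | h
    · exact absurd (by linarith) h2
    · linarith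
  have h4 : (fa a)^[j] y ≠ 0 := by
    intro h; apply h2; rw [h3, h]; simp
  refine ⟨j, by omega, ?_⟩
  have hc := (continuous_iter a j).continuousOn (s := Icc x y)
  rcases lt_or_gt_of_ne h4 with h | h
  · obtain ⟨z, hz, hz0⟩ := intermediate_value_Ioo' hxy.le hc
      (show (0 : ℝ) ∈ Ioo ((fa a)^[j] y) ((fa a)^[j] x) from ⟨h, by linarith⟩)
    exact ⟨z, hz.1, hz.2, hz0⟩
  · obtain ⟨z, hz, hz0⟩ := intermediate_value_Ioo hxy.le hc
      (show (0 : ℝ) ∈ Ioo ((fa a)^[j] x) ((fa a)^[j] y) from ⟨by linarith, h⟩)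
    exact ⟨z, hz.1, hz.2, hz0⟩

lemma finite_preimage_iter (a : ℝ) (n : ℕ) {s : Set ℝ} (hs : s.Finite) :
    ((fa a)^[n] ⁻¹' s).Finite := by
  induction n with
  | zero => simpa using hs
  | succ n ih =>
    rw [Function.iterate_succ, preimage_comp]
    refine ih.preimage' fun c _ => ?_
    refine (Set.toFinite ({√(c - a), -√(c - a)} : Set ℝ)).subset fun x hx => ?_
    have hx' : x ^ 2 = c - a := by
      have : x ^ 2 + a = c := hx
      linarith
    have h0 : |x| = √(c - a) := by rw [← hx', Real.sqrt_sq_eq_abs]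
    rcases abs_choice x with h | h
    · left; rw [← h0, h]
    · right; rw [mem_singleton_iff, ← h0, h]; simp

/-- The points whose orbit hits the critical point before time `n`. -/
def critZeros (a : ℝ) (n : ℕ) : Set ℝ := {x | ∃ k < n, (fa a)^[k] x = 0}

lemma critZeros_finite (a : ℝ) (n : ℕ) : (critZeros a n).Finite := by
  have : critZeros a n = ⋃ k ∈ Finset.range n, (fa a)^[k] ⁻¹' {0} := by
    ext x; simp [critZeros]
  rw [this]
  exact Set.Finite.biUnion (Finset.finite_toSet _)
    fun k _ => finite_preimage_iter a k (finite_singleton 0)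

lemma critZeros_mono (a : ℝ) {m n : ℕ} (hmn : m ≤ n) : critZeros a m ⊆ critZeros a n :=
  fun _ ⟨k, hk, hx⟩ => ⟨k, hk.trans_le hmn, hx⟩

/-- One more than the number of points hitting the critical point before time `n`. -/
noncomputable def lapBound (a : ℝ) (n : ℕ) : ℕ := (critZeros a n).ncard + 1

lemma lapBound_pos (a : ℝ) (n : ℕ) : 0 < lapBound a n := Nat.succ_pos _

lemma ncard_le_of_separated {S T : Set ℝ} (hS : S.Finite) (hT : T.Finite)
    (hST : ∀ x ∈ S, ∀ y ∈ S, x < y → ∃ z ∈ T, x < z ∧ z < y) : S.ncard ≤ T.ncard + 1 := by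
  classical
  rw [ncard_eq_toFinset_card S hS, ncard_eq_toFinset_card T hT]
  refine Finset.card_le_of_interleaved fun x hx y hy hxy _ => ?_
  obtain ⟨z, hz, h1⟩ := hST x (by simpa using hx) y (by simpa using hy) hxy
  exact ⟨z, by simpa using hz, h1⟩

lemma ncard_preimage_singleton_le (a : ℝ) (n : ℕ) (c : ℝ) :
    ((fa a)^[n] ⁻¹' {c}).ncard ≤ lapBound a n := by
  refine ncard_le_of_separated (finite_preimage_iter a n (finite_singleton c))
    (critZeros_finite a n) fun x hx y hy hxy => ?_
  obtain ⟨i, hi, z, h1, h2, h3⟩ := exists_zero_between hxy (hx.trans hy.symm : _ = _)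
  exact ⟨z, ⟨i, hi, h3⟩, h1, h2⟩

lemma ncard_preimage_le (a : ℝ) (n : ℕ) {s : Set ℝ} (hs : s.Finite) :
    ((fa a)^[n] ⁻¹' s).ncard ≤ s.ncard * lapBound a n := by
  classical
  induction s, hs using Set.Finite.induction_on with
  | empty => simp
  | @insert c s hc hs ih =>
    rw [ncard_insert_of_notMem hc hs, insert_eq, preimage_union]
    refine (ncard_union_le _ _).trans ?_
    have := ncard_preimage_singleton_le a n c
    rw [Nat.succ_mul]
    omega

lemma critZeros_add (a : ℝ) (n k : ℕ) :
    critZeros a (n + k) = critZeros a n ∪ (fa a)^[n] ⁻¹' (critZeros a k) := by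
  ext x
  constructor
  · rintro ⟨j, hj, hx⟩
    rcases lt_or_ge j n with h | h
    · exact Or.inl ⟨j, h, hx⟩
    · refine Or.inr ⟨j - n, by omega, ?_⟩
      rw [← iter_add, Nat.sub_add_cancel h, hx]
  · rintro (⟨j, hj, hx⟩ | ⟨j, hj, hx⟩)
    · exact ⟨j, by omega, hx⟩
    · exact ⟨j + n, by omega, by rw [iter_add, hx]⟩

lemma lapBound_add_le (a : ℝ) (n k : ℕ) :
    lapBound a (n + k) ≤ lapBound a n * lapBound a k := by
  have h1 := ncard_union_le (critZeros a n) ((fa a)^[n] ⁻¹' (critZeros a k))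
  have h2 := ncard_preimage_le a n (critZeros_finite a k)
  rw [← critZeros_add] at h1
  have h3 : lapBound a n * lapBound a k
      = (critZeros a k).ncard * lapBound a n + lapBound a n := by
    simp only [lapBound]; ring
  rw [h3]
  simp only [lapBound] at *
  omega

lemma subadditive_log_lapBound (a : ℝ) : Subadditive fun n => Real.log (lapBound a n) := by
  intro m n
  rw [← Real.log_mul (by exact_mod_cast (lapBound_pos a m).ne')
    (by exact_mod_cast (lapBound_pos a n).ne')]
  refine Real.log_le_log (by exact_mod_cast lapBound_pos a _) ?_
  exact_mod_cast lapBound_add_le a m n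

/-- The exponential growth rate of the number of points hitting the critical point. -/
noncomputable def growth (a : ℝ) : ℝ := (subadditive_log_lapBound a).lim

lemma log_lapBound_nonneg (a : ℝ) (n : ℕ) : 0 ≤ Real.log (lapBound a n) :=
  Real.log_nonneg (by exact_mod_cast lapBound_pos a n)

lemma bddBelow_log_lapBound (a : ℝ) :
    BddBelow (range fun n : ℕ => Real.log (lapBound a n) / n) :=
  ⟨0, by rintro _ ⟨n, rfl⟩; exact div_nonneg (log_lapBound_nonneg a n) n.cast_nonneg⟩

lemma tendsto_growth (a : ℝ) :
    Tendsto (fun n : ℕ => Real.log (lapBound a n) / n) atTop (nhds (growth a)) :=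
  (subadditive_log_lapBound a).tendsto_lim (bddBelow_log_lapBound a)

lemma growth_nonneg (a : ℝ) : 0 ≤ growth a :=
  ge_of_tendsto' (tendsto_growth a)
    fun n => div_nonneg (log_lapBound_nonneg a n) n.cast_nonneg

lemma exp_growth_le (a : ℝ) (n : ℕ) : Real.exp (n * growth a) ≤ lapBound a n := by
  rcases Nat.eq_zero_or_pos n with rfl | hn
  · simpa using Nat.succ_le_of_lt (lapBound_pos a 0)
  rw [← Real.le_log_iff_exp_le (by exact_mod_cast lapBound_pos a n)]
  have := (subadditive_log_lapBound a).lim_le_div (bddBelow_log_lapBound a) hn.ne'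
  rw [le_div_iff₀ (by exact_mod_cast hn)] at this
  rw [mul_comm]; exact this

/-- The right endpoint of the invariant interval. -/
noncomputable def beta (a : ℝ) : ℝ := (1 + √(1 - 4 * a)) / 2

lemma Ia_eq (a : ℝ) : Ia a = Icc (-beta a) (beta a) := by
  unfold Ia beta; congr 1; ring

lemma beta_sq {a : ℝ} (ha : a ≤ 1 / 4) : beta a ^ 2 + a = beta a := by
  unfold beta
  have := Real.sq_sqrt (show (0 : ℝ) ≤ 1 - 4 * a by linarith)
  nlinarith

lemma half_le_beta (a : ℝ) : 1 / 2 ≤ beta a := by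
  unfold beta
  have := Real.sqrt_nonneg (1 - 4 * a)
  linarith

lemma beta_le_two {a : ℝ} (ha : -2 ≤ a) : beta a ≤ 2 := by
  unfold beta
  have : √(1 - 4 * a) ≤ 3 := by
    rw [show (3 : ℝ) = √9 by rw [show (9 : ℝ) = 3 ^ 2 by norm_num]; simp]
    exact Real.sqrt_le_sqrt (by linarith)
  linarith

lemma fa_mem_Ia {a : ℝ} (ha : a ∈ Icc (-2 : ℝ) (1 / 4)) {x : ℝ} (hx : x ∈ Ia a) :
    fa a x ∈ Ia a := by
  rw [Ia_eq] at *
  have h1 := beta_sq ha.2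
  have h2 := half_le_beta a
  have h3 := beta_le_two ha.1
  rw [fa_apply]
  constructor <;> nlinarith [hx.1, hx.2, sq_nonneg x]

lemma iter_mem_Ia {a : ℝ} (ha : a ∈ Icc (-2 : ℝ) (1 / 4)) (n : ℕ) {x : ℝ} (hx : x ∈ Ia a) :
    (fa a)^[n] x ∈ Ia a := by
  induction n with
  | zero => exact hx
  | succ n ih => rw [Function.iterate_succ_apply']; exact fa_mem_Ia ha ih

lemma zero_mem_Ia (a : ℝ) : (0 : ℝ) ∈ Ia a := by
  rw [Ia_eq]; have := half_le_beta a; constructor <;> linarith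

lemma mem_Ia_of_fa_mem {a : ℝ} (ha : a ≤ 1 / 4) {x : ℝ} (hx : fa a x ∈ Ia a) : x ∈ Ia a := by
  rw [Ia_eq] at *
  have h1 := beta_sq ha
  have h2 := half_le_beta a
  have h3 := hx.2
  rw [fa_apply] at h3
  exact abs_le.1 (abs_le_of_sq_le_sq (by linarith) (by linarith))

lemma mem_Ia_of_iter_mem {a : ℝ} (ha : a ≤ 1 / 4) (n : ℕ) {x : ℝ} (hx : (fa a)^[n] x ∈ Ia a) :
    x ∈ Ia a := by
  induction n with
  | zero => exact hx
  | succ n ih => rw [Function.iterate_succ_apply'] at hx; exact ih (mem_Ia_of_fa_mem ha hx)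

lemma critZeros_subset_Ia {a : ℝ} (ha : a ≤ 1 / 4) (n : ℕ) : critZeros a n ⊆ Ia a := by
  rintro x ⟨k, _, hx⟩
  exact mem_Ia_of_iter_mem ha k (by rw [hx]; exact zero_mem_Ia a)

lemma lapBound_mono (a : ℝ) {m n : ℕ} (hmn : m ≤ n) : lapBound a m ≤ lapBound a n :=
  Nat.succ_le_succ (ncard_le_ncard (critZeros_mono a hmn) (critZeros_finite a n))

lemma exists_fine_grid (β : ℝ) (hβ : 0 < β) (ε : ℝ) (hε : 0 < ε) :
    ∃ Γ : Set ℝ, Γ.Finite ∧ -β ∈ Γ ∧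
      ∀ u v, -β ≤ u → v ≤ β → u + ε ≤ v → ∃ g ∈ Γ, u < g ∧ g < v := by
  obtain ⟨M, hM⟩ := exists_nat_gt (2 * β / (ε / 2))
  rw [div_lt_iff₀ (by positivity)] at hM
  refine ⟨(fun i : ℕ => -β + i * (ε / 2)) '' (Iio M), (finite_Iio M).image _, ?_, ?_⟩
  · refine ⟨0, ?_, by simp⟩
    rw [mem_Iio]
    by_contra hcon
    have : M = 0 := by omega
    rw [this] at hM
    simp at hM
    linarith
  · intro u v hu hv huv
    have h0 : 0 ≤ (u + β) / (ε / 2) := div_nonneg (by linarith) (by linarith)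
    set i := ⌊(u + β) / (ε / 2)⌋₊
    have h1 : (i : ℝ) ≤ (u + β) / (ε / 2) := Nat.floor_le h0
    have h2 : (u + β) / (ε / 2) < (i : ℝ) + 1 := Nat.lt_floor_add_one _
    rw [le_div_iff₀ (by positivity)] at h1
    rw [div_lt_iff₀ (by positivity)] at h2
    have h3 : -β + ((i + 1 : ℕ) : ℝ) * (ε / 2) < v := by push_cast; linarith
    refine ⟨-β + ((i + 1 : ℕ) : ℝ) * (ε / 2), ⟨i + 1, ?_, rfl⟩, by push_cast; linarith, h3⟩
    rw [mem_Iio]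
    by_contra hcon
    have : (M : ℝ) ≤ ((i + 1 : ℕ) : ℝ) := by exact_mod_cast not_lt.1 hcon
    nlinarith

lemma exists_dynCover {a : ℝ} (ha : a ∈ Icc (-2 : ℝ) (1 / 4)) {U : SetRel ℝ ℝ}
    (hU : U ∈ uniformity ℝ) : ∃ K : ℕ, ∀ n, 0 < n →
      ∃ s : Finset ℝ, Dynamics.IsDynCoverOf (fa a) (Ia a) U n s ∧
        s.card ≤ n * (K * lapBound a n) := by
  classical
  obtain ⟨ε, hε, hεU⟩ := Metric.mem_uniformity_dist.1 hU
  have hβ : 0 < beta a := by have := half_le_beta a; linarith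
  obtain ⟨Γ, hΓ, hβΓ, hgrid⟩ := exists_fine_grid (beta a) hβ ε hε
  refine ⟨Γ.ncard, fun n hn => ?_⟩
  set A : Finset ℝ := (Finset.range n).biUnion
    fun k => (finite_preimage_iter a k hΓ).toFinset with hA
  have hAmem : ∀ x, x ∈ A ↔ ∃ k < n, (fa a)^[k] x ∈ Γ := by
    intro x; simp [hA]
  refine ⟨A, ?_, ?_⟩
  · intro x hx
    have hxI := hx
    rw [Ia_eq] at hx
    have hne : (A.filter (· ≤ x)).Nonempty :=
      ⟨-beta a, by
        rw [Finset.mem_filter, hAmem]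
        exact ⟨⟨0, hn, hβΓ⟩, hx.1⟩⟩
    set y := (A.filter (· ≤ x)).max' hne with hy
    have hyA := Finset.max'_mem _ hne
    rw [← hy, Finset.mem_filter] at hyA
    have hmax : ∀ z ∈ A, z ≤ x → z ≤ y := fun z hz hzx =>
      Finset.le_max' _ _ (Finset.mem_filter.2 ⟨hz, hzx⟩)
    refine ⟨y, hyA.1, ?_⟩
    rw [Dynamics.mem_dynEntourage]
    intro k hk
    apply hεU
    by_contra hcon
    rw [not_lt, Real.dist_eq] at hcon
    have hyI : y ∈ Ia a := by
      rw [Ia_eq]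
      refine ⟨hmax _ ((hAmem _).2 ⟨0, hn, hβΓ⟩) hx.1, hyA.2.trans hx.2⟩
    have h1 := iter_mem_Ia ha k hxI
    have h2 := iter_mem_Ia ha k hyI
    rw [Ia_eq] at h1 h2
    have hc := (continuous_iter a k).continuousOn (s := Icc y x)
    have key : ∃ z, y < z ∧ z ≤ x ∧ (fa a)^[k] z ∈ Γ := by
      rcases le_abs.1 hcon with h | h
      · obtain ⟨g, hg, h3, h4⟩ := hgrid ((fa a)^[k] y) ((fa a)^[k] x) h2.1 h1.2 (by linarith)
        obtain ⟨z, hz, hzg⟩ := intermediate_value_Ioo hyA.2 hc ⟨h3, h4⟩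
        exact ⟨z, hz.1, hz.2.le, by rw [hzg]; exact hg⟩
      · obtain ⟨g, hg, h3, h4⟩ := hgrid ((fa a)^[k] x) ((fa a)^[k] y) h1.1 h2.2 (by linarith)
        obtain ⟨z, hz, hzg⟩ := intermediate_value_Ioo' hyA.2 hc ⟨h3, h4⟩
        exact ⟨z, hz.1, hz.2.le, by rw [hzg]; exact hg⟩
    obtain ⟨z, hz1, hz2, hz3⟩ := key
    have := hmax z ((hAmem z).2 ⟨k, hk, hz3⟩) hz2
    linarith
  · have h1 : A.card ≤ (Finset.range n).card * (Γ.ncard * lapBound a n) := by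
      refine Finset.card_biUnion_le_card_mul _ _ _ fun k hk => ?_
      rw [← ncard_eq_toFinset_card _ (finite_preimage_iter a k hΓ)]
      refine (ncard_preimage_le a k hΓ).trans ?_
      exact Nat.mul_le_mul_left _ (lapBound_mono a (Finset.mem_range.1 hk).le)
    simpa using h1

lemma eventually_mul_lapBound_le (a : ℝ) (K : ℕ) {c : ℝ} (hc : growth a < c) :
    ∀ᶠ n : ℕ in atTop, ((n * (K * lapBound a n) : ℕ) : ℝ) ≤ Real.exp (c * n) := by
  set η := (c - growth a) / 2 with hη
  have hη0 : 0 < η := by rw [hη]; linarith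
  have h1 : ∀ᶠ n : ℕ in atTop, Real.log (lapBound a n) / n < growth a + η :=
    (tendsto_growth a).eventually_lt_const (by linarith)
  obtain ⟨M, hM⟩ := exists_nat_gt (2 * K / η ^ 2)
  filter_upwards [h1, eventually_ge_atTop M, eventually_gt_atTop 0] with n hn hnM hn0
  have hn0' : (0 : ℝ) < n := by exact_mod_cast hn0
  rw [div_lt_iff₀ hn0', Real.log_lt_iff_lt_exp (by exact_mod_cast lapBound_pos a n)] at hn
  have h2 : (2 * K : ℝ) ≤ n * η ^ 2 := by
    rw [div_lt_iff₀ (by positivity)] at hM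
    have : (M : ℝ) ≤ n := by exact_mod_cast hnM
    nlinarith [sq_nonneg η]
  have h3 : (n * K : ℝ) ≤ Real.exp (η * n) := by
    have := Real.quadratic_le_exp_of_nonneg (show 0 ≤ η * n by positivity)
    nlinarith
  calc ((n * (K * lapBound a n) : ℕ) : ℝ) = (n * K) * lapBound a n := by push_cast; ring
    _ ≤ Real.exp (η * n) * Real.exp ((growth a + η) * n) := by gcongr
    _ = Real.exp (c * n) := by
      rw [← Real.exp_add]; congr 1; rw [hη]; ring

lemma coverEntropy_le_growth {a : ℝ} (ha : a ∈ Icc (-2 : ℝ) (1 / 4)) :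
    Dynamics.coverEntropy (fa a) (Ia a) ≤ (growth a : EReal) := by
  rw [Dynamics.coverEntropy]
  refine iSup₂_le fun U hU => ?_
  obtain ⟨K, hK⟩ := exists_dynCover ha hU
  refine le_of_forall_gt_imp_ge_of_dense fun c hc => ?_
  induction c with
  | bot => exact absurd hc (by simp)
  | top => exact le_top
  | coe c =>
    have hc' : growth a < c := by exact_mod_cast hc
    refine Eventually.expGrowthSup_le ?_
    filter_upwards [eventually_mul_lapBound_le a K hc', eventually_gt_atTop 0] with n hn hn0
    obtain ⟨s, hs, hcard⟩ := hK n hn0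
    have h1 := hs.coverMincard_le_card
    have h2 : ((Dynamics.coverMincard (fa a) (Ia a) U n : ℕ∞) : ENNReal) ≤ (s.card : ENNReal) := by
      exact_mod_cast h1
    refine h2.trans ?_
    have h3 : ((c : EReal) * (n : EReal)) = ((c * n : ℝ) : EReal) := by
      rw [EReal.coe_mul]; rfl
    rw [h3, EReal.exp_coe, ← ENNReal.ofReal_natCast]
    refine ENNReal.ofReal_le_ofReal (le_trans ?_ hn)
    exact_mod_cast hcard

lemma exists_separation {S : Set ℝ} (hS : S.Finite) :
    ∃ δ > 0, ∀ x ∈ S, ∀ y ∈ S, x ≠ y → δ ≤ |x - y| := by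
  by_cases hn : S.Nontrivial
  · refine ⟨S.infsep, (hS.infsep_pos_iff_nontrivial).2 hn, fun x hx y hy hxy => ?_⟩
    rw [← Real.dist_eq]
    exact infsep_le_dist_of_mem hx hy hxy
  · rw [not_nontrivial_iff] at hn
    exact ⟨1, one_pos, fun x hx y hy hxy => absurd (hn hx hy) hxy⟩

/-- Itineraries relative to the unique points of `critZeros a N` near a reference orbit
separate the points of `critZeros a (n * N)` shadowed by that orbit. -/
lemma eq_of_same_itinerary {a : ℝ} {N n : ℕ} {δ : ℝ}
    (hδ : ∀ x ∈ critZeros a N, ∀ y ∈ critZeros a N, x ≠ y → 2 * δ ≤ |x - y|) {w : ℝ}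
    {e : ℕ → ℝ}
    (he : ∀ j, (∃ c ∈ critZeros a N, |c - (fa a)^[j * N] w| < δ) →
      e j ∈ critZeros a N ∧ |e j - (fa a)^[j * N] w| < δ)
    {x y : ℝ} (hx : x ∈ critZeros a (n * N))
    (hxw : ∀ j < n, |(fa a)^[j * N] x - (fa a)^[j * N] w| < δ)
    (hyw : ∀ j < n, |(fa a)^[j * N] y - (fa a)^[j * N] w| < δ)
    (hs : ∀ j < n, SignType.sign ((fa a)^[j * N] x - e j)
      = SignType.sign ((fa a)^[j * N] y - e j)) : x = y := by
  by_contra hxy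
  have key : ∀ j ≤ n, (fa a)^[j * N] x ≠ (fa a)^[j * N] y ∧ x ∉ critZeros a (j * N) := by
    intro j
    induction j with
    | zero => intro _; refine ⟨by simpa using hxy, by simp [critZeros]⟩
    | succ j ih =>
      intro hj
      obtain ⟨h1, h2⟩ := ih (by omega)
      have hxj := abs_lt.1 (hxw j (by omega))
      have hyj := abs_lt.1 (hyw j (by omega))
      have hsj := hs j (by omega)
      have hej := he j
      rw [Nat.succ_mul, add_comm (j * N) N, iter_add, iter_add]
      set x' := (fa a)^[j * N] x
      set y' := (fa a)^[j * N] y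
      set w' := (fa a)^[j * N] w
      have hfree : ∀ c ∈ critZeros a N, ¬ (min x' y' ≤ c ∧ c ≤ max x' y') := by
        rintro c hc ⟨hc1, hc2⟩
        have hcw : |c - w'| < δ := by
          rw [abs_lt]
          rcases min_choice x' y' with h | h <;> rcases max_choice x' y' with h' | h' <;>
            rw [h] at hc1 <;> rw [h'] at hc2 <;> constructor <;> linarith
        obtain ⟨he1, he2⟩ := hej ⟨c, hc, hcw⟩
        have hce : c = e j := by
          by_contra hne
          have := hδ c hc (e j) he1 hne
          have h3 := abs_lt.1 hcw
          have h4 := abs_lt.1 he2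
          have : |c - e j| < 2 * δ := by rw [abs_lt]; constructor <;> linarith
          linarith
        rw [← hce] at hsj
        rcases lt_trichotomy x' c with h | h | h
        · rw [sign_neg (by linarith), eq_comm, sign_eq_neg_one_iff] at hsj
          have : max x' y' < c := max_lt h (by linarith)
          linarith
        · rw [h, sub_self, sign_zero, eq_comm, sign_eq_zero_iff] at hsj
          exact h1 (by linarith)
        · rw [sign_pos (by linarith), eq_comm, sign_eq_one_iff] at hsj
          have : c < min x' y' := lt_min h (by linarith)
          linarith
      constructor
      · intro hEq
        rcases lt_or_gt_of_ne h1 with h | h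
        · obtain ⟨i, hi, z, hz1, hz2, hz3⟩ := exists_zero_between h hEq
          exact hfree z ⟨i, hi, hz3⟩
            ⟨(min_le_left _ _).trans hz1.le, hz2.le.trans (le_max_right _ _)⟩
        · obtain ⟨i, hi, z, hz1, hz2, hz3⟩ := exists_zero_between h hEq.symm
          exact hfree z ⟨i, hi, hz3⟩
            ⟨(min_le_right _ _).trans hz1.le, hz2.le.trans (le_max_left _ _)⟩
      · rw [add_comm, critZeros_add]
        rintro (h | h)
        · exact h2 h
        · exact hfree x' h ⟨min_le_left _ _, le_max_left _ _⟩
  exact (key n le_rfl).2 hx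

lemma ncard_critZeros_le_of_dynCover {a : ℝ} (ha : a ≤ 1 / 4) {N : ℕ} {δ : ℝ} (hN : 0 < N)
    (hδ : ∀ x ∈ critZeros a N, ∀ y ∈ critZeros a N, x ≠ y → 2 * δ ≤ |x - y|) (n : ℕ)
    {s : Finset ℝ}
    (hs : Dynamics.IsDynCoverOf (fa a) (Ia a) {p : ℝ × ℝ | dist p.1 p.2 < δ} (n * N) (s : Set ℝ)) :
    (critZeros a (n * N)).ncard ≤ s.card * 3 ^ n := by
  classical
  have hw : ∀ x ∈ critZeros a (n * N), ∃ w ∈ s, ∀ k < n * N,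
      |(fa a)^[k] x - (fa a)^[k] w| < δ := by
    intro x hx
    obtain ⟨w, hw, hxw⟩ := hs (critZeros_subset_Ia ha _ hx)
    rw [Dynamics.mem_dynEntourage] at hxw
    exact ⟨w, hw, fun k hk => by simpa [Real.dist_eq] using hxw k hk⟩
  choose! w hws hxw using hw
  have hex : ∀ (v : ℝ) (j : ℕ), ∃ c, (∃ c ∈ critZeros a N, |c - (fa a)^[j * N] v| < δ) →
      c ∈ critZeros a N ∧ |c - (fa a)^[j * N] v| < δ := by
    intro v j
    by_cases h : ∃ c ∈ critZeros a N, |c - (fa a)^[j * N] v| < δ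
    · obtain ⟨c, hc⟩ := h
      exact ⟨c, fun _ => hc⟩
    · exact ⟨0, fun h' => absurd h' h⟩
  choose e he using hex
  set code : ℝ → ℝ × (Fin n → SignType) := fun x =>
    (w x, fun j => SignType.sign ((fa a)^[j * N] x - e (w x) j))
  rw [ncard_eq_toFinset_card _ (critZeros_finite a (n * N))]
  have hcard : (s ×ˢ (Finset.univ : Finset (Fin n → SignType))).card = s.card * 3 ^ n := by
    rw [Finset.card_product, Finset.card_univ, Fintype.card_fun, Fintype.card_fin]
    rfl
  rw [← hcard]
  refine Finset.card_le_card_of_injOn code ?_ ?_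
  · intro x hx
    simp only [Finite.coe_toFinset] at hx
    simp only [Finset.coe_product, Finset.coe_univ, mem_prod, mem_univ, and_true]
    exact hws x hx
  · intro x hx y hy hxy
    simp only [Finite.coe_toFinset] at hx hy
    have h1 : w x = w y := congrArg Prod.fst hxy
    have h2 := congrArg Prod.snd hxy
    have hlt : ∀ j < n, j * N < n * N := fun j hj => Nat.mul_lt_mul_of_pos_right hj hN
    refine eq_of_same_itinerary hδ (he (w x)) hx (fun j hj => hxw x hx _ (hlt j hj))
      (fun j hj => by rw [h1]; exact hxw y hy _ (hlt j hj)) fun j hj => ?_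
    have := congrFun h2 ⟨j, hj⟩
    rw [show e (w x) j = e (w x) j from rfl]
    simp only [code] at this
    rw [this, h1]

lemma not_forall_exp_le {A B : ℝ} (hB : 0 ≤ B) (hAB : B < A) :
    ¬ ∀ᶠ n : ℕ in atTop, Real.exp (n * A) ≤ Real.exp (n * B) + 1 := by
  intro hcon
  obtain ⟨M, hM⟩ := exists_nat_gt (1 / (A - B))
  obtain ⟨n, h1, h2⟩ := (hcon.and (eventually_ge_atTop M)).exists
  rw [div_lt_iff₀ (by linarith)] at hM
  have h3 : (M : ℝ) ≤ n := by exact_mod_cast h2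
  have h4 : 1 < n * (A - B) := by nlinarith
  have h5 := Real.add_one_le_exp (n * (A - B))
  have h6 : Real.exp (n * A) = Real.exp (n * B) * Real.exp (n * (A - B)) := by
    rw [← Real.exp_add]; congr 1; ring
  have h7 : 1 ≤ Real.exp (n * B) := Real.one_le_exp (by positivity)
  nlinarith

lemma growth_le_coverEntropy {a : ℝ} (ha : a ∈ Icc (-2 : ℝ) (1 / 4)) :
    (growth a : EReal) ≤ Dynamics.coverEntropy (fa a) (Ia a) := by
  by_contra hcon
  rw [not_le] at hcon
  obtain ⟨c, hc1, hc2⟩ := EReal.lt_iff_exists_real_btwn.1 hcon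
  have hc2' : c < growth a := by exact_mod_cast hc2
  have hc0 : 0 ≤ c := by
    have := (Dynamics.coverEntropy_nonneg (fa a) ⟨0, zero_mem_Ia a⟩).trans hc1.le
    exact_mod_cast this
  obtain ⟨N, hN⟩ := exists_nat_gt (Real.log 3 / (growth a - c))
  have hlog3 : 0 < Real.log 3 := Real.log_pos (by norm_num)
  have hN0 : 0 < N := by
    by_contra h0
    have : N = 0 := by omega
    rw [this] at hN
    have : 0 < Real.log 3 / (growth a - c) := div_pos hlog3 (by linarith)
    simp at hN
    linarith
  rw [div_lt_iff₀ (by linarith)] at hN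
  obtain ⟨δ, hδ, hsep⟩ := exists_separation (critZeros_finite a N)
  have hsep' : ∀ x ∈ critZeros a N, ∀ y ∈ critZeros a N, x ≠ y → 2 * (δ / 2) ≤ |x - y| := by
    intro x hx y hy hxy
    have := hsep x hx y hy hxy
    linarith
  have hU : {p : ℝ × ℝ | dist p.1 p.2 < δ / 2} ∈ uniformity ℝ :=
    Metric.dist_mem_uniformity (half_pos hδ)
  have h1 := (Dynamics.coverEntropyEntourage_le_coverEntropy (fa a) (Ia a) hU).trans_lt hc1
  have h2 := ExpGrowth.eventually_le_exp h1
  have h3 : ∀ᶠ n : ℕ in atTop, Real.exp (n * (N * growth a))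
      ≤ Real.exp (n * (N * c + Real.log 3)) + 1 := by
    have h4 : Tendsto (fun n : ℕ => n * N) atTop atTop :=
      tendsto_id.atTop_mul_const' hN0
    filter_upwards [h4.eventually h2] with n hn
    have h5 : ((c : EReal) * ((n * N : ℕ) : EReal)) = ((c * (n * N : ℕ) : ℝ) : EReal) := by
      rw [EReal.coe_mul]; rfl
    rw [h5, EReal.exp_coe] at hn
    have hfin : Dynamics.coverMincard (fa a) (Ia a) {p : ℝ × ℝ | dist p.1 p.2 < δ / 2} (n * N)
        < ⊤ := by
      by_contra htop
      rw [not_lt, top_le_iff] at htop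
      rw [htop] at hn
      simp at hn
    obtain ⟨s, hs, hcard⟩ := (Dynamics.coverMincard_finite_iff _ _ _ _).1 hfin
    rw [← hcard] at hn
    have h6 : (s.card : ℝ) ≤ Real.exp (c * (n * N : ℕ)) := by
      have h7 : ((s.card : ℕ) : ENNReal) ≤ ENNReal.ofReal (Real.exp (c * (n * N : ℕ))) := by
        simpa using hn
      rw [← ENNReal.ofReal_natCast] at h7
      exact (ENNReal.ofReal_le_ofReal_iff (Real.exp_pos _).le).1 h7
    have h8 := ncard_critZeros_le_of_dynCover ha.2 hN0 hsep' n hs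
    have h9 : (lapBound a (n * N) : ℝ) ≤ s.card * 3 ^ n + 1 := by
      exact_mod_cast Nat.succ_le_succ h8
    have h10 := exp_growth_le a (n * N)
    have h11 : Real.exp (n * (N * c + Real.log 3)) = Real.exp (c * (n * N : ℕ)) * 3 ^ n := by
      rw [← Real.exp_log (show (0 : ℝ) < 3 ^ n by positivity), Real.log_pow, ← Real.exp_add]
      congr 1; push_cast; ring
    rw [h11]
    have h12 : Real.exp (n * (N * growth a)) = Real.exp ((n * N : ℕ) * growth a) := by
      congr 1; push_cast; ring
    rw [h12]
    have : (s.card : ℝ) * 3 ^ n ≤ Real.exp (c * (n * N : ℕ)) * 3 ^ n := by gcongr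
    linarith
  exact not_forall_exp_le (by positivity) (by nlinarith) h3

theorem h_eq_growth {a : ℝ} (ha : a ∈ Icc (-2 : ℝ) (1 / 4)) : h a = growth a := by
  rw [h, le_antisymm (coverEntropy_le_growth ha) (growth_le_coverEntropy ha), EReal.toReal_coe]

/-- The orbit of the critical point. -/
noncomputable def crit (a : ℝ) (n : ℕ) : ℝ := (fa a)^[n] 0

lemma crit_zero (a : ℝ) : crit a 0 = 0 := rfl

lemma crit_succ (a : ℝ) (n : ℕ) : crit a (n + 1) = crit a n ^ 2 + a := iter_succ a n 0

lemma crit_one (a : ℝ) : crit a 1 = a := by rw [crit_succ, crit_zero]; simp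

lemma crit_add (a : ℝ) (m n : ℕ) : crit a (m + n) = (fa a)^[m] (crit a n) := iter_add a m n 0

/-- The kneading signs of the critical orbit. -/
noncomputable def theta (a : ℝ) : ℕ → ℝ
  | 0 => 1
  | n + 1 => if crit a (n + 1) = 0 then 1 else
      if 0 < crit a (n + 1) then theta a n else -theta a n

lemma theta_zero (a : ℝ) : theta a 0 = 1 := by rw [theta]

lemma theta_succ_of_zero {a : ℝ} {n : ℕ} (hn : crit a (n + 1) = 0) : theta a (n + 1) = 1 := by
  rw [theta, if_pos hn]

lemma theta_succ_of_pos {a : ℝ} {n : ℕ} (hn : 0 < crit a (n + 1)) :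
    theta a (n + 1) = theta a n := by
  rw [theta, if_neg hn.ne', if_pos hn]

lemma theta_succ_of_neg {a : ℝ} {n : ℕ} (hn : crit a (n + 1) < 0) :
    theta a (n + 1) = -theta a n := by
  rw [theta, if_neg hn.ne, if_neg hn.le.not_gt]

lemma theta_eq_or (a : ℝ) (n : ℕ) : theta a n = 1 ∨ theta a n = -1 := by
  induction n with
  | zero => exact Or.inl (theta_zero a)
  | succ n ih =>
    rcases lt_trichotomy (crit a (n + 1)) 0 with h | h | h
    · rw [theta_succ_of_neg h]
      rcases ih with h | h <;> rw [h] <;> norm_num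
    · exact Or.inl (theta_succ_of_zero h)
    · rw [theta_succ_of_pos h]; exact ih

lemma abs_theta (a : ℝ) (n : ℕ) : |theta a n| = 1 := by
  rcases theta_eq_or a n with h | h <;> rw [h] <;> norm_num

/-- Points hitting the critical point for the first time at time `n`. -/
def firstZeros (a : ℝ) (n : ℕ) : Set ℝ := {x | (fa a)^[n] x = 0 ∧ ∀ i < n, (fa a)^[i] x ≠ 0}

lemma firstZeros_finite (a : ℝ) (n : ℕ) : (firstZeros a n).Finite :=
  (critZeros_finite a (n + 1)).subset fun _ hx => ⟨n, n.lt_succ_self, hx.1⟩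

lemma mem_firstZeros_succ {a : ℝ} {n : ℕ} {x : ℝ} :
    x ∈ firstZeros a (n + 1) ↔ x ≠ 0 ∧ fa a x ∈ firstZeros a n := by
  constructor
  · rintro ⟨h1, h2⟩
    exact ⟨h2 0 n.succ_pos, h1, fun i hi => h2 (i + 1) (by omega)⟩
  · rintro ⟨h1, h2, h3⟩
    refine ⟨h2, fun i hi => ?_⟩
    rcases i with _ | i
    · exact h1
    · exact h3 i (by omega)

lemma neg_mem_firstZeros_succ {a : ℝ} {n : ℕ} {x : ℝ} :
    -x ∈ firstZeros a (n + 1) ↔ x ∈ firstZeros a (n + 1) := by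
  rw [mem_firstZeros_succ, mem_firstZeros_succ, fa_apply, fa_apply, neg_sq, neg_ne_zero]

lemma firstZeros_zero (a : ℝ) : firstZeros a 0 = {0} := by
  ext x; simp [firstZeros]

/-- The number of first zeros of order `n`. -/
noncomputable def numZeros (a : ℝ) (n : ℕ) : ℝ := (firstZeros a n).ncard

/-- The number of first zeros of order `n` strictly to the right of `x`. -/
noncomputable def numGt (a : ℝ) (n : ℕ) (x : ℝ) : ℝ := {y ∈ firstZeros a n | x < y}.ncard

/-- The number of first zeros of order `n` weakly to the right of `x`. -/
noncomputable def numGe (a : ℝ) (n : ℕ) (x : ℝ) : ℝ := {y ∈ firstZeros a n | x ≤ y}.ncard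

lemma numGt_zero (a x : ℝ) : numGt a 0 x = if x < 0 then 1 else 0 := by
  unfold numGt
  rw [firstZeros_zero]
  split_ifs with h
  · rw [show {y ∈ ({0} : Set ℝ) | x < y} = {0} by
      ext y; simp only [mem_singleton_iff, mem_ofPred_eq, and_iff_left_iff_imp]
      rintro rfl; exact h]
    simp
  · rw [show {y ∈ ({0} : Set ℝ) | x < y} = ∅ by
      ext y; simp only [mem_singleton_iff, mem_ofPred_eq, mem_empty_iff_false, iff_false, not_and]
      rintro rfl; exact h]
    simp

lemma numGe_zero (a x : ℝ) : numGe a 0 x = if x ≤ 0 then 1 else 0 := by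
  unfold numGe
  rw [firstZeros_zero]
  split_ifs with h
  · rw [show {y ∈ ({0} : Set ℝ) | x ≤ y} = {0} by
      ext y; simp only [mem_singleton_iff, mem_ofPred_eq, and_iff_left_iff_imp]
      rintro rfl; exact h]
    simp
  · rw [show {y ∈ ({0} : Set ℝ) | x ≤ y} = ∅ by
      ext y; simp only [mem_singleton_iff, mem_ofPred_eq, mem_empty_iff_false, iff_false, not_and]
      rintro rfl; exact h]
    simp

lemma injOn_fa_nonneg (a : ℝ) : InjOn (fa a) (Ici 0) := by
  intro x hx y hy hxy
  rw [fa_apply, fa_apply] at hxy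
  exact (sq_eq_sq₀ hx hy).1 (by linarith)

lemma numGt_succ_of_nonneg {a : ℝ} {n : ℕ} {x : ℝ} (hx : 0 ≤ x) :
    numGt a (n + 1) x = numGt a n (fa a x) := by
  unfold numGt
  congr 1
  have : {w ∈ firstZeros a n | fa a x < w} = fa a '' {y ∈ firstZeros a (n + 1) | x < y} := by
    ext w
    constructor
    · rintro ⟨hw, hxw⟩
      rw [fa_apply] at hxw
      have h1 : 0 ≤ w - a := by nlinarith
      have h2 : fa a (√(w - a)) = w := by rw [fa_apply, Real.sq_sqrt h1]; ring
      have h3 : x < √(w - a) := Real.lt_sqrt_of_sq_lt (by linarith)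
      exact ⟨√(w - a), ⟨mem_firstZeros_succ.2 ⟨(hx.trans_lt h3).ne', by rwa [h2]⟩, h3⟩, h2⟩
    · rintro ⟨y, ⟨hy, hxy⟩, rfl⟩
      refine ⟨(mem_firstZeros_succ.1 hy).2, ?_⟩
      rw [fa_apply, fa_apply]
      nlinarith
  rw [this, InjOn.ncard_image]
  exact (injOn_fa_nonneg a).mono fun y hy => hx.trans hy.2.le

lemma numGe_succ_of_pos {a : ℝ} {n : ℕ} {x : ℝ} (hx : 0 < x) :
    numGe a (n + 1) x = numGe a n (fa a x) := by
  unfold numGe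
  congr 1
  have : {w ∈ firstZeros a n | fa a x ≤ w} = fa a '' {y ∈ firstZeros a (n + 1) | x ≤ y} := by
    ext w
    constructor
    · rintro ⟨hw, hxw⟩
      rw [fa_apply] at hxw
      have h1 : 0 ≤ w - a := by nlinarith
      have h2 : fa a (√(w - a)) = w := by rw [fa_apply, Real.sq_sqrt h1]; ring
      have h3 : x ≤ √(w - a) := Real.le_sqrt_of_sq_le (by linarith)
      exact ⟨√(w - a), ⟨mem_firstZeros_succ.2 ⟨(hx.trans_le h3).ne', by rwa [h2]⟩, h3⟩, h2⟩
    · rintro ⟨y, ⟨hy, hxy⟩, rfl⟩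
      refine ⟨(mem_firstZeros_succ.1 hy).2, ?_⟩
      rw [fa_apply, fa_apply]
      nlinarith
  rw [this, InjOn.ncard_image]
  exact (injOn_fa_nonneg a).mono fun y hy => hx.le.trans hy.2

lemma numGt_add_numGe_neg (a : ℝ) (n : ℕ) (x : ℝ) :
    numGt a (n + 1) x + numGe a (n + 1) (-x) = numZeros a (n + 1) := by
  unfold numGt numGe numZeros
  have h1 : {y ∈ firstZeros a (n + 1) | -x ≤ y}.ncard
      = {y ∈ firstZeros a (n + 1) | y ≤ x}.ncard := by
    rw [← ncard_image_of_injective {y ∈ firstZeros a (n + 1) | y ≤ x} neg_injective]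
    congr 1
    ext y
    constructor
    · rintro ⟨h1, h2⟩
      exact ⟨-y, ⟨neg_mem_firstZeros_succ.2 h1, by linarith⟩, neg_neg y⟩
    · rintro ⟨z, ⟨h1, h2⟩, rfl⟩
      exact ⟨neg_mem_firstZeros_succ.2 h1, neg_le_neg h2⟩
  rw [h1]
  norm_cast
  rw [← ncard_union_eq ?_ ((firstZeros_finite a _).subset (sep_subset _ _))
    ((firstZeros_finite a _).subset (sep_subset _ _))]
  · congr 1
    ext y
    simp only [mem_union, mem_ofPred_eq]
    have := lt_or_ge x y
    tauto
  · rw [Set.disjoint_left]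
    rintro y ⟨_, hy1⟩ ⟨_, hy2⟩
    linarith

lemma numGe_succ_zero (a : ℝ) (n : ℕ) : numGe a (n + 1) 0 = numGt a (n + 1) 0 := by
  unfold numGt numGe
  congr 2
  ext y
  constructor
  · rintro ⟨h1, h2⟩
    exact ⟨h1, lt_of_le_of_ne h2 (Ne.symm (mem_firstZeros_succ.1 h1).1)⟩
  · rintro ⟨h1, h2⟩
    exact ⟨h1, h2.le⟩

lemma numZeros_succ (a : ℝ) (n : ℕ) : numZeros a (n + 1) = 2 * numGt a n a := by
  have h1 := numGt_add_numGe_neg a n 0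
  rw [neg_zero, numGe_succ_zero, numGt_succ_of_nonneg le_rfl, fa_apply] at h1
  rw [← h1]
  norm_num
  ring

lemma numZeros_zero (a : ℝ) : numZeros a 0 = 1 := by
  simp [numZeros, firstZeros_zero]

/-- The number of first zeros of order `n` to the right of the `m+1`-st critical value,
counted strictly or weakly according to the current kneading sign. -/
noncomputable def numRight (a : ℝ) (m n : ℕ) : ℝ :=
  if theta a m = 1 then numGt a n (crit a (m + 1)) else numGe a n (crit a (m + 1))

lemma theta_mul_numRight_zero (a : ℝ) (m : ℕ) :
    theta a m * numRight a m 0 = (theta a m - theta a (m + 1)) / 2 * numZeros a 0 := by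
  unfold numRight
  rw [numZeros_zero, numGt_zero, numGe_zero]
  rcases lt_trichotomy (crit a (m + 1)) 0 with h | h | h
  · rw [theta_succ_of_neg h, if_pos h, if_pos h.le]
    split_ifs <;> ring
  · rw [theta_succ_of_zero h, h]
    rcases theta_eq_or a m with h1 | h1 <;> rw [h1] <;> norm_num
  · rw [theta_succ_of_pos h, if_neg h.le.not_gt, if_neg h.not_ge]
    split_ifs <;> ring

lemma theta_mul_numRight_succ (a : ℝ) (m n : ℕ) :
    theta a m * numRight a m (n + 1) = (theta a m - theta a (m + 1)) / 2 * numZeros a (n + 1)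
      + theta a (m + 1) * numRight a (m + 1) n := by
  have hsucc : crit a (m + 1 + 1) = fa a (crit a (m + 1)) := by rw [crit_succ, fa_apply]
  have hneg : fa a (-crit a (m + 1)) = fa a (crit a (m + 1)) := by
    rw [fa_apply, fa_apply, neg_sq]
  have h0 := numGt_add_numGe_neg a n (crit a (m + 1))
  have h1 := numGt_add_numGe_neg a n (-crit a (m + 1))
  rw [neg_neg] at h1
  rcases lt_trichotomy (crit a (m + 1)) 0 with h | h | h
  · rw [numGe_succ_of_pos (by linarith), hneg, ← hsucc] at h0
    rw [numGt_succ_of_nonneg (by linarith), hneg, ← hsucc] at h1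
    rw [theta_succ_of_neg h]
    unfold numRight
    rw [theta_succ_of_neg h]
    rcases theta_eq_or a m with h2 | h2
    · rw [h2, if_pos rfl, if_neg (by norm_num)]; linarith
    · rw [h2, if_neg (by norm_num), if_pos (by norm_num)]; linarith
  · have h2 := numZeros_succ a n
    have h3 : numRight a m (n + 1) = numGt a n a := by
      unfold numRight
      rw [h, numGe_succ_zero, numGt_succ_of_nonneg le_rfl, fa_apply]
      norm_num
    have h4 : numRight a (m + 1) n = numGt a n a := by
      unfold numRight
      rw [theta_succ_of_zero h, if_pos rfl, hsucc, h, fa_apply]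
      norm_num
    rw [h3, h4, h2, theta_succ_of_zero h]
    ring
  · unfold numRight
    rw [theta_succ_of_pos h, numGt_succ_of_nonneg h.le, numGe_succ_of_pos h, ← hsucc]
    ring

lemma theta_mul_numRight (a : ℝ) (n m : ℕ) :
    theta a m * numRight a m n = ∑ j ∈ Finset.range (n + 1),
      (theta a (m + j) - theta a (m + j + 1)) / 2 * numZeros a (n - j) := by
  induction n generalizing m with
  | zero => simp [theta_mul_numRight_zero]
  | succ n ih =>
    rw [theta_mul_numRight_succ, ih, Finset.sum_range_succ' _ (n + 1), add_comm]
    congr 1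
    refine Finset.sum_congr rfl fun j _ => ?_
    rw [Nat.succ_sub_succ, show m + 1 + j = m + (j + 1) by ring]

theorem kneading_identity (a : ℝ) (n : ℕ) :
    ∑ j ∈ Finset.range (n + 1), theta a j * numZeros a (n - j) = 1 := by
  induction n with
  | zero => simp [theta_zero, numZeros_zero]
  | succ n ih =>
    have h1 := theta_mul_numRight a n 0
    have h2 : numRight a 0 n = numGt a n a := by
      unfold numRight
      rw [theta_zero, if_pos rfl, zero_add, crit_one]
    rw [h2, theta_zero, one_mul] at h1
    rw [Finset.sum_range_succ', theta_zero, one_mul, Nat.sub_zero, numZeros_succ, h1,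
      Finset.mul_sum, ← Finset.sum_add_distrib, ← ih]
    refine Finset.sum_congr rfl fun j _ => ?_
    rw [Nat.succ_sub_succ, zero_add]
    ring

/-- The power series with coefficients `d`. -/
noncomputable def pser (d : ℕ → ℝ) (t : ℝ) : ℝ := ∑' i, d i * t ^ i

lemma summable_norm_pser {d : ℕ → ℝ} (hd : ∀ i, |d i| ≤ 1) {t : ℝ} (h0 : 0 ≤ t) (h1 : t < 1) :
    Summable fun i => ‖d i * t ^ i‖ := by
  refine Summable.of_nonneg_of_le (fun i => norm_nonneg _) (fun i => ?_)
    (summable_geometric_of_lt_one h0 h1)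
  rw [norm_mul, Real.norm_eq_abs, norm_pow, Real.norm_of_nonneg h0]
  exact mul_le_of_le_one_left (by positivity) (hd i)

lemma summable_pser {d : ℕ → ℝ} (hd : ∀ i, |d i| ≤ 1) {t : ℝ} (h0 : 0 ≤ t) (h1 : t < 1) :
    Summable fun i => d i * t ^ i := (summable_norm_pser hd h0 h1).of_norm

lemma continuousOn_pser {d : ℕ → ℝ} (hd : ∀ i, |d i| ≤ 1) {r : ℝ} (hr0 : 0 ≤ r) (hr : r < 1) :
    ContinuousOn (pser d) (Icc 0 r) := by
  refine continuousOn_tsum (u := fun i => r ^ i) (fun i => by fun_prop)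
    (summable_geometric_of_lt_one hr0 hr) fun i t ht => ?_
  rw [norm_mul, Real.norm_eq_abs, norm_pow, Real.norm_of_nonneg ht.1]
  calc |d i| * t ^ i ≤ 1 * r ^ i := by
        have := ht.1
        have := ht.2
        have := hd i
        gcongr
    _ = r ^ i := one_mul _

lemma firstZeros_ncard_add (a : ℝ) (n : ℕ) :
    lapBound a (n + 1) = lapBound a n + (firstZeros a n).ncard := by
  unfold lapBound
  have h1 : critZeros a (n + 1) = critZeros a n ∪ firstZeros a n := by
    ext x
    constructor
    · rintro ⟨k, hk, hx⟩
      by_cases hc : x ∈ critZeros a n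
      · exact Or.inl hc
      · have hkn : k = n := by
          by_contra hne
          exact hc ⟨k, by omega, hx⟩
        subst hkn
        exact Or.inr ⟨hx, fun i hi h0 => hc ⟨i, hi, h0⟩⟩
    · rintro (⟨k, hk, hx⟩ | hx)
      · exact ⟨k, by omega, hx⟩
      · exact ⟨n, n.lt_succ_self, hx.1⟩
  rw [h1, ncard_union_eq ?_ (critZeros_finite a n) (firstZeros_finite a n)]
  · ring
  · rw [Set.disjoint_left]
    rintro x ⟨k, hk, hx⟩ ⟨_, h2⟩
    exact h2 k hk hx

lemma sum_numZeros (a : ℝ) (n : ℕ) :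
    ∑ k ∈ Finset.range n, numZeros a k = lapBound a n - 1 := by
  induction n with
  | zero => simp [lapBound, critZeros]
  | succ n ih =>
    rw [Finset.sum_range_succ, ih, firstZeros_ncard_add, numZeros]
    push_cast; ring

lemma numZeros_nonneg (a : ℝ) (n : ℕ) : 0 ≤ numZeros a n := Nat.cast_nonneg _

lemma summable_numZeros {a t : ℝ} (h0 : 0 ≤ t) (ht : t < Real.exp (-growth a)) :
    Summable fun n => numZeros a n * t ^ n := by
  obtain ⟨r, hr1, hr2⟩ := exists_between ht
  have hr0 : 0 < r := h0.trans_lt hr1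
  have hc : growth a < -Real.log r := by
    have := (Real.log_lt_log hr0 hr2)
    rw [Real.log_exp] at this
    linarith
  have h1 := eventually_mul_lapBound_le a 1 hc
  have hq : t / r < 1 := (div_lt_one hr0).2 hr1
  refine Summable.of_norm_bounded_eventually_nat
    (g := fun n => r⁻¹ * (t / r) ^ n)
    ((summable_geometric_of_lt_one (by positivity) hq).mul_left _) ?_
  filter_upwards [(tendsto_add_atTop_nat 1).eventually h1] with n hn
  rw [Real.norm_of_nonneg (mul_nonneg (numZeros_nonneg a n) (by positivity))]
  have h2 : numZeros a n ≤ lapBound a (n + 1) := by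
    rw [numZeros, firstZeros_ncard_add]; push_cast; linarith [(lapBound a n).cast_nonneg (α := ℝ)]
  have h3 : (lapBound a (n + 1) : ℝ) ≤ Real.exp (-Real.log r * (n + 1 : ℕ)) := by
    refine le_trans ?_ hn
    have : lapBound a (n + 1) ≤ (n + 1) * (1 * lapBound a (n + 1)) := by
      rw [one_mul]; exact Nat.le_mul_of_pos_left _ n.succ_pos
    exact_mod_cast this
  have h4 : Real.exp (-Real.log r * (n + 1 : ℕ)) = (r⁻¹) ^ (n + 1) := by
    rw [mul_comm, Real.exp_nat_mul, Real.exp_neg, Real.exp_log hr0]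
  rw [h4] at h3
  calc numZeros a n * t ^ n ≤ r⁻¹ ^ (n + 1) * t ^ n := by
        have := h2.trans h3
        gcongr
    _ = r⁻¹ * (t / r) ^ n := by rw [div_eq_mul_inv, mul_pow]; ring

lemma exp_neg_growth_le_one (a : ℝ) : Real.exp (-growth a) ≤ 1 :=
  Real.exp_le_one_iff.2 (by linarith [growth_nonneg a])

lemma abs_theta_le (a : ℝ) (i : ℕ) : |theta a i| ≤ 1 := (abs_theta a i).le

lemma pser_theta_mul {a t : ℝ} (h0 : 0 ≤ t) (ht : t < Real.exp (-growth a)) :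
    pser (theta a) t * (∑' n, numZeros a n * t ^ n) = (1 - t)⁻¹ := by
  have ht1 := ht.trans_le (exp_neg_growth_le_one a)
  have hs := summable_numZeros h0 ht
  rw [pser, tsum_mul_tsum_eq_tsum_sum_range_of_summable_norm
    (summable_norm_pser (abs_theta_le a) h0 ht1) hs.norm, ← tsum_geometric_of_lt_one h0 ht1]
  congr 1
  ext n
  rw [← one_mul (t ^ n), ← kneading_identity a n, Finset.sum_mul]
  refine Finset.sum_congr rfl fun k hk => ?_
  have : k + (n - k) = n := Nat.add_sub_cancel' (Nat.lt_succ_iff.1 (Finset.mem_range.1 hk))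
  calc theta a k * t ^ k * (numZeros a (n - k) * t ^ (n - k))
      = theta a k * numZeros a (n - k) * t ^ (k + (n - k)) := by rw [pow_add]; ring
    _ = _ := by rw [this]

lemma one_le_tsum_numZeros {a t : ℝ} (h0 : 0 ≤ t) (ht : t < Real.exp (-growth a)) :
    1 ≤ ∑' n, numZeros a n * t ^ n := by
  have := (summable_numZeros h0 ht).le_tsum 0
    fun n _ => mul_nonneg (numZeros_nonneg a n) (by positivity)
  simpa [numZeros_zero] using this

lemma pser_theta_pos {a t : ℝ} (h0 : 0 ≤ t) (ht : t < Real.exp (-growth a)) :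
    0 < pser (theta a) t := by
  have h1 := pser_theta_mul h0 ht
  have h2 := one_le_tsum_numZeros h0 ht
  have ht1 := ht.trans_le (exp_neg_growth_le_one a)
  have h3 : 0 < (1 - t)⁻¹ := inv_pos.2 (by linarith)
  rw [← h1] at h3
  exact pos_of_mul_pos_left h3 (by linarith)

lemma one_sub_mul_pser_antitone {a s t : ℝ} (h0 : 0 ≤ s) (hst : s ≤ t)
    (ht : t < Real.exp (-growth a)) :
    (1 - t) * pser (theta a) t ≤ (1 - s) * pser (theta a) s := by
  have key : ∀ t, 0 ≤ t → t < Real.exp (-growth a) →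
      (1 - t) * pser (theta a) t = (∑' n, numZeros a n * t ^ n)⁻¹ := by
    intro t h0 ht
    have h1 := pser_theta_mul h0 ht
    have h2 := one_le_tsum_numZeros h0 ht
    have ht1 := ht.trans_le (exp_neg_growth_le_one a)
    refine eq_inv_of_mul_eq_one_left ?_
    rw [mul_assoc, h1, mul_inv_cancel₀ (by linarith)]
  rw [key t (h0.trans hst) ht, key s h0 (hst.trans_lt ht)]
  have := one_le_tsum_numZeros h0 (hst.trans_lt ht)
  refine inv_anti₀ (by linarith) ?_
  refine (summable_numZeros h0 (hst.trans_lt ht)).tsum_le_tsum (fun n => ?_)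
    (summable_numZeros (h0.trans hst) ht)
  have := numZeros_nonneg a n
  gcongr

lemma one_sub_mul_pser_le {a t : ℝ} (h0 : 0 ≤ t) (ht : t < Real.exp (-growth a)) :
    (1 - t) * pser (theta a) t * (1 - Real.exp (-growth a)) ≤ Real.exp (-growth a) - t := by
  set ρ := Real.exp (-growth a) with hρ
  have hρ0 : 0 < ρ := Real.exp_pos _
  have ht1 : t < 1 := ht.trans_le (exp_neg_growth_le_one a)
  have hs := summable_numZeros h0 ht
  have hg := summable_geometric_of_lt_one h0 ht1
  have h1 := pser_theta_mul h0 ht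
  have h2 := tsum_mul_tsum_eq_tsum_sum_range_of_summable_norm hs.norm hg.norm
  have h2s := (summable_norm_sum_mul_range_of_summable_norm hs.norm hg.norm).of_norm
  have hterm : ∀ n, ∑ k ∈ Finset.range (n + 1), numZeros a k * t ^ k * t ^ (n - k)
      = (lapBound a (n + 1) - 1) * t ^ n := by
    intro n
    rw [← sum_numZeros, Finset.sum_mul]
    refine Finset.sum_congr rfl fun k hk => ?_
    rw [mul_assoc, ← pow_add, Nat.add_sub_cancel' (Nat.lt_succ_iff.1 (Finset.mem_range.1 hk))]
  simp_rw [hterm] at h2 h2s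
  have htρ : t / ρ < 1 := (div_lt_one hρ0).2 ht
  have hg2 := (summable_geometric_of_lt_one (div_nonneg h0 hρ0.le) htρ).mul_left ρ⁻¹
  have h3 : ∑' n, (ρ⁻¹ * (t / ρ) ^ n - t ^ n) ≤ ∑' n, ((lapBound a (n + 1) : ℝ) - 1) * t ^ n := by
    refine (hg2.sub hg).tsum_le_tsum (fun n => ?_) h2s
    have h4 := exp_growth_le a (n + 1)
    have h5 : Real.exp ((n + 1 : ℕ) * growth a) = ρ⁻¹ ^ (n + 1) := by
      rw [Real.exp_nat_mul, hρ, Real.exp_neg, inv_inv]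
    rw [h5] at h4
    have h6 : ρ⁻¹ * (t / ρ) ^ n = ρ⁻¹ ^ (n + 1) * t ^ n := by
      rw [div_eq_mul_inv, mul_pow]; ring
    rw [h6, sub_mul, one_mul]
    gcongr
  rw [hg2.tsum_sub hg, tsum_mul_left, tsum_geometric_of_lt_one (div_nonneg h0 hρ0.le) htρ,
    tsum_geometric_of_lt_one h0 ht1, ← h2, tsum_geometric_of_lt_one h0 ht1] at h3
  set N := ∑' n, numZeros a n * t ^ n
  have hD := pser_theta_pos h0 ht
  set D := pser (theta a) t
  have h1t : 0 < 1 - t := by linarith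
  have hρt : 0 < ρ - t := by linarith
  have h7 : ρ⁻¹ * (1 - t / ρ)⁻¹ = (ρ - t)⁻¹ := by
    rw [← mul_inv]; congr 1; field_simp
  rw [h7] at h3
  have h8 : (1 - ρ) ≤ N * (ρ - t) := by
    have h9 := mul_le_mul_of_nonneg_right h3 (mul_pos h1t hρt).le
    have h10 : ((ρ - t)⁻¹ - (1 - t)⁻¹) * ((1 - t) * (ρ - t)) = (1 - t) - (ρ - t) := by
      field_simp
    have h11 : N * (1 - t)⁻¹ * ((1 - t) * (ρ - t)) = N * (ρ - t) := by
      field_simp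
    rw [h10, h11] at h9
    linarith
  have h12 : (1 - t) * D * N = 1 := by rw [mul_assoc, h1]; exact mul_inv_cancel₀ h1t.ne'
  calc (1 - t) * D * (1 - ρ) ≤ (1 - t) * D * (N * (ρ - t)) := by
        have := mul_pos h1t hD
        gcongr
    _ = ((1 - t) * D * N) * (ρ - t) := by ring
    _ = ρ - t := by rw [h12, one_mul]

lemma tendsto_pser_theta {a : ℝ} (hH : 0 < growth a) :
    Tendsto (pser (theta a)) (nhdsWithin (Real.exp (-growth a)) (Iio (Real.exp (-growth a))))
      (nhds (pser (theta a) (Real.exp (-growth a)))) := by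
  have hρ1 : Real.exp (-growth a) < 1 := Real.exp_lt_one_iff.2 (by linarith)
  have hρ0 := Real.exp_pos (-growth a)
  have h1 := continuousOn_pser (abs_theta_le a) hρ0.le hρ1 _ (right_mem_Icc.2 hρ0.le)
  exact h1.tendsto.mono_left (nhdsWithin_le_of_mem (Icc_mem_nhdsLT hρ0))

theorem pser_theta_root {a : ℝ} (hH : 0 < growth a) :
    pser (theta a) (Real.exp (-growth a)) = 0 := by
  have hρ1 : Real.exp (-growth a) < 1 := Real.exp_lt_one_iff.2 (by linarith)
  have hρ0 := Real.exp_pos (-growth a)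
  have h1 := tendsto_pser_theta hH
  have hmem : ∀ᶠ t in nhdsWithin (Real.exp (-growth a)) (Iio (Real.exp (-growth a))),
      0 ≤ t ∧ t < Real.exp (-growth a) := by
    filter_upwards [Ico_mem_nhdsLT hρ0] with t ht using ht
  refine le_antisymm ?_ (ge_of_tendsto h1 (hmem.mono fun t ht => (pser_theta_pos ht.1 ht.2).le))
  set ρ := Real.exp (-growth a)
  have hid : Tendsto (fun t : ℝ => t) (nhdsWithin ρ (Iio ρ)) (nhds ρ) :=
    tendsto_id.mono_left nhdsWithin_le_nhds
  have h2 : Tendsto (fun t => (1 - t) * pser (theta a) t * (1 - ρ)) (nhdsWithin ρ (Iio ρ))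
      (nhds ((1 - ρ) * pser (theta a) ρ * (1 - ρ))) :=
    (((tendsto_const_nhds.sub hid).mul h1).mul_const _)
  have h3 : Tendsto (fun t => ρ - t) (nhdsWithin ρ (Iio ρ)) (nhds (ρ - ρ)) :=
    tendsto_const_nhds.sub hid
  have h4 := le_of_tendsto_of_tendsto h2 h3 (hmem.mono fun t ht => one_sub_mul_pser_le ht.1 ht.2)
  rw [sub_self] at h4
  by_contra hcon
  rw [not_le] at hcon
  have : 0 < (1 - ρ) * pser (theta a) ρ * (1 - ρ) := by
    have : 0 < 1 - ρ := by linarith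
    positivity
  linarith

lemma one_sub_mul_pser_antitone' {a s t : ℝ} (hH : 0 < growth a) (h0 : 0 ≤ s) (hst : s ≤ t)
    (ht : t ≤ Real.exp (-growth a)) :
    (1 - t) * pser (theta a) t ≤ (1 - s) * pser (theta a) s := by
  rcases ht.lt_or_eq with h | h
  · exact one_sub_mul_pser_antitone h0 hst h
  rcases hst.lt_or_eq with hlt | heq
  · rw [h, pser_theta_root hH, mul_zero]
    have hs : s < Real.exp (-growth a) := by linarith
    have := hs.trans_le (exp_neg_growth_le_one a)
    exact mul_nonneg (by linarith) (pser_theta_pos h0 hs).le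
  · rw [heq]

/-- The divided difference of the `n`-th iterate. -/
noncomputable def sec (a : ℝ) (n : ℕ) (x y : ℝ) : ℝ :=
  ∏ i ∈ Finset.range n, ((fa a)^[i] x + (fa a)^[i] y)

lemma sec_succ (a : ℝ) (n : ℕ) (x y : ℝ) :
    sec a (n + 1) x y = sec a n x y * ((fa a)^[n] x + (fa a)^[n] y) :=
  Finset.prod_range_succ _ _

lemma sec_succ' (a : ℝ) (n : ℕ) (x y : ℝ) :
    sec a (n + 1) x y = sec a n (fa a x) (fa a y) * (x + y) :=
  Finset.prod_range_succ' _ _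

lemma sec_add (a : ℝ) (m n : ℕ) (x y : ℝ) :
    sec a (n + m) x y = sec a n x y * sec a m ((fa a)^[n] x) ((fa a)^[n] y) := by
  unfold sec
  rw [Finset.prod_range_add]
  simp_rw [add_comm n, iter_add]

lemma iter_sub_iter (a : ℝ) (n : ℕ) (x y : ℝ) :
    (fa a)^[n] x - (fa a)^[n] y = (x - y) * sec a n x y := by
  induction n with
  | zero => simp [sec]
  | succ n ih =>
    rw [iter_succ, iter_succ, sec_succ, ← mul_assoc, ← ih]; ring

/-- The four numbers are in monotone order, increasing or decreasing. -/
def MonoOrd (p q r s : ℝ) : Prop := (p ≤ q ∧ q ≤ r ∧ r ≤ s) ∨ (s ≤ r ∧ r ≤ q ∧ q ≤ p)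

lemma MonoOrd.signs {p q r s : ℝ} (ho : MonoOrd p q r s) (hps : 0 ≤ p * s) :
    (0 ≤ p ∧ 0 ≤ q ∧ 0 ≤ r ∧ 0 ≤ s) ∨ (p ≤ 0 ∧ q ≤ 0 ∧ r ≤ 0 ∧ s ≤ 0) := by
  rcases ho with ⟨h1, h2, h3⟩ | ⟨h1, h2, h3⟩
  · rcases le_or_gt 0 p with h | h
    · left; exact ⟨h, by linarith, by linarith, by linarith⟩
    · have : s ≤ 0 := by by_contra hc; rw [not_le] at hc; nlinarith
      right; exact ⟨h.le, by linarith, by linarith, this⟩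
  · rcases le_or_gt 0 s with h | h
    · left; exact ⟨by linarith, by linarith, by linarith, h⟩
    · have : p ≤ 0 := by by_contra hc; rw [not_le] at hc; nlinarith
      right; exact ⟨this, by linarith, by linarith, h.le⟩

lemma MonoOrd.map_fa {p q r s : ℝ} (ho : MonoOrd p q r s) (hps : 0 ≤ p * s) (a : ℝ) :
    MonoOrd (p ^ 2 + a) (q ^ 2 + a) (r ^ 2 + a) (s ^ 2 + a) := by
  have hs := ho.signs hps
  unfold MonoOrd at *
  rcases hs with ⟨h1, h2, h3, h4⟩ | ⟨h1, h2, h3, h4⟩ <;>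
    rcases ho with ⟨h5, h6, h7⟩ | ⟨h5, h6, h7⟩
  · left; refine ⟨?_, ?_, ?_⟩ <;> nlinarith
  · right; refine ⟨?_, ?_, ?_⟩ <;> nlinarith
  · right; refine ⟨?_, ?_, ?_⟩ <;> nlinarith
  · left; refine ⟨?_, ?_, ?_⟩ <;> nlinarith

lemma MonoOrd.add_mul_add {p q r s : ℝ} (ho : MonoOrd p q r s) (hps : 0 ≤ p * s) :
    0 ≤ (p + q) * (r + s) ∧ (p + q) * (r + s) ≤ (p + r) * (q + s) ∧
      (p + q) * (r + s) ≤ (q + r) * (p + s) := by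
  have hs := ho.signs hps
  have h0 : 0 ≤ (p + q) * (r + s) := by
    rcases hs with ⟨h1, h2, h3, h4⟩ | ⟨h1, h2, h3, h4⟩
    · positivity
    · exact mul_nonneg_of_nonpos_of_nonpos (by linarith) (by linarith)
  have h1 : 0 ≤ (p - s) * (q - r) := by
    rcases ho with ⟨h5, h6, h7⟩ | ⟨h5, h6, h7⟩
    · exact mul_nonneg_of_nonpos_of_nonpos (by linarith) (by linarith)
    · exact mul_nonneg (by linarith) (by linarith)
  have h2 : 0 ≤ (p - r) * (q - s) := by
    rcases ho with ⟨h5, h6, h7⟩ | ⟨h5, h6, h7⟩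
    · exact mul_nonneg_of_nonpos_of_nonpos (by linarith) (by linarith)
    · exact mul_nonneg (by linarith) (by linarith)
  exact ⟨h0, by linarith, by linarith⟩

lemma monoOrd_iter {a : ℝ} {n : ℕ} {A B C D : ℝ} (hAB : A ≤ B) (hBC : B ≤ C) (hCD : C ≤ D)
    (hs : ∀ i < n, 0 ≤ (fa a)^[i] A * (fa a)^[i] D) {i : ℕ} (hi : i ≤ n) :
    MonoOrd ((fa a)^[i] A) ((fa a)^[i] B) ((fa a)^[i] C) ((fa a)^[i] D) := by
  induction i with
  | zero => exact Or.inl ⟨hAB, hBC, hCD⟩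
  | succ i ih =>
    simp only [iter_succ]
    exact (ih (by omega)).map_fa (hs i (by omega)) a

lemma sec_quad {a : ℝ} {n : ℕ} {A B C D : ℝ} (hAB : A ≤ B) (hBC : B ≤ C) (hCD : C ≤ D)
    (hs : ∀ i < n, 0 ≤ (fa a)^[i] A * (fa a)^[i] D) :
    |sec a n A B| * |sec a n C D| ≤ |sec a n A C| * |sec a n B D| ∧
      |sec a n A B| * |sec a n C D| ≤ |sec a n B C| * |sec a n A D| := by
  have key := fun i (hi : i ∈ Finset.range n) =>
    (monoOrd_iter hAB hBC hCD hs (Finset.mem_range.1 hi).le).add_mul_add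
      (hs i (Finset.mem_range.1 hi))
  simp only [← abs_mul]
  unfold sec
  simp only [← Finset.prod_mul_distrib]
  have h0 := Finset.prod_nonneg fun i hi => (key i hi).1
  have h1 := Finset.prod_le_prod (fun i hi => (key i hi).1) fun i hi => (key i hi).2.1
  have h2 := Finset.prod_le_prod (fun i hi => (key i hi).1) fun i hi => (key i hi).2.2
  rw [abs_of_nonneg h0, abs_of_nonneg (h0.trans h1), abs_of_nonneg (h0.trans h2)]
  exact ⟨h1, h2⟩

/-- `[-q, q]` is a restrictive interval of period `n`, with orientation `σ`. -/
structure Window (a : ℝ) (n : ℕ) (σ q : ℝ) : Prop where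
  n_pos : 0 < n
  sign_or : σ = 1 ∨ σ = -1
  q_pos : 0 < q
  fixed : (fa a)^[n] q = σ * q
  sameSign : ∀ i, 0 < i → i < n → ∀ x, |x| ≤ q → 0 < (fa a)^[i] x * crit a i
  crit_le : |crit a n| ≤ q
  theta_pred : theta a (n - 1) = σ

namespace Window

variable {a : ℝ} {n : ℕ} {σ q : ℝ}

lemma sign_mul_self (w : Window a n σ q) : σ * σ = 1 := by
  rcases w.sign_or with h | h <;> rw [h] <;> norm_num

lemma abs_sign (w : Window a n σ q) : |σ| = 1 := by
  rcases w.sign_or with h | h <;> rw [h] <;> norm_num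

lemma theta_mul_sec_pos (w : Window a n σ q) {x y : ℝ} (hx : |x| ≤ q) (hy : |y| ≤ q)
    (hxy : 0 < x + y) {m : ℕ} (hm : m < n) : 0 < theta a m * sec a (m + 1) x y := by
  induction m with
  | zero => simpa [theta_zero, sec] using hxy
  | succ m ih =>
    have h1 := ih (by omega)
    have h2 := w.sameSign (m + 1) m.succ_pos hm x hx
    have h3 := w.sameSign (m + 1) m.succ_pos hm y hy
    rw [sec_succ]
    rcases lt_trichotomy (crit a (m + 1)) 0 with h | h | h
    · rw [theta_succ_of_neg h]
      have h4 : (fa a)^[m + 1] x < 0 := by by_contra hc; rw [not_lt] at hc; nlinarith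
      have h5 : (fa a)^[m + 1] y < 0 := by by_contra hc; rw [not_lt] at hc; nlinarith
      have := mul_pos h1 (show 0 < -((fa a)^[m + 1] x + (fa a)^[m + 1] y) by linarith)
      linarith
    · rw [h, mul_zero] at h2; exact absurd h2 (lt_irrefl _)
    · rw [theta_succ_of_pos h]
      have h4 := pos_of_mul_pos_left h2 h.le
      have h5 := pos_of_mul_pos_left h3 h.le
      rw [← mul_assoc]
      positivity

lemma sign_mul_sec_pos (w : Window a n σ q) {x y : ℝ} (hx : |x| ≤ q) (hy : |y| ≤ q)
    (hxy : 0 < x + y) : 0 < σ * sec a n x y := by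
  have := w.theta_mul_sec_pos hx hy hxy (m := n - 1) (Nat.sub_lt w.n_pos one_pos)
  rwa [w.theta_pred, Nat.sub_add_cancel (show 1 ≤ n from w.n_pos)] at this

lemma strictMono (w : Window a n σ q) {x y : ℝ} (hx : 0 ≤ x) (hxy : x < y) (hy : y ≤ q) :
    σ * (fa a)^[n] x < σ * (fa a)^[n] y := by
  have h1 := w.sign_mul_sec_pos (x := y) (y := x) (by rw [abs_of_nonneg] <;> linarith)
    (by rw [abs_of_nonneg] <;> linarith) (by linarith)
  have h2 := iter_sub_iter a n y x
  have h3 : σ * (fa a)^[n] y - σ * (fa a)^[n] x = (y - x) * (σ * sec a n y x) := by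
    rw [← mul_sub, h2]; ring
  have := mul_pos (sub_pos.2 hxy) h1
  linarith

lemma mono (w : Window a n σ q) {x y : ℝ} (hx : 0 ≤ x) (hxy : x ≤ y) (hy : y ≤ q) :
    σ * (fa a)^[n] x ≤ σ * (fa a)^[n] y := by
  rcases hxy.lt_or_eq with h | h
  · exact (w.strictMono hx h hy).le
  · rw [h]

lemma sign_mul_fixed (w : Window a n σ q) : σ * (fa a)^[n] q = q := by
  rw [w.fixed, ← mul_assoc, w.sign_mul_self, one_mul]

lemma abs_sign_mul (w : Window a n σ q) (x : ℝ) : |σ * x| = |x| := by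
  rw [abs_mul, w.abs_sign, one_mul]

lemma sign_crit_le (w : Window a n σ q) {x : ℝ} (hx : |x| ≤ q) :
    σ * crit a n ≤ σ * (fa a)^[n] x := by
  rw [← iter_abs a n w.n_pos x]
  exact w.mono le_rfl (abs_nonneg x) hx

lemma maps (w : Window a n σ q) {x : ℝ} (hx : |x| ≤ q) : |(fa a)^[n] x| ≤ q := by
  have h1 := w.sign_crit_le hx
  have h2 := w.mono (abs_nonneg x) hx le_rfl
  rw [w.sign_mul_fixed, iter_abs a n w.n_pos] at h2
  have h3 := w.crit_le
  rw [← w.abs_sign_mul, abs_le] at h3 ⊢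
  exact ⟨h3.1.trans h1, h2⟩

lemma abs_crit_le (w : Window a n σ q) (j : ℕ) : |crit a (n * j)| ≤ q := by
  induction j with
  | zero => rw [mul_zero, crit_zero, abs_zero]; exact w.q_pos.le
  | succ j ih => rw [Nat.mul_succ, add_comm, crit_add]; exact w.maps ih

lemma sameSign_crit (w : Window a n σ q) {i : ℕ} (hi : 0 < i) (hin : i < n) (j : ℕ) :
    0 < crit a (n * j + i) * crit a i := by
  rw [add_comm, crit_add]
  exact w.sameSign i hi hin _ (w.abs_crit_le j)

lemma theta_mul_add (w : Window a n σ q) (j : ℕ) {i : ℕ} (hin : i < n) :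
    theta a (n * j + i) = theta a (n * j) * theta a i := by
  induction i with
  | zero => rw [theta_zero, mul_one, add_zero]
  | succ i ih =>
    have h1 : 0 < crit a (n * j + i + 1) * crit a (i + 1) := w.sameSign_crit i.succ_pos hin j
    have h2 := ih (by omega)
    rw [← add_assoc]
    rcases lt_trichotomy (crit a (i + 1)) 0 with h | h | h
    · have h3 : crit a (n * j + i + 1) < 0 := by by_contra hc; rw [not_lt] at hc; nlinarith
      rw [theta_succ_of_neg h, theta_succ_of_neg h3, h2]; ring
    · rw [h, mul_zero] at h1; exact absurd h1 (lt_irrefl _)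
    · have h3 := pos_of_mul_pos_left h1 h.le
      rw [theta_succ_of_pos h, theta_succ_of_pos h3, h2]

lemma theta_mul_succ_pred (w : Window a n σ q) (j : ℕ) :
    theta a (n * j + (n - 1)) = theta a (n * j) * σ := by
  rw [w.theta_mul_add j (Nat.sub_lt w.n_pos one_pos), w.theta_pred]

lemma mul_succ_eq (w : Window a n σ q) (j : ℕ) : n * (j + 1) = n * j + (n - 1) + 1 := by
  have := w.n_pos
  rw [Nat.mul_succ]; omega

lemma theta_mul_succ_of_neg (w : Window a n σ q) {j : ℕ} (hj : σ * crit a (n * (j + 1)) < 0) :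
    theta a (n * (j + 1)) = -theta a (n * j) := by
  have h1 := w.theta_mul_succ_pred j
  rw [w.mul_succ_eq] at *
  rcases w.sign_or with h | h <;> rw [h] at hj h1
  · rw [theta_succ_of_neg (by linarith), h1, mul_one]
  · rw [theta_succ_of_pos (by linarith), h1]; ring

lemma theta_mul_succ_of_pos (w : Window a n σ q) {j : ℕ} (hj : 0 < σ * crit a (n * (j + 1))) :
    theta a (n * (j + 1)) = theta a (n * j) := by
  have h1 := w.theta_mul_succ_pred j
  rw [w.mul_succ_eq] at *
  rcases w.sign_or with h | h <;> rw [h] at hj h1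
  · rw [theta_succ_of_pos (by linarith), h1, mul_one]
  · rw [theta_succ_of_neg (by linarith), h1]; ring

lemma theta_mul_eq_one (w : Window a n σ q) (hc : 0 ≤ σ * crit a n) (j : ℕ) :
    theta a (n * j) = 1 := by
  induction j with
  | zero => exact theta_zero a
  | succ j ih =>
    have h1 : 0 ≤ σ * crit a (n * (j + 1)) := by
      have := w.sign_crit_le (w.abs_crit_le j)
      rw [Nat.mul_succ, add_comm, crit_add]
      exact hc.trans this
    rcases h1.lt_or_eq with h | h
    · rw [w.theta_mul_succ_of_pos h, ih]
    · have h0 : crit a (n * (j + 1)) = 0 := by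
        rcases mul_eq_zero.1 h.symm with h' | h'
        · have := w.sign_mul_self; rw [h'] at this; norm_num at this
        · exact h'
      rw [w.mul_succ_eq] at *
      exact theta_succ_of_zero h0

end Window

lemma pser_factor {d e : ℕ → ℝ} {n : ℕ} (hn : 0 < n) (hd : ∀ i, |d i| ≤ 1) (he : ∀ i, |e i| ≤ 1)
    (hde : ∀ j, ∀ i < n, d (n * j + i) = e j * d i) {t : ℝ} (h0 : 0 ≤ t) (h1 : t < 1) :
    pser d t = (∑ i ∈ Finset.range n, d i * t ^ i) * pser e (t ^ n) := by
  have hpart : ∀ J, ∑ l ∈ Finset.range (n * J), d l * t ^ l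
      = (∑ i ∈ Finset.range n, d i * t ^ i) * ∑ j ∈ Finset.range J, e j * (t ^ n) ^ j := by
    intro J
    induction J with
    | zero => simp
    | succ J ih =>
      rw [Nat.mul_succ, Finset.sum_range_add, ih, Finset.sum_range_succ, mul_add]
      congr 1
      rw [Finset.sum_mul]
      refine Finset.sum_congr rfl fun i hi => ?_
      rw [hde J i (Finset.mem_range.1 hi), pow_add, pow_mul]
      ring
  have ht : t ^ n < 1 := pow_lt_one₀ h0 h1 hn.ne'
  have hs1 := (summable_pser hd h0 h1).hasSum.tendsto_sum_nat
  have hs2 := (summable_pser he (pow_nonneg h0 n) ht).hasSum.tendsto_sum_nat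
  have h4 : Tendsto (fun J : ℕ => n * J) atTop atTop := tendsto_id.const_mul_atTop' hn
  have h5 := hs1.comp h4
  have h6 : Tendsto (fun J => ∑ l ∈ Finset.range (n * J), d l * t ^ l) atTop
      (nhds ((∑ i ∈ Finset.range n, d i * t ^ i) * pser e (t ^ n))) := by
    simp_rw [hpart]
    exact hs2.const_mul _
  exact tendsto_nhds_unique h5 h6

lemma pser_pow {τ : ℝ} (hτ : |τ| ≤ 1) {t : ℝ} (h0 : 0 ≤ t) (h1 : t < 1) :
    pser (fun j => τ ^ j) t = (1 - τ * t)⁻¹ := by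
  unfold pser
  simp_rw [← mul_pow]
  refine tsum_geometric_of_abs_lt_one ?_
  rw [abs_mul, abs_of_nonneg h0]
  calc |τ| * t ≤ 1 * t := by gcongr
    _ < 1 := by linarith

/-- The truncation of the kneading series. -/
noncomputable def kpoly (a : ℝ) (n : ℕ) (t : ℝ) : ℝ := ∑ i ∈ Finset.range n, theta a i * t ^ i

namespace Window

variable {a : ℝ} {n : ℕ} {σ q : ℝ}

lemma pser_theta (w : Window a n σ q) {t : ℝ} (h0 : 0 ≤ t) (h1 : t < 1) :
    pser (theta a) t = kpoly a n t * pser (fun j => theta a (n * j)) (t ^ n) :=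
  pser_factor w.n_pos (abs_theta_le a) (fun _ => abs_theta_le a _)
    (fun j _ hi => w.theta_mul_add j hi) h0 h1

lemma theta_eq_neg_one (w : Window a n σ q) (hc : σ * crit a n < 0) : theta a n = -1 := by
  have h := w.theta_mul_succ_of_neg (j := 0) (by simpa using hc)
  simpa [theta_zero] using h

lemma kpoly_double (w : Window a n σ q) (hc : σ * crit a n < 0) (t : ℝ) :
    kpoly a (2 * n) t = kpoly a n t * (1 - t ^ n) := by
  unfold kpoly
  rw [two_mul, Finset.sum_range_add, mul_sub, mul_one, sub_eq_add_neg]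
  congr 1
  rw [Finset.sum_mul, ← Finset.sum_neg_distrib]
  refine Finset.sum_congr rfl fun i hi => ?_
  have := w.theta_mul_add 1 (Finset.mem_range.1 hi)
  rw [mul_one, w.theta_eq_neg_one hc] at this
  rw [this, pow_add]; ring

lemma crit_sign_neg (w : Window a n σ q)
    (hP : ∀ t, 0 < t → t < 1 → 0 < kpoly a n t) (hH : 0 < growth a) : σ * crit a n < 0 := by
  by_contra hc
  rw [not_lt] at hc
  set ρ := Real.exp (-growth a) with hρ
  have hρ0 : 0 < ρ := Real.exp_pos _
  have hρ1 : ρ < 1 := Real.exp_lt_one_iff.2 (by linarith)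
  have h1 := pser_theta_root hH
  rw [← hρ, w.pser_theta hρ0.le hρ1] at h1
  have h2 : (fun j => theta a (n * j)) = fun j => (1 : ℝ) ^ j := by
    ext j; rw [w.theta_mul_eq_one hc, one_pow]
  have h3 : ρ ^ n < 1 := pow_lt_one₀ hρ0.le hρ1 w.n_pos.ne'
  rw [h2, pser_pow (by simp) (by positivity) h3, one_mul] at h1
  have h4 := hP ρ hρ0 hρ1
  have h5 : 0 < (1 - ρ ^ n)⁻¹ := inv_pos.2 (by linarith)
  exact (mul_pos h4 h5).ne' h1

end Window

lemma two_pow_le_lapBound {a p : ℝ} {m : ℕ} (hm : 0 < m)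
    (hsurj : ∀ w, |w| ≤ p → ∃ x, 0 < x ∧ x ≤ p ∧ (fa a)^[m] x = w) (hp : 0 ≤ p) (j : ℕ) :
    2 ^ j ≤ lapBound a (m * j + 1) := by
  classical
  have key : ∀ j, ∃ S : Finset ℝ, S.card = 2 ^ j ∧ ∀ x ∈ S, |x| ≤ p ∧ (fa a)^[m * j] x = 0 := by
    intro j
    induction j with
    | zero => exact ⟨{0}, by simp, by simp [hp]⟩
    | succ j ih =>
      obtain ⟨S, hcard, hS⟩ := ih
      have hex : ∀ w ∈ S, ∃ x, 0 < x ∧ x ≤ p ∧ (fa a)^[m] x = w := fun w hw => hsurj w (hS w hw).1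
      choose! g hg0 hgp hg using hex
      have hinj : InjOn g S := fun x hx y hy hxy => by rw [← hg x hx, ← hg y hy, hxy]
      refine ⟨S.image g ∪ S.image (fun x => -g x), ?_, ?_⟩
      · rw [Finset.card_union_of_disjoint, Finset.card_image_of_injOn hinj,
          Finset.card_image_of_injOn (fun x hx y hy hxy => hinj hx hy (neg_injective hxy)), hcard]
        · ring
        · rw [Finset.disjoint_left]
          intro x hx hx'
          obtain ⟨u, hu, rfl⟩ := Finset.mem_image.1 hx
          obtain ⟨v, hv, hvu⟩ := Finset.mem_image.1 hx'
          have := hg0 u hu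
          have := hg0 v hv
          linarith
      · intro x hx
        rcases Finset.mem_union.1 hx with hx | hx <;> obtain ⟨w, hw, rfl⟩ := Finset.mem_image.1 hx
        · refine ⟨by rw [abs_of_pos (hg0 w hw)]; exact hgp w hw, ?_⟩
          rw [Nat.mul_succ, iter_add, hg w hw, (hS w hw).2]
        · refine ⟨by rw [abs_neg, abs_of_pos (hg0 w hw)]; exact hgp w hw, ?_⟩
          rw [Nat.mul_succ, iter_add, iter_neg a m hm, hg w hw, (hS w hw).2]
  obtain ⟨S, hcard, hS⟩ := key j
  rw [← hcard, ← ncard_coe_finset]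
  refine (ncard_le_ncard (t := critZeros a (m * j + 1)) ?_ (critZeros_finite a _)).trans
    (Nat.le_succ _)
  exact fun x hx => ⟨m * j, Nat.lt_succ_self _, (hS x hx).2⟩

lemma log_two_div_le_growth {a p : ℝ} {m : ℕ} (hm : 0 < m)
    (hsurj : ∀ w, |w| ≤ p → ∃ x, 0 < x ∧ x ≤ p ∧ (fa a)^[m] x = w) (hp : 0 ≤ p) :
    Real.log 2 / m ≤ growth a := by
  have hm' : (0 : ℝ) < m := by exact_mod_cast hm
  by_contra hcon
  rw [not_le, lt_div_iff₀ hm'] at hcon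
  have h1 : ∀ᶠ n : ℕ in atTop, Real.log (lapBound a n) / n
      < (growth a + Real.log 2 / m) / 2 := by
    refine (tendsto_growth a).eventually_lt_const ?_
    have : growth a < Real.log 2 / m := (lt_div_iff₀ hm').2 hcon
    linarith
  have h2 : Tendsto (fun j : ℕ => m * j + 1) atTop atTop :=
    (tendsto_add_atTop_nat 1).comp (tendsto_id.const_mul_atTop' hm)
  have h3 : ∀ᶠ j : ℕ in atTop,
      (growth a + Real.log 2 / m) / (Real.log 2 / m - growth a) < m * j := by
    have : Tendsto (fun j : ℕ => (m : ℝ) * j) atTop atTop :=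
      tendsto_natCast_atTop_atTop.const_mul_atTop hm'
    exact this.eventually_gt_atTop _
  obtain ⟨j, hj1, hj2⟩ := ((h2.eventually h1).and h3).exists
  set x := Real.log 2 / m with hx
  have hgx : growth a < x := (lt_div_iff₀ hm').2 hcon
  rw [div_lt_iff₀ (by linarith)] at hj2
  rw [div_lt_iff₀ (by positivity)] at hj1
  have h4 : (j : ℝ) * Real.log 2 ≤ Real.log (lapBound a (m * j + 1)) := by
    rw [← Real.log_pow]
    refine Real.log_le_log (by positivity) ?_
    exact_mod_cast two_pow_le_lapBound hm hsurj hp j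
  have h5 : Real.log 2 = x * m := by rw [hx, div_mul_cancel₀ _ hm'.ne']
  rw [h5] at h4
  push_cast at hj1
  nlinarith

lemma abs_iter_sub (a : ℝ) (n : ℕ) (x y : ℝ) :
    |(fa a)^[n] x - (fa a)^[n] y| = |x - y| * |sec a n x y| := by
  rw [iter_sub_iter, abs_mul]

lemma iter_pred {a : ℝ} {n : ℕ} (hn : 0 < n) (x : ℝ) :
    (fa a)^[n - 1] (x ^ 2 + a) = (fa a)^[n] x := by
  obtain ⟨m, rfl⟩ : ∃ m, n = m + 1 := ⟨n - 1, by omega⟩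
  rfl

lemma iter_pred_self {a : ℝ} {n : ℕ} (hn : 0 < n) : (fa a)^[n - 1] a = crit a n := by
  have := iter_pred (a := a) hn 0
  rwa [zero_pow two_ne_zero, zero_add] at this

lemma sec_eq_pred {a : ℝ} {n : ℕ} (hn : 0 < n) (x y : ℝ) :
    sec a n x y = sec a (n - 1) (x ^ 2 + a) (y ^ 2 + a) * (x + y) := by
  obtain ⟨m, rfl⟩ : ∃ m, n = m + 1 := ⟨n - 1, by omega⟩
  exact sec_succ' a m x y

lemma abs_sec_neg {a : ℝ} {n : ℕ} (hn : 0 < n) (x : ℝ) :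
    |sec a n (-x) (-x)| = |sec a n x x| := by
  rw [sec_eq_pred hn, sec_eq_pred hn x, neg_sq, abs_mul, abs_mul, ← neg_add, abs_neg]

/-- A restrictive interval for which the renormalised critical value lies on the far side of
the critical point; `v` extends the monotone branch of `f^(n-1)` beyond the critical value. -/
structure Level (a : ℝ) (n : ℕ) (σ q Q v : ℝ) : Prop extends Window a n σ q where
  crit_neg : σ * crit a n < 0
  one_le_sec : 1 ≤ |sec a n q q|
  v_le : v ≤ a
  v_sign : ∀ i, i + 1 < n → 0 < (fa a)^[i] v * crit a (i + 1)
  v_iter : (fa a)^[n - 1] v = -(σ * Q)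
  le_Q : 9 / 8 * q ≤ Q

lemma mul_pos_of_common {x y c : ℝ} (hx : 0 < x * c) (hy : 0 < y * c) : 0 < x * y := by
  have h := mul_pos hx hy
  have h2 : x * c * (y * c) = (x * y) * c ^ 2 := by ring
  rw [h2] at h
  exact pos_of_mul_pos_left h (sq_nonneg c)

namespace Level

variable {a : ℝ} {n : ℕ} {σ q Q v : ℝ}

lemma sign_quad_window (L : Level a n σ q Q v) {x y : ℝ} (hx : |x| ≤ q) (hy : |y| ≤ q) :
    ∀ i < n - 1, 0 ≤ (fa a)^[i] (x ^ 2 + a) * (fa a)^[i] (y ^ 2 + a) := by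
  intro i hi
  have h1 := L.sameSign (i + 1) i.succ_pos (by omega) x hx
  have h2 := L.sameSign (i + 1) i.succ_pos (by omega) y hy
  exact (mul_pos_of_common h1 h2).le

lemma sign_quad_v (L : Level a n σ q Q v) {y : ℝ} (hy : |y| ≤ q) :
    ∀ i < n - 1, 0 ≤ (fa a)^[i] v * (fa a)^[i] (y ^ 2 + a) := by
  intro i hi
  have h1 := L.v_sign i (by omega)
  have h2 := L.sameSign (i + 1) i.succ_pos (by omega) y hy
  exact (mul_pos_of_common h1 h2).le

lemma abs_sub_le (L : Level a n σ q Q v) {x y : ℝ} (hx : |x| ≤ q) (hy : |y| ≤ q) :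
    |(fa a)^[n] x - (fa a)^[n] y| ≤ 2 * q := by
  have h1 := abs_le.1 (L.maps hx)
  have h2 := abs_le.1 (L.maps hy)
  rw [abs_le]; constructor <;> linarith [h1.1, h1.2, h2.1, h2.2]

lemma abs_sub_eq (L : Level a n σ q Q v) (x y : ℝ) :
    |(fa a)^[n] x - (fa a)^[n] y|
      = |x ^ 2 - y ^ 2| * |sec a (n - 1) (x ^ 2 + a) (y ^ 2 + a)| := by
  rw [← iter_pred L.n_pos x, ← iter_pred L.n_pos y, abs_iter_sub]
  congr 2; ring

lemma one_le_sec_pred (L : Level a n σ q Q v) :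
    1 ≤ |sec a (n - 1) (q ^ 2 + a) (q ^ 2 + a)| * (2 * q) := by
  have h := L.one_le_sec
  have hq := L.q_pos
  rwa [sec_eq_pred L.n_pos, abs_mul, ← two_mul, abs_of_pos (show 0 < 2 * q by linarith)] at h

lemma abs_crit_eq (L : Level a n σ q Q v) : |crit a n| = -(σ * crit a n) := by
  rw [← L.abs_sign_mul, abs_of_neg L.crit_neg]

lemma crit_eq (L : Level a n σ q Q v) : crit a n = -(σ * |crit a n|) := by
  rw [L.abs_crit_eq, mul_neg, neg_neg, ← mul_assoc, L.sign_mul_self, one_mul]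

/-- Bound for the derivative of the return map on the restrictive interval. -/
lemma abs_sec_self_le (L : Level a n σ q Q v) {x : ℝ} (hx : |x| ≤ q) : |sec a n x x| ≤ 272 := by
  wlog hx0 : 0 ≤ x generalizing x
  · rw [← abs_sec_neg L.n_pos]
    exact this (by rwa [abs_neg]) (by linarith)
  have hq := L.q_pos
  have hqa : |q| ≤ q := by rw [abs_of_pos hq]
  have h0a : |(0 : ℝ)| ≤ q := by rw [abs_zero]; exact hq.le
  have hxq : x ≤ q := (le_abs_self x).trans hx
  rw [sec_eq_pred L.n_pos, abs_mul, abs_of_nonneg (show 0 ≤ x + x by linarith)]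
  have hxq2 : x ^ 2 ≤ q ^ 2 := by gcongr
  rcases le_total x (q / 2) with hh | hh
  · have h1 := (sec_quad (a := a) (n := n - 1) (A := x ^ 2 + a) (B := x ^ 2 + a)
      (C := q ^ 2 + a) (D := q ^ 2 + a) le_rfl (by linarith) le_rfl
      (L.sign_quad_window hx hqa)).1
    have h3 := L.abs_sub_eq x q
    have h5 := L.abs_sub_le hx hqa
    have h7 := L.one_le_sec_pred
    rw [h3, abs_sub_comm (x ^ 2), abs_of_nonneg (by linarith)] at h5
    set S := |sec a (n - 1) (q ^ 2 + a) (q ^ 2 + a)|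
    set s := |sec a (n - 1) (x ^ 2 + a) (x ^ 2 + a)|
    set r := |sec a (n - 1) (x ^ 2 + a) (q ^ 2 + a)|
    have hs : 0 ≤ s := abs_nonneg _
    have hr : 0 ≤ r := abs_nonneg _
    have h8 : 3 * q * r ≤ 8 := by
      have : x ^ 2 ≤ q ^ 2 / 4 := by nlinarith
      have h9 : 3 / 4 * q ^ 2 * r ≤ 2 * q :=
        le_trans (mul_le_mul_of_nonneg_right (by linarith) hr) h5
      have h10 : q * (3 * q * r) ≤ q * 8 := by nlinarith
      exact le_of_mul_le_mul_left h10 hq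
    calc s * (x + x) ≤ s * q := by gcongr; linarith
      _ ≤ s * q * (S * (2 * q)) := le_mul_of_one_le_right (by positivity) h7
      _ = (s * S) * (2 * q ^ 2) := by ring
      _ ≤ (r * r) * (2 * q ^ 2) := by gcongr
      _ = 2 / 9 * ((3 * q * r) * (3 * q * r)) := by ring
      _ ≤ 2 / 9 * (8 * 8) := by gcongr
      _ ≤ 272 := by norm_num
  · have h1 := (sec_quad (a := a) (n := n - 1) (A := v) (B := a)
      (C := x ^ 2 + a) (D := x ^ 2 + a) L.v_le (by nlinarith) le_rfl
      (L.sign_quad_v hx)).1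
    have hC := L.crit_le
    have hQ := L.le_Q
    have hv := L.v_le
    have h2 : |(fa a)^[n - 1] v - (fa a)^[n - 1] a| = Q - |crit a n| := by
      rw [L.v_iter, iter_pred_self L.n_pos]
      conv_lhs => rw [L.crit_eq]
      rw [show -(σ * Q) - -(σ * |crit a n|) = -(σ * (Q - |crit a n|)) by ring, abs_neg,
        L.abs_sign_mul, abs_of_nonneg (by linarith)]
    have h3 : |(fa a)^[n - 1] v - (fa a)^[n - 1] (x ^ 2 + a)| ≤ Q + q := by
      rw [L.v_iter, iter_pred L.n_pos]
      refine (abs_sub _ _).trans (add_le_add ?_ (L.maps hx))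
      rw [abs_neg, L.abs_sign_mul, abs_of_nonneg (by linarith)]
    have h4 := L.abs_sub_eq 0 x
    have h5 := L.abs_sub_le h0a hx
    rw [abs_iter_sub, abs_sub_comm, abs_of_nonneg (by linarith)] at h2
    rw [abs_iter_sub, abs_sub_comm, abs_of_nonneg (by nlinarith)] at h3
    rw [h4, abs_sub_comm (0 ^ 2 : ℝ), abs_of_nonneg (by nlinarith), zero_pow two_ne_zero,
      zero_add, sub_zero] at h5
    set s := |sec a (n - 1) (x ^ 2 + a) (x ^ 2 + a)|
    set r := |sec a (n - 1) v a|
    set t := |sec a (n - 1) v (x ^ 2 + a)|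
    set u := |sec a (n - 1) a (x ^ 2 + a)|
    have hs : 0 ≤ s := abs_nonneg _
    have ht : 0 ≤ t := abs_nonneg _
    have hu : 0 ≤ u := abs_nonneg _
    have hav : 0 ≤ a - v := by linarith
    have h8 : u * x ≤ 4 := by
      have : x * (u * x) ≤ x * 4 := by nlinarith
      exact le_of_mul_le_mul_left this (by linarith)
    have h9 : (Q - q) * s ≤ (Q + q) * u := by
      calc (Q - q) * s ≤ (Q - |crit a n|) * s := by gcongr
        _ = (a - v) * (r * s) := by rw [← h2]; ring
        _ ≤ (a - v) * (t * u) := by gcongr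
        _ ≤ (x ^ 2 + a - v) * (t * u) := by
            refine mul_le_mul_of_nonneg_right ?_ (by positivity)
            nlinarith
        _ = ((x ^ 2 + a - v) * t) * u := by ring
        _ ≤ _ := by gcongr
    have h10 : s ≤ 17 * u := by
      have hQq : 0 < Q - q := by linarith
      have : (Q - q) * s ≤ (Q - q) * (17 * u) := by
        refine h9.trans ?_
        have : Q + q ≤ (Q - q) * 17 := by linarith
        calc (Q + q) * u ≤ ((Q - q) * 17) * u := by gcongr
          _ = _ := by ring
      exact le_of_mul_le_mul_left this hQq
    nlinarith

end Level

lemma level_one {a : ℝ} (ha : a ∈ Icc (-2 : ℝ) (1 / 4)) (hH : 0 < growth a) :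
    Level a 1 1 (beta a) (2 * beta a) (-(2 * beta a)) := by
  have hb := half_le_beta a
  have hb2 := beta_le_two ha.1
  have hbs := beta_sq ha.2
  have w : Window a 1 1 (beta a) := by
    refine ⟨one_pos, Or.inl rfl, by linarith, ?_, fun i h1 h2 => by omega, ?_, theta_zero a⟩
    · rw [one_mul]; exact hbs
    · have h1 := iter_mem_Ia ha 1 (zero_mem_Ia a)
      rw [Ia_eq] at h1
      rw [abs_le]; exact h1
  have hc : (1 : ℝ) * crit a 1 < 0 := by
    refine w.crit_sign_neg (fun t _ _ => ?_) hH
    simp [kpoly, theta_zero]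
  refine ⟨w, hc, ?_, by nlinarith, fun i hi => by omega, by simp, by linarith⟩
  simp only [sec, Finset.prod_range_one, Function.iterate_zero, id]
  rw [abs_of_nonneg] <;> linarith

namespace Level

variable {a : ℝ} {n : ℕ} {σ q Q v : ℝ}

lemma continuous_sign_iter (σ : ℝ) (a : ℝ) (n : ℕ) : Continuous fun x => σ * (fa a)^[n] x :=
  continuous_const.mul (continuous_iter a n)

lemma exists_flip (L : Level a n σ q Q v) :
    ∃ p, 0 < p ∧ p < q ∧ σ * (fa a)^[n] p = -p := by
  have hq := L.q_pos
  have hc := L.crit_neg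
  have h1 : ContinuousOn (fun x => σ * (fa a)^[n] x + x) (Icc 0 q) :=
    ((continuous_sign_iter σ a n).add continuous_id).continuousOn
  have h0 : (fun x => σ * (fa a)^[n] x + x) 0 < 0 := by
    simp only [add_zero]; exact hc
  have h2 : 0 < (fun x => σ * (fa a)^[n] x + x) q := by
    simp only [L.sign_mul_fixed]; linarith
  obtain ⟨p, hp, hpe⟩ := intermediate_value_Ioo hq.le h1 ⟨h0, h2⟩
  exact ⟨p, hp.1, hp.2, by simp only at hpe; linarith⟩

variable {p : ℝ}

lemma lt_abs_crit (L : Level a n σ q Q v) (hp0 : 0 < p) (hpq : p < q)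
    (hp : σ * (fa a)^[n] p = -p) : p < |crit a n| := by
  rw [L.abs_crit_eq]
  have h := L.strictMono le_rfl hp0 hpq.le
  rw [hp] at h
  have : (fa a)^[n] 0 = crit a n := rfl
  rw [this] at h
  linarith

lemma crit_double (L : Level a n σ q Q v) : crit a (2 * n) = (fa a)^[n] |crit a n| := by
  rw [two_mul, crit_add, iter_abs a n L.n_pos]

lemma iter_flip (L : Level a n σ q Q v) (hp : σ * (fa a)^[n] p = -p) :
    (fa a)^[n] p = -(σ * p) := by
  have h := L.sign_mul_self
  have : (fa a)^[n] p = σ * (σ * (fa a)^[n] p) := by rw [← mul_assoc, h, one_mul]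
  rw [this, hp, mul_neg]

lemma iter_sign_mul (L : Level a n σ q Q v) (x : ℝ) : (fa a)^[n] (σ * x) = (fa a)^[n] x := by
  rw [← iter_abs a n L.n_pos, L.abs_sign_mul, iter_abs a n L.n_pos]

lemma horseshoe (L : Level a n σ q Q v) (hp0 : 0 < p)
    (hp : σ * (fa a)^[n] p = -p) (hc : p < σ * crit a (2 * n)) :
    Real.log 2 / (2 * n : ℕ) ≤ growth a := by
  refine log_two_div_le_growth (p := p) (by have := L.n_pos; omega) (fun w hw => ?_) hp0.le
  have hF0 : σ * (fa a)^[2 * n] 0 = σ * crit a (2 * n) := rfl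
  have hFp : σ * (fa a)^[2 * n] p = -p := by
    rw [two_mul, iter_add, L.iter_flip hp, iter_neg a n L.n_pos, L.iter_sign_mul, hp]
  have hsw := L.abs_sign_mul w
  rw [← hsw, abs_le] at hw
  obtain ⟨x, hx, hxe⟩ := intermediate_value_Icc' hp0.le
    (continuous_sign_iter σ a (2 * n)).continuousOn
    (show σ * w ∈ Icc _ _ from
      ⟨by simp only [hFp]; exact hw.1, by simp only [hF0]; linarith [hw.2]⟩)
  have hx0 : x ≠ 0 := by
    rintro rfl
    simp only [hF0] at hxe
    linarith [hw.2]
  refine ⟨x, lt_of_le_of_ne hx.1 hx0.symm, hx.2, ?_⟩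
  have hs : σ ≠ 0 := fun h => by have := L.sign_mul_self; rw [h] at this; norm_num at this
  exact mul_left_cancel₀ hs hxe

lemma window_double (L : Level a n σ q Q v) (hp0 : 0 < p) (hpq : p < q)
    (hp : σ * (fa a)^[n] p = -p) (hc : σ * crit a (2 * n) ≤ p) :
    Window a (2 * n) (-σ) p := by
  have hn := L.n_pos
  have hcp := L.lt_abs_crit hp0 hpq hp
  have hcq := L.crit_le
  refine ⟨by omega, ?_, hp0, ?_, ?_, ?_, ?_⟩
  · rcases L.sign_or with h | h
    · exact Or.inr (by rw [h])
    · exact Or.inl (by rw [h]; norm_num)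
  · rw [two_mul, iter_add, L.iter_flip hp, iter_neg a n L.n_pos, L.iter_sign_mul, L.iter_flip hp]
    ring
  · intro i hi hin x hx
    have hxq : |x| ≤ q := hx.trans hpq.le
    rcases lt_trichotomy i n with h | h | h
    · exact L.sameSign i hi h x hxq
    · subst h
      have h1 : σ * (fa a)^[i] x ≤ -p := by
        rw [← hp, ← iter_abs a i hi x]
        exact L.mono (abs_nonneg x) hx hpq.le
      have h2 := mul_pos_of_neg_of_neg (show σ * (fa a)^[i] x < 0 by linarith) L.crit_neg
      calc 0 < σ * (fa a)^[i] x * (σ * crit a i) := h2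
        _ = (σ * σ) * ((fa a)^[i] x * crit a i) := by ring
        _ = _ := by rw [L.sign_mul_self, one_mul]
    · obtain ⟨j, rfl⟩ : ∃ j, i = j + n := ⟨i - n, by omega⟩
      rw [iter_add, crit_add]
      exact mul_pos_of_common (L.sameSign j (by omega) (by omega) _ (L.maps hxq))
        (L.sameSign j (by omega) (by omega) _ hcq)
  · rw [← L.abs_sign_mul, abs_le]
    refine ⟨?_, hc⟩
    rw [L.crit_double, ← hp]
    exact L.mono hp0.le hcp.le hcq
  · rw [show 2 * n - 1 = n * 1 + (n - 1) by omega, L.theta_mul_succ_pred, mul_one,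
      L.theta_eq_neg_one L.crit_neg]
    ring

lemma one_le_sec_flip (L : Level a n σ q Q v) (hp0 : 0 < p) (hpq : p < q)
    (hp : σ * (fa a)^[n] p = -p) (he : 0 < σ * crit a (2 * n)) : 1 ≤ |sec a n p p| := by
  have hcp := L.lt_abs_crit hp0 hpq hp
  have hcq := L.crit_le
  have hs0 : σ ≠ 0 := fun h => by have := L.sign_mul_self; rw [h] at this; norm_num at this
  rw [L.crit_double] at he
  obtain ⟨z, hz, hze⟩ := intermediate_value_Ioo hcp.le
    (continuous_sign_iter σ a n).continuousOn (show (0 : ℝ) ∈ Ioo _ _ from ⟨by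
      simp only [hp]; linarith, he⟩)
  have hz0 : (fa a)^[n] z = 0 := (mul_eq_zero.1 hze).resolve_left hs0
  have hzq : |z| ≤ q := by rw [abs_of_pos] <;> linarith [hz.1, hz.2]
  have h1 := (sec_quad (a := a) (n := n) (A := 0) (B := p) (C := p) (D := z) hp0.le le_rfl
    hz.1.le (fun i hi => by
      rcases Nat.eq_zero_or_pos i with rfl | h
      · simp
      · exact (mul_pos_of_common (L.sameSign i h hi 0 (by rw [abs_zero]; exact L.q_pos.le))
          (L.sameSign i h hi z hzq)).le)).2
  have e1 := abs_iter_sub a n 0 p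
  have e2 := abs_iter_sub a n p z
  have e3 := abs_iter_sub a n 0 z
  have h0 : (fa a)^[n] 0 = crit a n := rfl
  have hcn := L.crit_eq
  set C := |crit a n| with hC
  have hc3 : |(fa a)^[n] 0 - (fa a)^[n] p| = C - p := by
    rw [h0, hcn, L.iter_flip hp, show -(σ * C) - -(σ * p) = -(σ * (C - p)) by ring, abs_neg,
      L.abs_sign_mul, abs_of_pos (by linarith)]
  have hc4 : |(fa a)^[n] p - (fa a)^[n] z| = p := by
    rw [hz0, sub_zero, L.iter_flip hp, abs_neg, L.abs_sign_mul, abs_of_pos hp0]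
  have hc5 : |(fa a)^[n] 0 - (fa a)^[n] z| = C := by rw [hz0, sub_zero, h0]
  rw [hc3, zero_sub, abs_neg, abs_of_pos hp0] at e1
  rw [hc4, abs_sub_comm, abs_of_pos (by linarith [hz.1])] at e2
  rw [hc5, zero_sub, abs_neg, abs_of_pos (by linarith [hz.1])] at e3
  set s1 := |sec a n 0 p|
  set s2 := |sec a n p z|
  set s3 := |sec a n 0 z|
  have hz1 := hz.1
  have hz2 := hz.2
  have hs2 : 0 ≤ s2 := abs_nonneg _
  by_contra hcon
  rw [not_le] at hcon
  have h3 : 0 < s3 := by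
    by_contra h
    have : z * s3 ≤ 0 := mul_nonpos_of_nonneg_of_nonpos (by linarith) (by linarith)
    linarith
  have h4 : s1 * s2 < s3 := lt_of_le_of_lt h1 (by nlinarith)
  have h5 : (C - p) * z < C * (z - p) := by
    have : (p * s1) * ((z - p) * s2) * z < p * (z - p) * (z * s3) := by
      have hk : 0 < p * (z - p) * z := mul_pos (mul_pos hp0 (by linarith)) (by linarith)
      nlinarith
    rw [← e1, ← e2, ← e3] at this
    have h6 : p * ((C - p) * z) < p * (C * (z - p)) := by linarith
    exact lt_of_mul_lt_mul_left h6 hp0.le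
  nlinarith

lemma nine_eighths_le {p C Q e : ℝ} (hp0 : 0 < p) (hcp : p < C) (hQ : 9 / 8 * C ≤ Q) (he : 0 < e)
    (h2 : (Q - C) * (p + e) * p ^ 2 ≤ (C - p) * (C ^ 2 - p ^ 2) * (Q + e)) : 9 / 8 * p ≤ C := by
  have hC0 : 0 < C := by linarith
  by_contra hcon
  rw [not_le] at hcon
  have hQe : 0 < Q + e := by linarith
  have h3 : C * (Q + e) * (p + e) ≤ 9 * (C + e) * ((Q - C) * (p + e)) := by
    have : C * (Q + e) ≤ 9 * (C + e) * (Q - C) := by nlinarith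
    nlinarith
  have h4 : C * (p + e) * p ^ 2 ≤ 9 * (C + e) * ((C - p) * (C ^ 2 - p ^ 2)) := by
    have : (Q + e) * (C * (p + e) * p ^ 2)
        ≤ (Q + e) * (9 * (C + e) * ((C - p) * (C ^ 2 - p ^ 2))) := by
      calc _ = (C * (Q + e) * (p + e)) * p ^ 2 := by ring
        _ ≤ (9 * (C + e) * ((Q - C) * (p + e))) * p ^ 2 := by gcongr
        _ = 9 * (C + e) * ((Q - C) * (p + e) * p ^ 2) := by ring
        _ ≤ 9 * (C + e) * ((C - p) * (C ^ 2 - p ^ 2) * (Q + e)) := by gcongr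
        _ = _ := by ring
    exact le_of_mul_le_mul_left this hQe
  have h5 : (C - p) * (C ^ 2 - p ^ 2) ≤ (1 / 8 * p) * (17 / 64 * p ^ 2) :=
    mul_le_mul (by linarith) (by nlinarith) (by nlinarith) (by linarith)
  have h6 : p * (C + e) ≤ C * (p + e) := by nlinarith
  have h7 : 9 * (C + e) * ((C - p) * (C ^ 2 - p ^ 2))
      ≤ 9 * (C + e) * ((1 / 8 * p) * (17 / 64 * p ^ 2)) := by gcongr
  have h8 : p * (C + e) * p ^ 2 ≤ C * (p + e) * p ^ 2 := by gcongr
  have h9 : 0 < p * (C + e) * p ^ 2 := by positivity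
  nlinarith

lemma extension_bound (L : Level a n σ q Q v) (hp0 : 0 < p) (hpq : p < q)
    (hp : σ * (fa a)^[n] p = -p) (he : 0 < σ * crit a (2 * n)) :
    9 / 8 * p ≤ |crit a n| := by
  have hq := L.q_pos
  have hcp := L.lt_abs_crit hp0 hpq hp
  have hcq := L.crit_le
  have hcn := L.crit_eq
  have hQ := L.le_Q
  have hs1 := L.sign_mul_self
  rw [L.crit_double] at he
  set C := |crit a n| with hC
  have hC0 : 0 < C := by linarith
  have hCabs : |C| ≤ q := by rw [abs_of_pos hC0]; exact hcq
  have h1 := (sec_quad (a := a) (n := n - 1) (A := v) (B := a)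
      (C := p ^ 2 + a) (D := C ^ 2 + a) L.v_le (by nlinarith) (by nlinarith)
      (L.sign_quad_v hCabs)).2
  have e1 := abs_iter_sub a (n - 1) v a
  have e2 := abs_iter_sub a (n - 1) (p ^ 2 + a) (C ^ 2 + a)
  have e3 := abs_iter_sub a (n - 1) a (p ^ 2 + a)
  have e4 := abs_iter_sub a (n - 1) v (C ^ 2 + a)
  rw [iter_pred L.n_pos] at e2 e3 e4
  rw [iter_pred L.n_pos] at e2
  rw [iter_pred_self L.n_pos] at e1 e3
  rw [L.v_iter] at e1 e4
  set e := σ * (fa a)^[n] C with hee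
  have hfC : (fa a)^[n] C = σ * e := by rw [hee, ← mul_assoc, hs1, one_mul]
  have hav : v ≤ a := L.v_le
  have hp2 : p ^ 2 < C ^ 2 := by nlinarith
  rw [hcn, show -(σ * Q) - -(σ * C) = -(σ * (Q - C)) by ring, abs_neg,
      L.abs_sign_mul, abs_of_pos (show 0 < Q - C by linarith), abs_sub_comm v,
      abs_of_nonneg (show 0 ≤ a - v by linarith)] at e1
  rw [L.iter_flip hp, hfC, show -(σ * p) - σ * e = -(σ * (p + e)) by ring, abs_neg,
      L.abs_sign_mul, abs_of_pos (show 0 < p + e by linarith), abs_sub_comm (p ^ 2 + a),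
      abs_of_pos (show 0 < C ^ 2 + a - (p ^ 2 + a) by linarith)] at e2
  rw [hcn, L.iter_flip hp, show -(σ * C) - -(σ * p) = -(σ * (C - p)) by ring, abs_neg,
      L.abs_sign_mul, abs_of_pos (show 0 < C - p by linarith), abs_sub_comm a,
      abs_of_pos (show 0 < p ^ 2 + a - a by nlinarith)] at e3
  rw [hfC, show -(σ * Q) - σ * e = -(σ * (Q + e)) by ring, abs_neg,
      L.abs_sign_mul, abs_of_pos (show 0 < Q + e by linarith), abs_sub_comm v,
      abs_of_pos (show 0 < C ^ 2 + a - v by nlinarith)] at e4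
  set s1 := |sec a (n - 1) v a|
  set s2 := |sec a (n - 1) (p ^ 2 + a) (C ^ 2 + a)|
  set s3 := |sec a (n - 1) a (p ^ 2 + a)|
  set s4 := |sec a (n - 1) v (C ^ 2 + a)|
  have hs2 : 0 ≤ s1 * s2 := mul_nonneg (abs_nonneg _) (abs_nonneg _)
  have hs4 : 0 ≤ s4 := abs_nonneg _
  refine nine_eighths_le (Q := Q) (e := e) hp0 hcp (by linarith) he ?_
  have hk1 : 0 ≤ C ^ 2 - p ^ 2 := by linarith
  have hk2 : 0 ≤ C ^ 2 + a - v := by linarith [sq_nonneg C]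
  have hk3 : 0 ≤ a - v := by linarith
  have hk4 : 0 ≤ C - p := by linarith
  have hk5 : 0 ≤ Q + e := by linarith
  have h3 : (C ^ 2 + a - v) * ((Q - C) * (p + e) * p ^ 2)
      ≤ (C ^ 2 + a - v) * ((C - p) * (C ^ 2 - p ^ 2) * (Q + e)) := by
    calc (C ^ 2 + a - v) * ((Q - C) * (p + e) * p ^ 2)
        = (s1 * s2) * ((a - v) * (C ^ 2 - p ^ 2) * p ^ 2 * (C ^ 2 + a - v)) := by
          rw [e1, e2]; ring
      _ ≤ (s3 * s4) * ((a - v) * (C ^ 2 - p ^ 2) * p ^ 2 * (C ^ 2 + a - v)) :=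
          mul_le_mul_of_nonneg_right h1 (by positivity)
      _ = (a - v) * ((C - p) * (C ^ 2 - p ^ 2) * (Q + e)) := by rw [e3, e4]; ring
      _ ≤ _ := mul_le_mul_of_nonneg_right (by linarith [sq_nonneg C]) (by positivity)
  exact le_of_mul_le_mul_left h3 (by linarith [pow_pos hC0 2])

/-- The period-doubling step. -/
theorem exists_next (L : Level a n σ q Q v) (hH : 0 < growth a)
    (hlt : growth a < Real.log 2 / (2 * n : ℕ))
    (hP : ∀ t, 0 < t → t < 1 → 0 < kpoly a n t) :
    ∃ p v', Level a (2 * n) (-σ) p q v' := by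
  obtain ⟨p, hp0, hpq, hp⟩ := L.exists_flip
  have hn := L.n_pos
  have hc : σ * crit a (2 * n) ≤ p := by
    by_contra h
    exact absurd (L.horseshoe hp0 hp (not_le.1 h)) (not_le.2 hlt)
  have w := L.window_double hp0 hpq hp hc
  have hneg := w.crit_sign_neg (fun t h0 h1 => by
    rw [L.kpoly_double L.crit_neg]
    exact mul_pos (hP t h0 h1) (sub_pos.2 (pow_lt_one₀ h0.le h1 hn.ne'))) hH
  have he : 0 < σ * crit a (2 * n) := by linarith
  have hcq := L.crit_le
  have hQ := L.le_Q
  have hq := L.q_pos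
  have hs1 := L.sign_mul_self
  have hva : σ * (fa a)^[n - 1] v = -Q := by
    rw [L.v_iter, mul_neg, ← mul_assoc, hs1, one_mul]
  have haa : σ * (fa a)^[n - 1] a = -|crit a n| := by
    rw [iter_pred_self hn, L.abs_crit_eq, neg_neg]
  obtain ⟨v', hv', hve⟩ := intermediate_value_Icc L.v_le
    (continuous_sign_iter σ a (n - 1)).continuousOn
    (show -q ∈ Icc _ _ from ⟨by simp only [hva]; linarith, by simp only [haa]; linarith⟩)
  simp only at hve
  have hve' : (fa a)^[n - 1] v' = -(σ * q) := by
    have : (fa a)^[n - 1] v' = σ * (σ * (fa a)^[n - 1] v') := by rw [← mul_assoc, hs1, one_mul]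
    rw [this, hve, mul_neg]
  have hvn : ∀ j, (fa a)^[j + n] v' = (fa a)^[j + 1] q := by
    intro j
    rw [show j + n = (j + 1) + (n - 1) by omega, iter_add, hve', iter_neg a _ j.succ_pos]
    rcases L.sign_or with h | h
    · rw [h, one_mul]
    · rw [h, neg_one_mul, iter_neg a _ j.succ_pos]
  refine ⟨p, v', w, hneg, ?_, hv'.2, ?_, ?_, ?_⟩
  · have h1 := L.one_le_sec_flip hp0 hpq hp he
    rw [two_mul, sec_add, abs_mul, L.iter_flip hp, abs_sec_neg hn]
    have h2 : |sec a n (σ * p) (σ * p)| = |sec a n p p| := by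
      rcases L.sign_or with h | h
      · rw [h, one_mul]
      · rw [h, neg_one_mul, abs_sec_neg hn]
    rw [h2]
    nlinarith
  · intro i hi
    rcases lt_trichotomy (i + 1) n with h | h | h
    · have h1 := L.v_sign i h
      have h2 := monoOrd_iter (a := a) (n := n - 1) hv'.1 hv'.2 (show a ≤ a from le_rfl)
        (fun i hi => by
          have := L.sign_quad_v (y := 0) (by rw [abs_zero]; exact hq.le) i hi
          rwa [zero_pow two_ne_zero, zero_add] at this) (i := i) (by omega)
      have h3 : (fa a)^[i] a = crit a (i + 1) := by
        have := iter_pred_self (a := a) i.succ_pos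
        simpa using this
      rw [h3] at h2
      rcases lt_trichotomy (crit a (i + 1)) 0 with h5 | h5 | h5
      · have : (fa a)^[i] v < 0 := by by_contra hc; rw [not_lt] at hc; nlinarith
        refine mul_pos_of_neg_of_neg ?_ h5
        rcases h2 with h2 | h2 <;> linarith [h2.1, h2.2.1]
      · rw [h5, mul_zero] at h1; exact absurd h1 (lt_irrefl _)
      · have := pos_of_mul_pos_left h1 h5.le
        refine mul_pos ?_ h5
        rcases h2 with h2 | h2 <;> linarith [h2.1, h2.2.1]
    · have h1 := L.crit_neg
      obtain rfl : i = n - 1 := by omega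
      rw [h, hve']
      nlinarith
    · obtain ⟨j, rfl⟩ : ∃ j, i = j + n := ⟨i - n, by omega⟩
      rw [hvn, show j + n + 1 = n * 1 + (j + 1) by omega]
      exact mul_pos_of_common
        (L.sameSign (j + 1) j.succ_pos (by omega) q (by rw [abs_of_pos hq]))
        (L.sameSign_crit j.succ_pos (by omega) 1)
  · obtain ⟨m, rfl⟩ : ∃ m, n = m + 1 := ⟨n - 1, by omega⟩
    rw [show 2 * (m + 1) - 1 = m + (m + 1) by omega, hvn, L.fixed]
    ring
  · exact (L.extension_bound hp0 hpq hp he).trans hcq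

end Level

/-- Nested restrictive intervals `[-q j, q j]` of periods `2 ^ j`, `j ≤ k`, with uniform bounds. -/
structure Tower (a : ℝ) (k : ℕ) (q : ℕ → ℝ) : Prop where
  window : ∀ j ≤ k, Window a (2 ^ j) ((-1) ^ j) (q j)
  sec_le : ∀ j ≤ k, ∀ x, |x| ≤ q j → |sec a (2 ^ j) x x| ≤ 272
  kpoly_eq : ∀ t, kpoly a (2 ^ k) t = ∏ i ∈ Finset.range k, (1 - t ^ 2 ^ i)

lemma exists_level_tower {a : ℝ} (ha : a ∈ Icc (-2 : ℝ) (1 / 4)) (hH : 0 < growth a) (k : ℕ)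
    (hk : k = 0 ∨ growth a < Real.log 2 / 2 ^ k) :
    ∃ q, Tower a k q ∧ ∃ Q v, Level a (2 ^ k) ((-1) ^ k) (q k) Q v := by
  induction k with
  | zero =>
    have L := level_one ha hH
    refine ⟨fun _ => beta a, ⟨?_, ?_, ?_⟩, 2 * beta a, -(2 * beta a), by simpa using L⟩
    · intro j hj
      obtain rfl : j = 0 := by omega
      simpa using L.toWindow
    · intro j hj
      obtain rfl : j = 0 := by omega
      exact fun x hx => L.abs_sec_self_le hx
    · intro t
      simp [kpoly, theta_zero]
  | succ k ih =>
    have hk' : growth a < Real.log 2 / 2 ^ (k + 1) := hk.resolve_left k.succ_ne_zero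
    have hlog := Real.log_pos one_lt_two
    obtain ⟨q, T, Q, v, L⟩ := ih (Or.inr (hk'.trans (by
      rw [pow_succ]; exact div_lt_div_of_pos_left hlog (by positivity)
        (by linarith [pow_pos (two_pos (α := ℝ)) k]))))
    have hpos : ∀ t : ℝ, 0 < t → t < 1 → 0 < kpoly a (2 ^ k) t := by
      intro t h0 h1
      rw [T.kpoly_eq]
      exact Finset.prod_pos fun i _ => sub_pos.2 (pow_lt_one₀ h0.le h1 (by positivity))
    obtain ⟨p, v', L'⟩ := L.exists_next hH (by
      rw [pow_succ'] at hk'; push_cast; exact hk') hpos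
    have e1 : 2 * 2 ^ k = 2 ^ (k + 1) := by ring
    have e2 : -(-1 : ℝ) ^ k = (-1) ^ (k + 1) := by ring
    rw [e1, e2] at L'
    set q' : ℕ → ℝ := fun j => if j ≤ k then q j else p with hq'
    have hq1 : ∀ j ≤ k, q' j = q j := fun j hj => if_pos hj
    have hq2 : q' (k + 1) = p := if_neg (by omega)
    refine ⟨q', ⟨?_, ?_, ?_⟩, q k, v', by rw [hq2]; exact L'⟩
    · intro j hj
      rcases Nat.lt_or_ge k j with h | h
      · obtain rfl : j = k + 1 := by omega
        rw [hq2]; exact L'.toWindow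
      · rw [hq1 j h]; exact T.window j h
    · intro j hj
      rcases Nat.lt_or_ge k j with h | h
      · obtain rfl : j = k + 1 := by omega
        rw [hq2]; exact fun x hx => L'.abs_sec_self_le hx
      · rw [hq1 j h]; exact T.sec_le j h
    · intro t
      rw [← e1, L.kpoly_double L.crit_neg, T.kpoly_eq, Finset.prod_range_succ]

theorem exists_tower {a : ℝ} (ha : a ∈ Icc (-2 : ℝ) (1 / 4)) (hH : 0 < growth a) (k : ℕ)
    (hk : k = 0 ∨ growth a < Real.log 2 / 2 ^ k) : ∃ q, Tower a k q :=
  let ⟨q, T, _⟩ := exists_level_tower ha hH k hk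
  ⟨q, T⟩

namespace Tower

variable {a : ℝ} {k : ℕ} {q : ℕ → ℝ}

lemma abs_crit_le (T : Tower a k q) {j : ℕ} (hj : j ≤ k) (t : ℕ) : |crit a (2 ^ j * t)| ≤ q j :=
  (T.window j hj).abs_crit_le t

lemma prod_block (T : Tower a k q) {j : ℕ} (hj : j ≤ k) (t : ℕ) :
    ∏ l ∈ Finset.Ico (2 ^ j * t) (2 ^ j * (t + 1)), |2 * crit a l| ≤ 272 := by
  have h := T.sec_le j hj _ (T.abs_crit_le hj t)
  rw [Finset.prod_Ico_eq_prod_range, mul_add, mul_one, Nat.add_sub_cancel_left]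
  unfold sec at h
  rw [Finset.abs_prod] at h
  refine le_trans (le_of_eq ?_) h
  refine Finset.prod_congr rfl fun i _ => ?_
  rw [← crit_add, two_mul, add_comm i]

lemma prod_le_of_dvd (T : Tower a k q) (N : ℕ) (i : ℕ) (hi : i ≤ k) : ∀ s t : ℕ, s ≤ t →
    2 ^ (k - i) * t ≤ 2 ^ k * N →
    ∏ l ∈ Finset.Ico (2 ^ (k - i) * s) (2 ^ (k - i) * t), |2 * crit a l| ≤ 272 ^ (2 * i + N) := by
  induction i with
  | zero =>
    intro s t hst htN
    rw [Nat.sub_zero] at *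
    have htN' : t ≤ N := Nat.le_of_mul_le_mul_left htN (by positivity)
    rw [mul_zero, zero_add]
    refine le_trans ?_ (pow_le_pow_right₀ (by norm_num) (show t - s ≤ N by omega))
    clear htN htN'
    induction t, hst using Nat.le_induction with
    | base => simp
    | succ t hst ih =>
      rw [← Finset.prod_Ico_consecutive _ (Nat.mul_le_mul_left _ hst)
        (Nat.mul_le_mul_left _ t.le_succ), Nat.succ_sub hst, pow_succ]
      exact mul_le_mul ih (T.prod_block le_rfl t)
        (Finset.prod_nonneg fun _ _ => abs_nonneg _) (by positivity)
  | succ i ih =>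
    intro s t hst htN
    have hki : k - i = (k - (i + 1)) + 1 := by omega
    specialize ih (by omega)
    rw [hki] at ih
    set j := k - (i + 1) with hj
    have hjk : j ≤ k := by omega
    have hnn : ∀ u v, 0 ≤ ∏ l ∈ Finset.Ico u v, |2 * crit a l| :=
      fun u v => Finset.prod_nonneg fun _ _ => abs_nonneg _
    have e : ∀ u, 2 ^ (j + 1) * u = 2 ^ j * (2 * u) := fun u => by rw [pow_succ, mul_assoc]
    simp only [e] at ih
    have step1 : ∀ s' t', 2 * s' ≤ t' → 2 ^ j * t' ≤ 2 ^ k * N →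
        ∏ l ∈ Finset.Ico (2 ^ j * (2 * s')) (2 ^ j * t'), |2 * crit a l|
          ≤ 272 ^ (2 * i + N) * 272 := by
      intro s' t' hst' hN
      rcases Nat.even_or_odd' t' with ⟨u, rfl | rfl⟩
      · exact (ih s' u (by omega) hN).trans (le_mul_of_one_le_right (by positivity) (by norm_num))
      · rw [← Finset.prod_Ico_consecutive _ (Nat.mul_le_mul_left _ (show 2 * s' ≤ 2 * u by omega))
          (Nat.mul_le_mul_left _ (2 * u).le_succ)]
        exact mul_le_mul (ih s' u (by omega)
          ((Nat.mul_le_mul_left _ (2 * u).le_succ).trans hN)) (T.prod_block hjk _)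
          (hnn _ _) (by positivity)
    have e3 : (272 : ℝ) ^ (2 * (i + 1) + N) = 272 * (272 ^ (2 * i + N) * 272) := by ring
    rw [e3]
    rcases Nat.even_or_odd' s with ⟨u, rfl | rfl⟩
    · exact (step1 u t hst htN).trans (le_mul_of_one_le_left (by positivity) (by norm_num))
    · rcases hst.eq_or_lt with rfl | hlt
      · rw [Finset.Ico_self, Finset.prod_empty]
        have : (1 : ℝ) ≤ 272 ^ (2 * i + N) := one_le_pow₀ (by norm_num)
        linarith
      · rw [← Finset.prod_Ico_consecutive _ (Nat.mul_le_mul_left _ (2 * u + 1).le_succ)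
          (Nat.mul_le_mul_left _ hlt)]
        refine mul_le_mul (T.prod_block hjk _) ?_ (hnn _ _) (by norm_num)
        exact step1 (u + 1) t hlt htN

theorem prod_le (T : Tower a k q) {N i j : ℕ} (hij : i ≤ j) (hj : j ≤ 2 ^ k * N) :
    ∏ l ∈ Finset.Ico i j, |2 * crit a l| ≤ 272 ^ (2 * k + N) := by
  have := T.prod_le_of_dvd N k le_rfl i j hij
  rw [Nat.sub_self, pow_zero, one_mul, one_mul] at this
  exact this hj

end Tower

lemma one_add_inv_pow_le {M l : ℕ} (hM : 0 < M) (hl : l ≤ M) : (1 + 1 / (M : ℝ)) ^ l ≤ 3 := by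
  have hM' : (0 : ℝ) < M := by exact_mod_cast hM
  calc (1 + 1 / (M : ℝ)) ^ l ≤ (1 + 1 / (M : ℝ)) ^ M :=
        pow_le_pow_right₀ (by linarith [one_div_pos.2 hM']) hl
    _ ≤ (Real.exp (1 / M)) ^ M := by
        gcongr
        linarith [Real.add_one_le_exp (1 / (M : ℝ))]
    _ = Real.exp 1 := by rw [← Real.exp_nat_mul, mul_one_div_cancel hM'.ne']
    _ ≤ 3 := by linarith [Real.exp_one_lt_d9]

lemma growth_bound {d w : ℕ → ℝ} {M L : ℕ} {B ε : ℝ} (hM : 0 < M) (hL : L ≤ M)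
    (hw : ∀ l, 0 ≤ w l) (hB : ∀ i j, i ≤ j → j ≤ M → ∏ l ∈ Finset.Ico i j, w l ≤ B)
    (hε : 0 ≤ ε) (h1 : d 1 ≤ ε)
    (hrec : ∀ l, 1 ≤ l → l < L → d l ≤ 3 * M * B * ε → d (l + 1) ≤ (1 + 1 / M) * w l * d l + ε)
    {l : ℕ} (hl1 : 1 ≤ l) (hlL : l ≤ L) : d l ≤ 3 * M * B * ε := by
  have hM' : (0 : ℝ) < M := by exact_mod_cast hM
  have hκ : 1 ≤ 1 + 1 / (M : ℝ) := by linarith [one_div_pos.2 hM']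
  have hBpos : 0 ≤ B := by
    have := hB 0 0 le_rfl (by omega)
    rw [Finset.Ico_self, Finset.prod_empty] at this
    linarith
  have hpn : ∀ i j, 0 ≤ ∏ l ∈ Finset.Ico i j, w l := fun i j => Finset.prod_nonneg fun l _ => hw l
  have hsum : ∀ l ≤ M, ∑ i ∈ Finset.Ico 1 (l + 1), ∏ m ∈ Finset.Ico i l, w m ≤ M * B := by
    intro l hl
    calc _ ≤ ∑ i ∈ Finset.Ico 1 (l + 1), B := by
          refine Finset.sum_le_sum fun i hi => hB i l ?_ hl
          have := (Finset.mem_Ico.1 hi).2; omega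
      _ = l * B := by simp
      _ ≤ M * B := by gcongr
  have hfin : ∀ l ≤ M, ε * (1 + 1 / (M : ℝ)) ^ l *
      ∑ i ∈ Finset.Ico 1 (l + 1), ∏ m ∈ Finset.Ico i l, w m ≤ 3 * M * B * ε := by
    intro l hl
    calc _ ≤ ε * 3 * (M * B) := by
          refine mul_le_mul (by gcongr; exact one_add_inv_pow_le hM hl) (hsum l hl)
            (Finset.sum_nonneg fun i _ => hpn _ _) (by positivity)
      _ = _ := by ring
  have key : d l ≤ ε * (1 + 1 / (M : ℝ)) ^ l *
      ∑ i ∈ Finset.Ico 1 (l + 1), ∏ m ∈ Finset.Ico i l, w m := by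
    induction l, hl1 using Nat.le_induction with
    | base =>
      simp only [Nat.Ico_succ_singleton, Finset.sum_singleton, Finset.Ico_self, Finset.prod_empty]
      have : ε * 1 ≤ ε * (1 + 1 / (M : ℝ)) ^ 1 := by gcongr; rw [pow_one]; exact hκ
      linarith
    | succ l hl ih =>
      specialize ih (by omega)
      have h2 := hrec l hl hlL (ih.trans (hfin l (by omega)))
      rw [Finset.sum_Ico_succ_top (by omega), Finset.Ico_self, Finset.prod_empty]
      have e : ∑ i ∈ Finset.Ico 1 (l + 1), ∏ m ∈ Finset.Ico i (l + 1), w m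
          = (∑ i ∈ Finset.Ico 1 (l + 1), ∏ m ∈ Finset.Ico i l, w m) * w l := by
        rw [Finset.sum_mul]
        refine Finset.sum_congr rfl fun i hi => ?_
        rw [Finset.prod_Ico_succ_top]
        have := (Finset.mem_Ico.1 hi).2; omega
      rw [e, mul_add, mul_one]
      refine h2.trans (add_le_add ?_ (le_mul_of_one_le_right hε (one_le_pow₀ hκ)))
      calc _ ≤ (1 + 1 / (M : ℝ)) * w l * (ε * (1 + 1 / (M : ℝ)) ^ l *
            ∑ i ∈ Finset.Ico 1 (l + 1), ∏ m ∈ Finset.Ico i l, w m) :=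
            mul_le_mul_of_nonneg_left ih (mul_nonneg (by linarith) (hw l))
        _ = _ := by ring
  exact key.trans (hfin l (by omega))

lemma growth_bound_hom {d w : ℕ → ℝ} {M L : ℕ} {B : ℝ} (hM : 0 < M) (hL : L ≤ M)
    (hw : ∀ l, 0 ≤ w l) (hB : ∀ i j, i ≤ j → j ≤ M → ∏ l ∈ Finset.Ico i j, w l ≤ B)
    (h1 : 0 ≤ d 1) (hrec : ∀ l, 1 ≤ l → l < L → d (l + 1) ≤ (1 + 1 / M) * w l * d l)
    {l : ℕ} (hl1 : 1 ≤ l) (hlL : l ≤ L) : d l ≤ 3 * B * d 1 := by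
  have hM' : (0 : ℝ) < M := by exact_mod_cast hM
  have hκ : 1 ≤ 1 + 1 / (M : ℝ) := by linarith [one_div_pos.2 hM']
  have key : d l ≤ (1 + 1 / (M : ℝ)) ^ l * (∏ m ∈ Finset.Ico 1 l, w m) * d 1 := by
    induction l, hl1 using Nat.le_induction with
    | base =>
      rw [Finset.Ico_self, Finset.prod_empty, mul_one, pow_one]
      exact le_mul_of_one_le_left h1 hκ
    | succ l hl ih =>
      rw [Finset.prod_Ico_succ_top hl]
      calc _ ≤ (1 + 1 / (M : ℝ)) * w l *
            ((1 + 1 / (M : ℝ)) ^ l * (∏ m ∈ Finset.Ico 1 l, w m) * d 1) :=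
            (hrec l hl hlL).trans
              (mul_le_mul_of_nonneg_left (ih (by omega)) (mul_nonneg (by linarith) (hw l)))
        _ = _ := by ring
  refine key.trans ?_
  gcongr
  · exact Finset.prod_nonneg fun l _ => hw l
  · exact one_add_inv_pow_le hM (by omega)
  · exact hB 1 l hl1 (by omega)

/-- Derivatives along the first `M` points of the critical orbit are bounded by `B`, and `δ` is
small compared with these bounds. -/
structure Control (a : ℝ) (M : ℕ) (B δ : ℝ) : Prop where
  M_pos : 0 < M
  δ_pos : 0 < δ
  prod_le : ∀ i j, i ≤ j → j ≤ M → ∏ l ∈ Finset.Ico i j, |2 * crit a l| ≤ B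
  small : 60 * (M : ℝ) ^ 2 * B * δ ≤ 1

namespace Control

variable {a b δ B : ℝ} {M L : ℕ}

lemma one_le_B (K : Control a M B δ) : 1 ≤ B := by
  simpa using K.prod_le 0 0 le_rfl (by omega)

lemma abs_add_le_mul (K : Control a M B δ) {x u v : ℝ} (hx : δ ≤ |x|)
    (h : |u - x| + |v - x| ≤ 2 * (δ / (4 * M))) : |u + v| ≤ (1 + 1 / M) * |2 * x| := by
  have hM : (0 : ℝ) < M := by exact_mod_cast K.M_pos
  have h1 : δ / (4 * M) ≤ |x| / M := by
    rw [div_le_div_iff₀ (by positivity) hM]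
    have := K.δ_pos
    nlinarith
  have h2 : |u + v| ≤ |2 * x| + (|u - x| + |v - x|) := by
    calc |u + v| = |2 * x + ((u - x) + (v - x))| := by congr 1; ring
      _ ≤ _ := (abs_add_le _ _).trans (by gcongr; exact abs_add_le _ _)
  rw [abs_mul, abs_two] at *
  have e : (1 + 1 / (M : ℝ)) * (2 * |x|) = 2 * |x| + 2 * (|x| / M) := by ring
  rw [e]; linarith

lemma track (K : Control a M B δ) (hL : L ≤ M) (hX : ∀ l, 0 < l → l < L → δ ≤ |crit a l|)
    {U : ℕ → ℝ} (hU : ∀ l, U (l + 1) = U l ^ 2 + b) (h1 : |U 1 - a| ≤ 5 * δ ^ 2)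
    (hab : |b - a| ≤ 5 * δ ^ 2) {l : ℕ} (hl1 : 1 ≤ l) (hlL : l ≤ L) :
    |U l - crit a l| ≤ δ / (4 * M) := by
  have hM : (0 : ℝ) < M := by exact_mod_cast K.M_pos
  have hη : 3 * M * B * (5 * δ ^ 2) ≤ δ / (4 * M) := by
    rw [le_div_iff₀ (by positivity)]
    have := mul_le_mul_of_nonneg_right K.small K.δ_pos.le
    nlinarith
  refine le_trans (growth_bound (d := fun l => |U l - crit a l|) (w := fun l => |2 * crit a l|)
    K.M_pos hL (fun _ => abs_nonneg _) K.prod_le (by positivity) (by rwa [crit_one])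
    (fun l hl hlL hd => ?_) hl1 hlL) hη
  have h2 := K.abs_add_le_mul (hX l hl hlL) (u := U l) (v := crit a l)
    (by
      rw [sub_self, abs_zero, add_zero]
      have h3 : |U l - crit a l| ≤ δ / (4 * M) := hd.trans hη
      have h4 : 0 ≤ |U l - crit a l| := abs_nonneg _
      linarith)
  simp only [hU, crit_succ]
  calc |U l ^ 2 + b - (crit a l ^ 2 + a)|
      = |(U l + crit a l) * (U l - crit a l) + (b - a)| := by congr 1; ring
    _ ≤ |U l + crit a l| * |U l - crit a l| + |b - a| := by
        rw [← abs_mul]; exact abs_add_le _ _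
    _ ≤ _ := by gcongr

lemma track_pair (K : Control a M B δ) (hL : L ≤ M) (hX : ∀ l, 0 < l → l < L → δ ≤ |crit a l|)
    {U V : ℕ → ℝ} (hU : ∀ l, U (l + 1) = U l ^ 2 + b) (hV : ∀ l, V (l + 1) = V l ^ 2 + b)
    (h1 : |U 1 - a| ≤ 5 * δ ^ 2) (h2 : |V 1 - a| ≤ 5 * δ ^ 2)
    (hab : |b - a| ≤ 5 * δ ^ 2) {l : ℕ} (hl1 : 1 ≤ l) (hlL : l ≤ L) :
    |U l - V l| ≤ 3 * B * |U 1 - V 1| := by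
  refine growth_bound_hom (d := fun l => |U l - V l|) (w := fun l => |2 * crit a l|)
    K.M_pos hL (fun _ => abs_nonneg _) K.prod_le (abs_nonneg _) (fun l hl hlL => ?_) hl1 hlL
  have h3 := K.abs_add_le_mul (hX l hl hlL) (u := U l) (v := V l) (by
    rw [two_mul]
    exact add_le_add (K.track hL hX hU h1 hab hl hlL.le) (K.track hL hX hV h2 hab hl hlL.le))
  simp only [hU, hV]
  calc |U l ^ 2 + b - (V l ^ 2 + b)| = |U l + V l| * |U l - V l| := by
        rw [← abs_mul]; congr 1; ring
    _ ≤ _ := by gcongr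

end Control

lemma theta_succ_congr {a b c : ℝ} {m i : ℕ} (hc : theta b m = c * theta a i)
    (hs : 0 < crit a (i + 1) * crit b (m + 1)) : theta b (m + 1) = c * theta a (i + 1) := by
  rcases lt_trichotomy (crit a (i + 1)) 0 with h | h | h
  · have h3 : crit b (m + 1) < 0 := by by_contra hc; rw [not_lt] at hc; nlinarith
    rw [theta_succ_of_neg h, theta_succ_of_neg h3, hc]; ring
  · rw [h, zero_mul] at hs; exact absurd hs (lt_irrefl _)
  · rw [theta_succ_of_pos h, theta_succ_of_pos (pos_of_mul_pos_right hs h.le), hc]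

lemma mul_pos_of_abs_sub_lt {x u : ℝ} (h : |u - x| < |x|) : 0 < x * u := by
  rcases lt_trichotomy x 0 with hx | hx | hx
  · rw [abs_of_neg hx, abs_lt] at h
    exact mul_pos_of_neg_of_neg hx (by linarith)
  · rw [hx, abs_zero] at h; exact absurd h (not_lt.2 (abs_nonneg _))
  · rw [abs_of_pos hx, abs_lt] at h
    exact mul_pos hx (by linarith)

namespace Control

variable {a b δ B : ℝ} {M : ℕ}

lemma div_lt (K : Control a M B δ) : δ / (4 * M) ≤ δ / 4 := by
  have hM : (1 : ℝ) ≤ M := by exact_mod_cast K.M_pos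
  have := K.δ_pos
  gcongr; linarith

/-- If the critical orbit of `a` stays away from zero, the kneading signs are locally constant. -/
lemma theta_eq_of_far (K : Control a M B δ) (hX : ∀ l, 0 < l → l ≤ M → δ ≤ |crit a l|)
    (hab : |b - a| ≤ δ ^ 2) {l : ℕ} (hl : l ≤ M) : theta b l = theta a l := by
  have hδ := K.δ_pos
  have h5 : |b - a| ≤ 5 * δ ^ 2 := by nlinarith [sq_nonneg δ]
  induction l with
  | zero => rw [theta_zero, theta_zero]
  | succ l ih =>
    have h1 := K.track (U := crit b) le_rfl (fun l h1 h2 => hX l h1 h2.le) (crit_succ b)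
      (by rwa [crit_one]) h5 (Nat.succ_pos l) hl
    have h2 := hX _ l.succ_pos hl
    have h3 := K.div_lt
    rw [← one_mul (theta a (l + 1))]
    exact theta_succ_congr (by rw [one_mul]; exact ih (by omega))
      (mul_pos_of_abs_sub_lt (by linarith))

variable {p : ℕ}

/-- If the critical orbit of `a` first comes close to zero at time `p`, then the kneading
sequence of every nearby parameter is periodic up to sign, with period `p`. -/
lemma theta_periodic (K : Control a M B δ) (hp0 : 0 < p) (hpM : p ≤ M)
    (hX : ∀ l, 0 < l → l < p → δ ≤ |crit a l|) (hXp : |crit a p| < δ) (hab : |b - a| ≤ δ ^ 2) :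
    (∀ i < p, theta b i = theta a i) ∧
      ∀ s, ∀ i < p, theta b (p * s + i) = theta b p ^ s * theta a i := by
  have hδ := K.δ_pos
  have hB := K.one_le_B
  have hM : (1 : ℝ) ≤ M := by exact_mod_cast K.M_pos
  have h5 : |b - a| ≤ 5 * δ ^ 2 := by nlinarith [sq_nonneg δ]
  have hdiv := K.div_lt
  have hWp : |crit b p| ≤ 5 / 4 * δ := by
    have h1 := K.track (U := crit b) hpM hX (crit_succ b) (by rwa [crit_one]) h5 hp0 le_rfl
    have h2 := abs_sub_abs_le_abs_sub (crit b p) (crit a p)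
    linarith
  have hBδ : 60 * B * δ ≤ 1 := by
    refine le_trans ?_ K.small
    have : (1 : ℝ) ≤ (M : ℝ) ^ 2 := one_le_pow₀ hM
    have : 60 * B * δ * 1 ≤ 60 * B * δ * (M : ℝ) ^ 2 := by gcongr
    linarith
  have hstep : ∀ s, |crit b (p * s)| ≤ 7 / 5 * |crit b p| →
      |crit b (p * s + 1) - a| ≤ 5 * δ ^ 2 ∧
      |crit b (p * s + p) - crit b p| ≤ 2 / 5 * |crit b p| := by
    intro s hs
    have h0 := abs_nonneg (crit b p)
    have hsq : crit b (p * s) ^ 2 ≤ 49 / 25 * |crit b p| ^ 2 := by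
      rw [← sq_abs]
      calc |crit b (p * s)| ^ 2 ≤ (7 / 5 * |crit b p|) ^ 2 := by gcongr
        _ = _ := by ring
    have h1 : |crit b (p * s + 1) - a| ≤ 5 * δ ^ 2 := by
      rw [crit_succ, add_sub_assoc]
      refine (abs_add_le _ _).trans ?_
      rw [abs_of_nonneg (sq_nonneg _)]
      have : |crit b p| ^ 2 ≤ (5 / 4 * δ) ^ 2 := by gcongr
      nlinarith
    refine ⟨h1, ?_⟩
    have h2 := K.track_pair (U := fun l => crit b (p * s + l)) (V := crit b) hpM hX
      (fun l => crit_succ b _) (crit_succ b) h1 (by rwa [crit_one]) h5 hp0 le_rfl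
    have e : crit b (p * s + 1) - crit b 1 = crit b (p * s) ^ 2 := by
      rw [crit_succ, crit_one]; ring
    simp only [e] at h2
    rw [abs_of_nonneg (sq_nonneg (crit b (p * s)))] at h2
    refine h2.trans ?_
    calc 3 * B * crit b (p * s) ^ 2 ≤ 3 * B * (49 / 25 * |crit b p| ^ 2) := by gcongr
      _ = (147 / 25 * B * |crit b p|) * |crit b p| := by ring
      _ ≤ 2 / 5 * |crit b p| := by
        gcongr
        have : B * |crit b p| ≤ B * (5 / 4 * δ) := by gcongr
        nlinarith
  have hclose : ∀ s, |crit b (p * s)| ≤ 7 / 5 * |crit b p| := by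
    intro s
    induction s with
    | zero => rw [mul_zero, crit_zero, abs_zero]; positivity
    | succ s ih =>
      have h1 := (hstep s ih).2
      have h2 := abs_sub_abs_le_abs_sub (crit b (p * s + p)) (crit b p)
      rw [Nat.mul_succ]
      linarith
  have hblock : ∀ s, ∀ i < p, theta b (p * s + i) = theta b (p * s) * theta a i := by
    intro s i hi
    induction i with
    | zero => rw [theta_zero, mul_one, add_zero]
    | succ i ih =>
      refine theta_succ_congr (m := p * s + i) (ih (by omega)) (mul_pos_of_abs_sub_lt ?_)
      have h1 := K.track (U := fun l => crit b (p * s + l)) hpM hX (fun l => crit_succ b _)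
        (hstep s (hclose s)).1 h5 i.succ_pos hi.le
      have h2 := hX (i + 1) i.succ_pos hi
      have h3 : |crit b (p * s + i + 1) - crit a (i + 1)| ≤ δ / (4 * M) := h1
      linarith
  have hfirst : ∀ i < p, theta b i = theta a i := by
    intro i hi
    have := hblock 0 i hi
    rwa [mul_zero, zero_add, theta_zero, one_mul] at this
  refine ⟨hfirst, fun s i hi => ?_⟩
  rw [hblock s i hi]
  congr 1
  clear hi i
  obtain ⟨r, rfl⟩ : ∃ r, p = r + 1 := ⟨p - 1, by omega⟩
  induction s with
  | zero => rw [mul_zero, theta_zero, pow_zero]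
  | succ s ih =>
    have h1 := (hstep s (hclose s)).2
    rw [pow_succ, Nat.mul_succ]
    by_cases hz : crit b (r + 1) = 0
    · rw [hz, sub_zero, abs_zero, mul_zero] at h1
      have h2 : crit b ((r + 1) * s + r + 1) = 0 := abs_nonpos_iff.1 h1
      have h3 : theta b ((r + 1) * s + (r + 1)) = 1 := theta_succ_of_zero h2
      have h4 : theta b (r + 1) = 1 := theta_succ_of_zero hz
      rw [h3, h4, mul_one, one_pow]
    · rw [← ih]
      have h2 := hblock s r (by omega)
      rw [← hfirst r (by omega)] at h2
      refine theta_succ_congr (m := (r + 1) * s + r) h2 (mul_pos_of_abs_sub_lt ?_)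
      have h3 : 0 < |crit b (r + 1)| := abs_pos.2 hz
      have h4 : |crit b ((r + 1) * s + r + 1) - crit b (r + 1)| ≤ 2 / 5 * |crit b (r + 1)| := h1
      linarith

end Control

lemma growth_le_of_common_factor {a b : ℝ} (ha : 0 < growth a) {P : ℝ → ℝ} {p : ℕ}
    (hp : 0 < p) {τ τ' : ℝ} (hτ : |τ| ≤ 1)
    (h1 : ∀ t, 0 ≤ t → t < 1 → pser (theta a) t = P t * (1 - τ * t ^ p)⁻¹)
    (h2 : ∀ t, 0 ≤ t → t < 1 → pser (theta b) t = P t * (1 - τ' * t ^ p)⁻¹) :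
    growth a ≤ growth b := by
  by_contra hlt
  rw [not_le] at hlt
  set ρ := Real.exp (-growth a)
  have hρ0 : 0 < ρ := Real.exp_pos _
  have hρ1 : ρ < 1 := Real.exp_lt_one_iff.2 (by linarith)
  have hroot : pser (theta a) ρ = 0 := pser_theta_root ha
  have hpos : 0 < pser (theta b) ρ := pser_theta_pos hρ0.le (Real.exp_lt_exp.2 (by linarith))
  have hne : 1 - τ * ρ ^ p ≠ 0 := by
    have h3 : ρ ^ p < 1 := pow_lt_one₀ hρ0.le hρ1 hp.ne'
    have h4 : τ * ρ ^ p ≤ ρ ^ p :=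
      mul_le_of_le_one_left (by positivity) ((le_abs_self _).trans hτ)
    exact (by linarith : 0 < 1 - τ * ρ ^ p).ne'
  rw [h1 ρ hρ0.le hρ1] at hroot
  have hP : P ρ = 0 := (mul_eq_zero.1 hroot).resolve_right (inv_ne_zero hne)
  rw [h2 ρ hρ0.le hρ1, hP, zero_mul] at hpos
  exact lt_irrefl _ hpos

/-- Nearby parameters either have the same entropy or share a long piece of kneading sequence. -/
theorem Control.growth_eq_or_theta_eq {a b δ B : ℝ} {M : ℕ} (K : Control a M B δ)
    (ha : 0 < growth a) (hb : 0 < growth b) (hab : |b - a| ≤ δ ^ 2) :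
    growth a = growth b ∨ ∀ l ≤ M, theta b l = theta a l := by
  classical
  by_cases hX : ∀ l, 0 < l → l ≤ M → δ ≤ |crit a l|
  · exact Or.inr fun l hl => K.theta_eq_of_far hX hab hl
  · left
    push Not at hX
    have hspec := Nat.find_spec hX
    have hmin := fun l => Nat.find_min hX (m := l)
    set p := Nat.find hX
    obtain ⟨hp0, hpM, hpX⟩ := hspec
    have hmin' : ∀ l, 0 < l → l < p → δ ≤ |crit a l| := by
      intro l hl hlp
      by_contra h
      exact hmin l hlp ⟨hl, by omega, not_le.1 h⟩
    have key : ∀ c, |c - a| ≤ δ ^ 2 → ∀ t, 0 ≤ t → t < 1 →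
        pser (theta c) t = kpoly a p t * (1 - theta c p * t ^ p)⁻¹ := by
      intro c hc t h0 h1
      obtain ⟨e1, e2⟩ := K.theta_periodic hp0 hpM hmin' hpX hc
      rw [pser_factor hp0 (abs_theta_le c) (e := fun j => theta c p ^ j)
        (fun j => by rw [abs_pow, abs_theta, one_pow])
        (fun j i hi => by rw [e2 j i hi, e1 i hi]) h0 h1,
        pser_pow (abs_theta_le c p) (pow_nonneg h0 p) (pow_lt_one₀ h0 h1 hp0.ne')]
      congr 1
      exact Finset.sum_congr rfl fun i hi => by rw [e1 i (Finset.mem_range.1 hi)]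
    have haa : |a - a| ≤ δ ^ 2 := by rw [sub_self, abs_zero]; positivity
    exact le_antisymm
      (growth_le_of_common_factor ha hp0 (abs_theta_le a p) (key a haa)
        (key b hab))
      (growth_le_of_common_factor hb hp0 (abs_theta_le b p) (key b hab)
        (key a haa))

/-- The `j`-th Taylor coefficient at `u` of the power series with coefficients `d`. -/
noncomputable def taylorSer (d : ℕ → ℝ) (j : ℕ) (u : ℝ) : ℝ :=
  ∑' i, ((i + j).choose j : ℝ) * d (i + j) * u ^ i

lemma taylorSer_zero (d : ℕ → ℝ) : taylorSer d 0 = pser d := by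
  ext u
  simp [taylorSer, pser]

lemma summable_choose_mul_pow (j : ℕ) {r : ℝ} (h0 : 0 ≤ r) (h1 : r < 1) :
    Summable fun i : ℕ => ((i + j).choose j : ℝ) * r ^ i :=
  summable_choose_mul_geometric_of_norm_lt_one j (by rwa [Real.norm_of_nonneg h0])

lemma norm_taylorSer_term_le {d : ℕ → ℝ} (hd : ∀ i, |d i| ≤ 1) (i j : ℕ) {u r : ℝ}
    (hu : |u| ≤ r) :
    ‖((i + j).choose j : ℝ) * d (i + j) * u ^ i‖ ≤ ((i + j).choose j : ℝ) * r ^ i := by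
  rw [norm_mul, norm_mul, norm_pow, Real.norm_natCast, Real.norm_eq_abs, Real.norm_eq_abs]
  have := hd (i + j)
  calc _ ≤ ((i + j).choose j : ℝ) * 1 * r ^ i := by gcongr
    _ = _ := by ring

lemma abs_taylorSer_le {d : ℕ → ℝ} (hd : ∀ i, |d i| ≤ 1) (j : ℕ) {u r : ℝ}
    (hu : |u| ≤ r) (h1 : r < 1) :
    |taylorSer d j u| ≤ ∑' i : ℕ, ((i + j).choose j : ℝ) * r ^ i :=
  tsum_of_norm_bounded (summable_choose_mul_pow j ((abs_nonneg u).trans hu) h1).hasSum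
    fun i => norm_taylorSer_term_le hd i j hu

lemma hasDerivAt_taylorSer {d : ℕ → ℝ} (hd : ∀ i, |d i| ≤ 1) (j : ℕ) {u : ℝ} (hu : |u| < 1) :
    HasDerivAt (taylorSer d j) ((j + 1) * taylorSer d (j + 1) u) u := by
  obtain ⟨s, hus, hs1⟩ := exists_between hu
  have hs0 : 0 ≤ s := (abs_nonneg u).trans hus.le
  have hch : ∀ i : ℕ, ((i + 1 + j).choose j : ℝ) * (i + 1) =
      (j + 1) * ((i + (j + 1)).choose (j + 1) : ℝ) := by
    intro i
    have := Nat.choose_succ_right_eq (i + 1 + j) j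
    rw [Nat.add_sub_cancel] at this
    have h2 : (((i + 1 + j).choose (j + 1) : ℕ) : ℝ) * (j + 1) =
        ((i + 1 + j).choose j : ℝ) * (i + 1) := by exact_mod_cast this
    rw [show i + (j + 1) = i + 1 + j by ring]
    linarith
  have hmem : u ∈ Ioo (-s) s := abs_lt.1 hus
  have hsum : Summable fun i : ℕ => ((i + j).choose j : ℝ) * (i * s ^ (i - 1)) := by
    rw [← summable_nat_add_iff 1]
    refine ((summable_choose_mul_pow (j + 1) hs0 hs1).mul_left ((j : ℝ) + 1)).congr fun i => ?_
    rw [Nat.add_sub_cancel, ← mul_assoc, ← hch]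
    push_cast
    ring
  have hbd : ∀ i : ℕ, ∀ y ∈ Ioo (-s) s,
      ‖((i + j).choose j : ℝ) * d (i + j) * (i * y ^ (i - 1))‖ ≤
        ((i + j).choose j : ℝ) * (i * s ^ (i - 1)) := by
    intro i y hy
    have hy' : |y| ≤ s := (abs_lt.2 hy).le
    rw [norm_mul, norm_mul, norm_mul, norm_pow, Real.norm_natCast, Real.norm_natCast,
      Real.norm_eq_abs, Real.norm_eq_abs]
    have := hd (i + j)
    calc _ ≤ ((i + j).choose j : ℝ) * 1 * (i * s ^ (i - 1)) := by gcongr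
      _ = _ := by ring
  have hD := hasDerivAt_tsum_of_isPreconnected hsum isOpen_Ioo isPreconnected_Ioo
    (g := fun i (y : ℝ) => ((i + j).choose j : ℝ) * d (i + j) * y ^ i)
    (g' := fun i (y : ℝ) => ((i + j).choose j : ℝ) * d (i + j) * (i * y ^ (i - 1)))
    (fun i y _ => (hasDerivAt_pow i y).const_mul _) hbd hmem
    (Summable.of_norm_bounded (summable_choose_mul_pow j hs0 hs1)
      fun i => norm_taylorSer_term_le hd i j hus.le) hmem
  convert! hD using 1
  have hsm : Summable fun i : ℕ => ((i + j).choose j : ℝ) * d (i + j) * (i * u ^ (i - 1)) :=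
    Summable.of_norm_bounded hsum fun i => hbd i u hmem
  rw [hsm.tsum_eq_zero_add, taylorSer, ← tsum_mul_left]
  simp only [Nat.cast_zero, zero_mul, mul_zero, zero_add]
  refine tsum_congr fun i => ?_
  rw [Nat.add_sub_cancel, show i + 1 + j = i + (j + 1) by ring]
  have := hch i
  rw [show i + 1 + j = i + (j + 1) by ring] at this
  push_cast
  linear_combination (-d (i + (j + 1)) * u ^ i) * this

lemma iteratedDeriv_pser {d : ℕ → ℝ} (hd : ∀ i, |d i| ≤ 1) (j : ℕ) {u : ℝ} (hu : |u| < 1) :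
    iteratedDeriv j (pser d) u = j.factorial * taylorSer d j u := by
  induction j generalizing u with
  | zero => simp [taylorSer_zero]
  | succ j ih =>
    rw [iteratedDeriv_succ]
    have hev : iteratedDeriv j (pser d) =ᶠ[nhds u] fun v => j.factorial * taylorSer d j v := by
      filter_upwards [isOpen_Ioo.mem_nhds (abs_lt.1 hu : u ∈ Ioo (-1 : ℝ) 1)] with v hv
      exact ih (abs_lt.2 hv)
    rw [hev.deriv_eq, ((hasDerivAt_taylorSer hd j hu).const_mul _).deriv, Nat.factorial_succ]
    push_cast
    ring

lemma analyticOnNhd_pser {d : ℕ → ℝ} (hd : ∀ i, |d i| ≤ 1) :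
    AnalyticOnNhd ℝ (pser d) (Ioo (-1) 1) := by
  have hsum : pser d = (FormalMultilinearSeries.ofScalars ℝ d).sum := by
    ext t
    have := congrFun (FormalMultilinearSeries.ofScalarsSum_eq_tsum (E := ℝ) d) t
    rw [← FormalMultilinearSeries.ofScalarsSum, this]
    simp [pser]
  have hrad : 1 ≤ (FormalMultilinearSeries.ofScalars ℝ d).radius := by
    refine FormalMultilinearSeries.le_radius_of_bound _ 1 (r := 1) fun n => ?_
    rw [FormalMultilinearSeries.ofScalars_norm]
    simpa using hd n
  rw [hsum]
  have hb := (FormalMultilinearSeries.ofScalars ℝ d).hasFPowerSeriesOnBall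
    (lt_of_lt_of_le zero_lt_one hrad)
  refine hb.analyticOnNhd.mono fun x hx => ?_
  rw [Metric.mem_eball, edist_zero_right]
  refine lt_of_lt_of_le ?_ hrad
  rw [← ofReal_norm, ENNReal.ofReal_lt_one, Real.norm_eq_abs]
  exact abs_lt.2 hx

lemma exists_taylorSer_ne_zero {d : ℕ → ℝ} (hd : ∀ i, |d i| ≤ 1) (hd0 : d 0 ≠ 0) {u : ℝ}
    (hu : |u| < 1) : ∃ j, taylorSer d j u ≠ 0 := by
  by_contra! hz
  have hmem : u ∈ Ioo (-1 : ℝ) 1 := abs_lt.1 hu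
  have han := analyticOnNhd_pser hd
  have htop : analyticOrderAt (pser d) u = ⊤ := by
    refine ENat.eq_top_iff_forall_ge.2 fun n => ?_
    rw [natCast_le_analyticOrderAt_iff_iteratedDeriv_eq_zero (han u hmem)]
    intro i _
    rw [iteratedDeriv_pser hd i hu, hz, mul_zero]
  have h0 := han.eqOn_zero_of_preconnected_of_eventuallyEq_zero isPreconnected_Ioo hmem
    (analyticOrderAt_eq_top.1 htop) (show (0 : ℝ) ∈ Ioo (-1 : ℝ) 1 by norm_num)
  have h1 : pser d 0 = d 0 := by
    rw [pser, tsum_eq_single 0 fun i hi => by simp [hi]]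
    simp
  rw [h1] at h0
  exact hd0 h0

lemma exists_uniform_taylorSer_bound {r : ℝ} (hr0 : 0 ≤ r) (hr : r < 1) :
    ∃ J : ℕ, ∃ ε : ℝ, 0 < ε ∧ ∀ d : ℕ → ℝ, (∀ i, |d i| ≤ 1) → d 0 = 1 →
      ∀ u ∈ Icc 0 r, ∃ j ≤ J, ε ≤ |taylorSer d j u| := by
  let K : Set ((ℕ → Icc (-1 : ℝ) 1) × Icc (0 : ℝ) r) := {x | (x.1 0 : ℝ) = 1}
  have hK : IsCompact K := by
    refine IsClosed.isCompact (isClosed_eq ?_ continuous_const)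
    fun_prop
  have hbd : ∀ x : ℕ → Icc (-1 : ℝ) 1, ∀ i, |(x i : ℝ)| ≤ 1 := fun x i => abs_le.2 (x i).2
  let F : ℕ → (ℕ → Icc (-1 : ℝ) 1) × Icc (0 : ℝ) r → ℝ := fun j x =>
    taylorSer (fun i => (x.1 i : ℝ)) j x.2
  have hF : ∀ j, Continuous (F j) := by
    intro j
    refine continuous_tsum (u := fun i => ((i + j).choose j : ℝ) * r ^ i) (fun i => ?_)
      (summable_choose_mul_pow j hr0 hr) fun i x => ?_
    · fun_prop
    · exact norm_taylorSer_term_le (d := fun i => (x.1 i : ℝ)) (hbd x.1) i j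
        (by rw [abs_of_nonneg x.2.2.1]; exact x.2.2.2)
  let U : ℕ → Set ((ℕ → Icc (-1 : ℝ) 1) × Icc (0 : ℝ) r) := fun J =>
    ⋃ j ∈ Finset.range (J + 1), {x | 1 / ((J : ℝ) + 1) < |F j x|}
  have hUo : ∀ J, IsOpen (U J) := fun J =>
    isOpen_biUnion fun j _ => isOpen_lt continuous_const (hF j).abs
  have hUm : Monotone U := by
    intro J L hJL x hx
    simp only [U, mem_iUnion, Finset.mem_range, mem_ofPred_eq, exists_prop] at hx ⊢
    obtain ⟨j, hj, hx⟩ := hx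
    refine ⟨j, by omega, lt_of_le_of_lt ?_ hx⟩
    gcongr
  have hKU : K ⊆ ⋃ J, U J := by
    intro x hx
    have hx0 : (x.1 0 : ℝ) ≠ 0 := by
      rw [show (x.1 0 : ℝ) = 1 from hx]
      exact one_ne_zero
    have hx2 : |(x.2 : ℝ)| < 1 := by
      rw [abs_of_nonneg x.2.2.1]
      exact x.2.2.2.trans_lt hr
    obtain ⟨j, hj⟩ := exists_taylorSer_ne_zero (d := fun i => (x.1 i : ℝ)) (hbd x.1) hx0 hx2
    obtain ⟨N, hN⟩ := exists_nat_one_div_lt (abs_pos.2 hj)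
    refine mem_iUnion.2 ⟨max j N, ?_⟩
    simp only [U, mem_iUnion, Finset.mem_range, mem_ofPred_eq, exists_prop]
    refine ⟨j, by omega, lt_of_le_of_lt ?_ hN⟩
    have : (N : ℝ) ≤ ((max j N : ℕ) : ℝ) := by exact_mod_cast le_max_right _ _
    gcongr
  obtain ⟨J, hJ⟩ := hK.elim_directed_cover U hUo hKU hUm.directed_le
  refine ⟨J, 1 / ((J : ℝ) + 1), by positivity, fun d hd hd0 u hu => ?_⟩
  have hx : ((fun i => ⟨d i, abs_le.1 (hd i)⟩, ⟨u, hu⟩) :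
      (ℕ → Icc (-1 : ℝ) 1) × Icc (0 : ℝ) r) ∈ K := hd0
  have hxU := hJ hx
  simp only [U, F, mem_iUnion, Finset.mem_range, mem_ofPred_eq, exists_prop] at hxU
  obtain ⟨j, hj, hlt⟩ := hxU
  exact ⟨j, by omega, hlt.le⟩

lemma exists_point_small_deriv (j : ℕ) : ∃ c : ℝ, 0 < c ∧ ∀ (g : ℕ → ℝ → ℝ) (p q η : ℝ), p < q →
    (∀ i, ∀ u ∈ Icc p q, HasDerivAt (g i) ((i + 1) * g (i + 1) u) u) →
    (∀ u ∈ Icc p q, |g 0 u| ≤ η) → ∃ ξ ∈ Icc p q, |g j ξ| * (q - p) ^ j ≤ c * η := by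
  induction j with
  | zero =>
    refine ⟨1, one_pos, fun g p q η hpq _ h0 => ⟨p, ⟨le_rfl, hpq.le⟩, ?_⟩⟩
    simpa using h0 p ⟨le_rfl, hpq.le⟩
  | succ j ih =>
    obtain ⟨c, hc, ih⟩ := ih
    refine ⟨6 * 3 ^ j * c, by positivity, fun g p q η hpq hg h0 => ?_⟩
    set ℓ := (q - p) / 3 with hℓ
    have hℓ0 : 0 < ℓ := by rw [hℓ]; linarith
    have hq : q = p + 3 * ℓ := by rw [hℓ]; ring
    obtain ⟨x, hx, hxc⟩ := ih g p (p + ℓ) η (by linarith)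
      (fun i u hu => hg i u ⟨hu.1, by linarith [hu.2]⟩)
      (fun u hu => h0 u ⟨hu.1, by linarith [hu.2]⟩)
    obtain ⟨y, hy, hyc⟩ := ih g (p + 2 * ℓ) q η (by linarith)
      (fun i u hu => hg i u ⟨by linarith [hu.1], hu.2⟩)
      (fun u hu => h0 u ⟨by linarith [hu.1], hu.2⟩)
    have hxy : ℓ ≤ y - x := by linarith [hx.2, hy.1]
    have hsub : Icc x y ⊆ Icc p q := Icc_subset_Icc hx.1 hy.2
    obtain ⟨ξ, hξ, he⟩ := exists_hasDerivAt_eq_slope (g j) (fun u => (j + 1) * g (j + 1) u)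
      (show x < y by linarith)
      (fun u hu => (hg j u (hsub hu)).continuousAt.continuousWithinAt)
      (fun u hu => hg j u (hsub (Ioo_subset_Icc_self hu)))
    refine ⟨ξ, hsub (Ioo_subset_Icc_self hξ), ?_⟩
    have hne : y - x ≠ 0 := by linarith
    have h1 : (j + 1) * g (j + 1) ξ * (y - x) = g j y - g j x := by
      rw [he]
      field_simp
    have h2 : |g (j + 1) ξ| * ℓ ≤ |g j y| + |g j x| := by
      calc |g (j + 1) ξ| * ℓ ≤ |g (j + 1) ξ| * ((j + 1) * (y - x)) := by
            gcongr
            nlinarith [(Nat.cast_nonneg j : (0 : ℝ) ≤ j)]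
        _ = |(j + 1) * g (j + 1) ξ * (y - x)| := by
            rw [abs_mul, abs_mul, abs_of_pos (show (0 : ℝ) < y - x by linarith),
              abs_of_nonneg (show (0 : ℝ) ≤ j + 1 by positivity)]
            ring
        _ ≤ _ := by
            rw [h1]
            exact abs_sub _ _
    have h3 : |g j x| * ℓ ^ j ≤ c * η := by
      rwa [add_sub_cancel_left] at hxc
    have h4 : |g j y| * ℓ ^ j ≤ c * η := by
      rwa [show q - (p + 2 * ℓ) = ℓ by linarith] at hyc
    calc |g (j + 1) ξ| * (q - p) ^ (j + 1) = 3 ^ (j + 1) * ((|g (j + 1) ξ| * ℓ) * ℓ ^ j) := by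
          rw [show q - p = 3 * ℓ by linarith, mul_pow, pow_succ ℓ]
          ring
      _ ≤ 3 ^ (j + 1) * ((|g j y| + |g j x|) * ℓ ^ j) := by gcongr
      _ ≤ 3 ^ (j + 1) * (2 * (c * η)) := by
          have h5 : (|g j y| + |g j x|) * ℓ ^ j ≤ 2 * (c * η) := by linarith
          gcongr
      _ = _ := by ring

/-- A power series with coefficients in `[-1, 1]` and constant term `1` which is small on an
interval inside `[0, r]` forces that interval to be short. -/
theorem exists_length_pow_le_of_pser_small {r : ℝ} (hr0 : 0 ≤ r) (hr : r < 1) :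
    ∃ J : ℕ, ∃ C : ℝ, 0 < J ∧ 0 < C ∧ ∀ d : ℕ → ℝ, (∀ i, |d i| ≤ 1) → d 0 = 1 →
      ∀ p q η : ℝ, 0 ≤ p → p ≤ q → q ≤ r → (∀ u ∈ Icc p q, |pser d u| ≤ η) →
        (q - p) ^ J ≤ C * η := by
  obtain ⟨J, ε, hε, hJ⟩ := exists_uniform_taylorSer_bound hr0 hr
  choose c hc hcp using exists_point_small_deriv
  let A : ℕ → ℝ := fun j => ∑' i : ℕ, ((i + j).choose j : ℝ) * r ^ i
  have hA0 : ∀ j, 0 ≤ A j := fun j => tsum_nonneg fun i => by positivity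
  set L : ℝ := 1 + 2 * ε + ∑ j ∈ Finset.range (J + 1), (j + 1) * A (j + 1) with hL
  have hS0 : 0 ≤ ∑ j ∈ Finset.range (J + 1), ((j : ℝ) + 1) * A (j + 1) :=
    Finset.sum_nonneg fun j _ => mul_nonneg (by positivity) (hA0 _)
  have hLε : 2 * ε ≤ L := by linarith
  have hL0 : 0 < L := by linarith
  set D : ℝ := ∑ j ∈ Finset.range (J + 1), c j with hD
  have hD0 : 0 < D := Finset.sum_pos (fun j _ => hc j) ⟨0, by simp⟩
  refine ⟨J + 1, 2 * D / ε * (2 * L / ε) ^ (J + 1), by omega, by positivity,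
    fun d hd hd0 p q η hp hpq hqr hη => ?_⟩
  have hη0 : 0 ≤ η := (abs_nonneg _).trans (hη p ⟨le_rfl, hpq⟩)
  rcases hpq.eq_or_lt with rfl | hlt
  · rw [sub_self, zero_pow (by omega)]
    positivity
  obtain ⟨j, hj, hbig⟩ := hJ d hd hd0 p ⟨hp, hpq.trans hqr⟩
  set s := ε / (2 * L) * (q - p) with hs
  have hεL : ε / (2 * L) ≤ 1 := by
    rw [div_le_one (by positivity)]
    linarith
  have hs0 : 0 < s := mul_pos (by positivity) (by linarith)
  have hsq : s ≤ q - p := mul_le_of_le_one_left (by linarith) hεL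
  have hsub : Icc p (p + s) ⊆ Icc p q := Icc_subset_Icc le_rfl (by linarith)
  have habs : ∀ u ∈ Icc p q, |u| ≤ r := fun u hu => by
    rw [abs_of_nonneg (hp.trans hu.1)]
    exact hu.2.trans hqr
  obtain ⟨ξ, hξ, hle⟩ := hcp j (taylorSer d) p (p + s) η (by linarith)
    (fun i u hu => hasDerivAt_taylorSer hd i ((habs u (hsub hu)).trans_lt hr))
    (fun u hu => by rw [taylorSer_zero]; exact hη u (hsub hu))
  have hLj : (j + 1) * A (j + 1) ≤ L := by
    have := Finset.single_le_sum (f := fun j : ℕ => ((j : ℝ) + 1) * A (j + 1))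
      (fun j _ => mul_nonneg (by positivity) (hA0 _)) (Finset.mem_range.2 (Nat.lt_succ_of_le hj))
    linarith
  have hvar : |taylorSer d j ξ - taylorSer d j p| ≤ L * |ξ - p| := by
    have := Convex.norm_image_sub_le_of_norm_hasDerivWithin_le (s := Icc p q) (x := p) (y := ξ)
      (f := taylorSer d j) (f' := fun u => (j + 1) * taylorSer d (j + 1) u) (C := L)
      (fun u hu => (hasDerivAt_taylorSer hd j ((habs u hu).trans_lt hr)).hasDerivWithinAt)
      (fun u hu => by
        rw [Real.norm_eq_abs, abs_mul, abs_of_nonneg (by positivity : (0 : ℝ) ≤ j + 1)]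
        refine le_trans ?_ hLj
        have := abs_taylorSer_le hd (j + 1) (habs u hu) hr
        gcongr)
      (convex_Icc p q) ⟨le_rfl, hpq⟩ (hsub hξ)
    exact this
  have hhalf : ε / 2 ≤ |taylorSer d j ξ| := by
    have h1 : L * |ξ - p| ≤ ε / 2 := by
      have h2 : |ξ - p| ≤ ε / (2 * L) := by
        rw [abs_of_nonneg (by linarith [hξ.1])]
        calc ξ - p ≤ s := by linarith [hξ.2]
          _ ≤ ε / (2 * L) * 1 := by
              rw [hs]
              gcongr
              linarith
          _ = _ := mul_one _
      calc L * |ξ - p| ≤ L * (ε / (2 * L)) := by gcongr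
        _ = ε / 2 := by field_simp
    have h3 := abs_sub_abs_le_abs_sub (taylorSer d j p) (taylorSer d j ξ)
    rw [abs_sub_comm] at h3
    linarith
  have hs1 : s ≤ 1 := hsq.trans (by linarith)
  have hcj : c j ≤ D := Finset.single_le_sum (fun j _ => (hc j).le)
    (Finset.mem_range.2 (Nat.lt_succ_of_le hj))
  have hfin : ε / 2 * s ^ (J + 1) ≤ D * η := by
    calc ε / 2 * s ^ (J + 1) ≤ |taylorSer d j ξ| * s ^ j := by
          have := pow_le_pow_of_le_one hs0.le hs1 (show j ≤ J + 1 by omega)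
          gcongr
      _ ≤ c j * η := by simpa using hle
      _ ≤ D * η := by gcongr
  have hqs : q - p = 2 * L / ε * s := by
    rw [hs]
    field_simp
  calc (q - p) ^ (J + 1) = (2 * L / ε) ^ (J + 1) * (2 / ε * (ε / 2 * s ^ (J + 1))) := by
        rw [hqs, mul_pow]
        field_simp
    _ ≤ (2 * L / ε) ^ (J + 1) * (2 / ε * (D * η)) := by gcongr
    _ = _ := by ring

lemma abs_pser_sub_le {d e : ℕ → ℝ} (hd : ∀ i, |d i| ≤ 1) (he : ∀ i, |e i| ≤ 1) {N : ℕ}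
    (hde : ∀ i < N, d i = e i) {t r : ℝ} (h0 : 0 ≤ t) (htr : t ≤ r) (hr : r < 1) :
    |pser d t - pser e t| ≤ 2 * r ^ N / (1 - r) := by
  have hsd := summable_pser hd h0 (htr.trans_lt hr)
  have hse := summable_pser he h0 (htr.trans_lt hr)
  have hr0 : 0 ≤ r := h0.trans htr
  unfold pser
  rw [← hsd.tsum_sub hse, ← (hsd.sub hse).sum_add_tsum_nat_add N, Finset.sum_eq_zero, zero_add]
  · have hg : HasSum (fun i : ℕ => 2 * r ^ N * r ^ i) (2 * r ^ N * (1 - r)⁻¹) :=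
      (hasSum_geometric_of_lt_one hr0 hr).mul_left _
    rw [div_eq_mul_inv, ← Real.norm_eq_abs]
    refine tsum_of_norm_bounded hg fun i => ?_
    have h1 : |d (i + N) - e (i + N)| ≤ 2 := by
      have := abs_sub (d (i + N)) (e (i + N))
      linarith [hd (i + N), he (i + N)]
    rw [← sub_mul, norm_mul, norm_pow, Real.norm_eq_abs, Real.norm_of_nonneg h0]
    calc |d (i + N) - e (i + N)| * t ^ (i + N) ≤ 2 * r ^ (i + N) := by gcongr
      _ = _ := by ring
  · intro i hi
    rw [hde i (Finset.mem_range.1 hi), sub_self]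

lemma one_sub_le_of_pow_le {s t : ℝ} {p : ℕ} (hs : 0 < s) (ht : 0 ≤ t)
    (hsp : 1 / 2 ≤ s ^ p) (htp : t ^ p ≤ 17 / 20) : 1 - s ≤ 8 * (1 - t) := by
  have h1 := one_add_mul_le_pow (a := t - 1) (by linarith) p
  have h2 := one_add_mul_le_pow (a := s⁻¹ - 1) (by linarith [inv_pos.2 hs]) p
  rw [add_sub_cancel] at h1 h2
  have h3 : s⁻¹ ^ p ≤ 2 := by
    rw [inv_pow]
    exact inv_le_of_inv_le₀ two_pos (by linarith)
  have h4 : 1 - s ≤ s⁻¹ - 1 := by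
    have : s * s⁻¹ = 1 := mul_inv_cancel₀ hs.ne'
    nlinarith [sq_nonneg (s - 1), inv_pos.2 hs, sq_nonneg (s⁻¹ - 1)]
  have hp : (0 : ℝ) < p := by
    rcases Nat.eq_zero_or_pos p with rfl | hp
    · norm_num at htp
    · exact_mod_cast hp
  have h5 : p * (1 - s) ≤ p * (8 * (1 - t)) := by
    have : p * (1 - s) ≤ p * (s⁻¹ - 1) := by gcongr
    nlinarith
  exact le_of_mul_le_mul_left h5 hp

lemma prod_one_sub_pow_le {s t : ℝ} {k : ℕ} (hs : 0 < s) (hs1 : s ≤ 1) (ht : 0 ≤ t)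
    (hsk : 1 / 2 ≤ s ^ 2 ^ k) (htk : t ^ 2 ^ k ≤ 17 / 20) :
    (1 - s) * ∏ i ∈ Finset.range k, (1 - s ^ 2 ^ i) ≤
      8 ^ (k + 1) * ((1 - t) * ∏ i ∈ Finset.range k, (1 - t ^ 2 ^ i)) := by
  have hfac : ∀ i ≤ k, 1 - s ^ 2 ^ i ≤ 8 * (1 - t ^ 2 ^ i) := fun i hi => by
    have hpow : ∀ x : ℝ, (x ^ 2 ^ i) ^ 2 ^ (k - i) = x ^ 2 ^ k := fun x => by
      rw [← pow_mul, ← pow_add, Nat.add_sub_cancel' hi]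
    exact one_sub_le_of_pow_le (p := 2 ^ (k - i)) (by positivity)
      (by positivity) (by rwa [hpow]) (by rwa [hpow])
  have hnn : ∀ i, 0 ≤ 1 - s ^ 2 ^ i := fun i => by linarith [pow_le_one₀ (n := 2 ^ i) hs.le hs1]
  have h0 := hfac 0 (Nat.zero_le k)
  simp only [pow_zero, pow_one] at h0
  have hprod : ∏ i ∈ Finset.range k, (1 - s ^ 2 ^ i) ≤
      ∏ i ∈ Finset.range k, (8 * (1 - t ^ 2 ^ i)) :=
    Finset.prod_le_prod (fun i _ => hnn i) fun i hi => hfac i (Finset.mem_range.1 hi).le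
  rw [Finset.prod_mul_distrib, Finset.prod_const, Finset.card_range] at hprod
  calc _ ≤ (8 * (1 - t)) * (8 ^ k * ∏ i ∈ Finset.range k, (1 - t ^ 2 ^ i)) :=
        mul_le_mul h0 hprod (Finset.prod_nonneg fun i _ => hnn i) (by linarith)
    _ = _ := by ring

lemma prod_one_sub_pow_pos {t : ℝ} (h0 : 0 ≤ t) (h1 : t < 1) (k : ℕ) :
    0 < ∏ i ∈ Finset.range k, (1 - t ^ 2 ^ i) :=
  Finset.prod_pos fun i _ => by
    have := pow_lt_one₀ h0 h1 (pow_ne_zero i two_ne_zero : 2 ^ i ≠ 0)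
    linarith

namespace Tower

variable {a b : ℝ} {k : ℕ} {q p : ℕ → ℝ}

lemma pser_theta (T : Tower a k q) {t : ℝ} (h0 : 0 ≤ t) (h1 : t < 1) :
    pser (theta a) t = (∏ i ∈ Finset.range k, (1 - t ^ 2 ^ i)) *
      pser (fun j => theta a (2 ^ k * j)) (t ^ 2 ^ k) := by
  rw [(T.window k le_rfl).pser_theta h0 h1, T.kpoly_eq]

lemma pser_root (T : Tower a k q) (hH : 0 < growth a) :
    pser (fun j => theta a (2 ^ k * j)) (Real.exp (-growth a) ^ 2 ^ k) = 0 := by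
  have h1 := pser_theta_root hH
  have hlt : Real.exp (-growth a) < 1 := Real.exp_lt_one_iff.2 (by linarith)
  rw [T.pser_theta (Real.exp_pos _).le hlt] at h1
  exact (mul_eq_zero.1 h1).resolve_left (prod_one_sub_pow_pos (Real.exp_pos _).le hlt k).ne'

/-- If the kneading data of `a` and `b` agree for a long time then the renormalised kneading
series of `b` is small between the two roots. -/
lemma abs_pser_le_of_agree (Ta : Tower a k q) (Tb : Tower b k p) (ha : 0 < growth a)
    (hba : growth b ≤ growth a) (hb : 0 < growth b)
    (hlo : 1 / 2 ≤ Real.exp (-growth a) ^ 2 ^ k) (hhi : Real.exp (-growth b) ^ 2 ^ k ≤ 17 / 20)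
    {N : ℕ} (hN : ∀ j < N, theta b (2 ^ k * j) = theta a (2 ^ k * j)) {u : ℝ}
    (hu : u ∈ Icc (Real.exp (-growth a) ^ 2 ^ k) (Real.exp (-growth b) ^ 2 ^ k)) :
    |pser (fun j => theta b (2 ^ k * j)) u| ≤ 8 ^ (k + 1) * (14 * (17 / 20) ^ N) := by
  set s := Real.exp (-growth a)
  set z := Real.exp (-growth b)
  have hs0 : 0 < s := Real.exp_pos _
  have hsz : s ≤ z := Real.exp_le_exp.2 (by linarith)
  have hz1 : z < 1 := Real.exp_lt_one_iff.2 (by linarith)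
  obtain ⟨t, ht, rfl⟩ : ∃ t ∈ Icc s z, t ^ 2 ^ k = u :=
    intermediate_value_Icc hsz (by fun_prop : ContinuousOn (fun t : ℝ => t ^ 2 ^ k) (Icc s z)) hu
  have ht0 : 0 < t := hs0.trans_le ht.1
  have ht1 : t < 1 := ht.2.trans_lt hz1
  have hs1 : s < 1 := hsz.trans_lt hz1
  set D := pser fun j => theta b (2 ^ k * j) with hD
  have hsmall : |D (s ^ 2 ^ k)| ≤ 14 * (17 / 20) ^ N := by
    have h1 := abs_pser_sub_le (fun j => abs_theta_le b (2 ^ k * j))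
      (fun j => abs_theta_le a (2 ^ k * j)) hN (pow_nonneg hs0.le (2 ^ k))
      ((pow_le_pow_left₀ hs0.le hsz _).trans hhi) (by norm_num)
    rw [Ta.pser_root ha, sub_zero] at h1
    refine h1.trans ?_
    have : (0 : ℝ) < (17 / 20) ^ N := by positivity
    rw [div_le_iff₀ (by norm_num)]
    linarith
  have hanti := one_sub_mul_pser_antitone' hb hs0.le ht.1 ht.2
  have hnn := one_sub_mul_pser_antitone' hb ht0.le ht.2 le_rfl
  rw [pser_theta_root hb, mul_zero, Tb.pser_theta ht0.le ht1, ← mul_assoc] at hnn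
  rw [Tb.pser_theta ht0.le ht1, Tb.pser_theta hs0.le hs1, ← mul_assoc, ← mul_assoc,
    ← hD] at hanti
  have hK := prod_one_sub_pow_le (t := t) hs0 hs1.le ht0.le hlo
    ((pow_le_pow_left₀ ht0.le ht.2 _).trans hhi)
  set Ks := (1 - s) * ∏ i ∈ Finset.range k, (1 - s ^ 2 ^ i)
  set Kt := (1 - t) * ∏ i ∈ Finset.range k, (1 - t ^ 2 ^ i)
  have hKt : 0 < Kt := mul_pos (by linarith) (prod_one_sub_pow_pos ht0.le ht1 k)
  have hKs : 0 < Ks := mul_pos (by linarith) (prod_one_sub_pow_pos hs0.le hs1 k)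
  have hDt : 0 ≤ D (t ^ 2 ^ k) := nonneg_of_mul_nonneg_right hnn hKt
  rw [abs_of_nonneg hDt]
  refine le_of_mul_le_mul_left ?_ hKt
  calc Kt * D (t ^ 2 ^ k) ≤ Ks * D (s ^ 2 ^ k) := hanti
    _ ≤ Ks * (14 * (17 / 20) ^ N) := by
        have := (le_abs_self _).trans hsmall
        gcongr
    _ ≤ (8 ^ (k + 1) * Kt) * (14 * (17 / 20) ^ N) := by gcongr
    _ = _ := by ring

lemma control (T : Tower a k q) {N : ℕ} (hN : 0 < N) :
    Control a (2 ^ k * N) (272 ^ (2 * k + N))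
      (1 / (60 * ((2 ^ k * N : ℕ) : ℝ) ^ 2 * 272 ^ (2 * k + N))) where
  M_pos := by positivity
  δ_pos := by positivity
  prod_le i j hij hj := T.prod_le hij hj
  small := by
    rw [mul_one_div_cancel]
    positivity

end Tower

lemma window_delta_le (k : ℕ) {N : ℕ} (hN : 0 < N) :
    ((1 : ℝ) / 272) ^ (6 * k + 4 * N + 2) ≤
      (1 / (60 * ((2 ^ k * N : ℕ) : ℝ) ^ 2 * 272 ^ (2 * k + N))) ^ 2 := by
  have h1 : ((2 ^ k * N : ℕ) : ℝ) ^ 2 ≤ 272 ^ k * 272 ^ N := by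
    have hN2 : (N : ℝ) ≤ 2 ^ N := by exact_mod_cast Nat.lt_two_pow_self.le
    push_cast
    calc ((2 : ℝ) ^ k * N) ^ 2 ≤ (2 ^ k * 2 ^ N) ^ 2 := by gcongr
      _ = 4 ^ k * 4 ^ N := by
          rw [mul_pow, ← pow_mul, ← pow_mul, mul_comm k, mul_comm N, pow_mul, pow_mul]
          norm_num
      _ ≤ _ := by gcongr <;> norm_num
  have h2 : 60 * ((2 ^ k * N : ℕ) : ℝ) ^ 2 * 272 ^ (2 * k + N) ≤ 272 ^ (3 * k + 2 * N + 1) := by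
    calc 60 * ((2 ^ k * N : ℕ) : ℝ) ^ 2 * 272 ^ (2 * k + N)
        ≤ 272 * (272 ^ k * 272 ^ N) * 272 ^ (2 * k + N) := by
          gcongr
          norm_num
      _ = _ := by ring
  rw [show 6 * k + 4 * N + 2 = (3 * k + 2 * N + 1) * 2 by ring, pow_mul, one_div_pow]
  gcongr

/-- The estimate at scale `N` for two parameters in the same renormalisation window. -/
theorem exists_growth_sub_pow_le : ∃ J : ℕ, ∃ C : ℝ, 0 < J ∧ 0 < C ∧ ∀ a ∈ Icc (-2 : ℝ) (1 / 4),
    ∀ b ∈ Icc (-2 : ℝ) (1 / 4), ∀ k N : ℕ, 0 < N → 0 < growth a → 0 < growth b →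
    (k = 0 ∨ growth a < Real.log 2 / 2 ^ k) → (k = 0 ∨ growth b < Real.log 2 / 2 ^ k) →
    1 / 2 ≤ Real.exp (-growth a) ^ 2 ^ k → 1 / 2 ≤ Real.exp (-growth b) ^ 2 ^ k →
    Real.exp (-growth a) ^ 2 ^ k ≤ 17 / 20 → Real.exp (-growth b) ^ 2 ^ k ≤ 17 / 20 →
    |b - a| ≤ (1 / 272) ^ (6 * k + 4 * N + 2) →
    |growth a - growth b| ^ J ≤ C * (8 ^ k * (17 / 20) ^ N) := by
  obtain ⟨J, C, hJ, hC, hmain⟩ :=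
    exists_length_pow_le_of_pser_small (r := 17 / 20) (by norm_num) (by norm_num)
  refine ⟨J, 2 ^ J * (C * 112), hJ, by positivity, ?_⟩
  intro a ha b hb k N hN hga hgb hka hkb hla hlb hua hub hab
  wlog hle : growth b ≤ growth a generalizing a b
  · rw [abs_sub_comm]
    exact this b hb a ha hgb hga hkb hka hlb hla hub hua (by rwa [abs_sub_comm]) (not_le.1 hle).le
  obtain ⟨q, Ta⟩ := exists_tower ha hga k hka
  obtain ⟨p, Tb⟩ := exists_tower hb hgb k hkb
  rcases (Ta.control hN).growth_eq_or_theta_eq hga hgb (hab.trans (window_delta_le k hN)) with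
    heq | hθ
  · rw [heq, sub_self, abs_zero, zero_pow hJ.ne']
    positivity
  set s := Real.exp (-growth a) ^ 2 ^ k with hs
  set z := Real.exp (-growth b) ^ 2 ^ k with hz
  have hsz : s ≤ z := pow_le_pow_left₀ (Real.exp_pos _).le (Real.exp_le_exp.2 (by linarith)) _
  have hpow := hmain (fun j => theta b (2 ^ k * j)) (fun j => abs_theta_le b _)
    (by simp [theta_zero]) s z _ (by linarith) hsz hub fun u hu =>
      Ta.abs_pser_le_of_agree Tb hga hle hgb hla hub
        (fun j hj => hθ _ (Nat.mul_le_mul_left _ hj.le)) hu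
  have hdiff : growth a - growth b ≤ 2 * (z - s) := by
    have hls : Real.log s = -(2 ^ k * growth a) := by
      rw [hs, Real.log_pow, Real.log_exp]
      push_cast
      ring
    have hlz : Real.log z = -(2 ^ k * growth b) := by
      rw [hz, Real.log_pow, Real.log_exp]
      push_cast
      ring
    have hs0 : 0 < s := by linarith
    have hlog : Real.log z - Real.log s ≤ z / s - 1 := by
      rw [← Real.log_div (by linarith) hs0.ne']
      exact Real.log_le_sub_one_of_pos (div_pos (by linarith) hs0)
    have h1 : z / s - 1 ≤ 2 * (z - s) := by
      rw [div_sub_one hs0.ne', div_le_iff₀ hs0]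
      nlinarith
    have h2 : growth a - growth b ≤ 2 ^ k * (growth a - growth b) :=
      le_mul_of_one_le_left (by linarith) (one_le_pow₀ one_le_two)
    linarith
  rw [abs_of_nonneg (by linarith)]
  calc (growth a - growth b) ^ J ≤ (2 * (z - s)) ^ J := by
        have : 0 ≤ growth a - growth b := by linarith
        gcongr
    _ = 2 ^ J * (z - s) ^ J := mul_pow _ _ _
    _ ≤ 2 ^ J * (C * (8 ^ (k + 1) * (14 * (17 / 20) ^ N))) := by gcongr
    _ = _ := by ring

lemma le_mul_rpow_of_pow_le {D C x : ℝ} {P : ℕ} (hP : P ≠ 0) (hC : 1 ≤ C)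
    (hx : 0 ≤ x) (h : D ^ P ≤ C * x) : D ≤ C * x ^ (1 / (P : ℝ)) := by
  have h1 : (C * x ^ (1 / (P : ℝ))) ^ P = C ^ P * x := by
    rw [mul_pow, one_div, Real.rpow_inv_natCast_pow hx hP]
  refine le_of_pow_le_pow_left₀ hP (by positivity) ?_
  rw [h1]
  exact h.trans (by have := le_self_pow₀ hC hP; gcongr)

lemma half_le_exp_pow {g : ℝ} {k : ℕ} (h : 2 ^ k * g ≤ Real.log 2) :
    1 / 2 ≤ Real.exp (-g) ^ 2 ^ k := by
  rw [← Real.exp_nat_mul, ← Real.exp_log (show (0 : ℝ) < 1 / 2 by norm_num), one_div, Real.log_inv]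
  refine Real.exp_le_exp.2 ?_
  push_cast
  linarith

lemma exp_pow_le {g : ℝ} {k : ℕ} (h : Real.log 2 ≤ 4 * (2 ^ k * g)) :
    Real.exp (-g) ^ 2 ^ k ≤ 17 / 20 := by
  refine le_of_pow_le_pow_left₀ (n := 4) (by norm_num) (by norm_num) ?_
  calc (Real.exp (-g) ^ 2 ^ k) ^ 4 = Real.exp (-(4 * (2 ^ k * g))) := by
        rw [← Real.exp_nat_mul, ← Real.exp_nat_mul]
        congr 1
        push_cast
        ring
    _ ≤ Real.exp (-Real.log 2) := Real.exp_le_exp.2 (by linarith)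
    _ ≤ (17 / 20) ^ 4 := by
        rw [Real.exp_neg, Real.exp_log two_pos]
        norm_num

/-- Bounds on the `2 ^ k`-fold growth in the `m`-th window, where `k = m - 1`. -/
lemma window_bounds {g : ℝ} {m : ℕ}
    (hg : g ∈ Icc (Real.log 2 / 2 ^ (m + 1)) (Real.log 2 / 2 ^ m)) :
    0 < g ∧ (m - 1 = 0 ∨ g < Real.log 2 / 2 ^ (m - 1)) ∧
      2 ^ (m - 1) * g ≤ Real.log 2 ∧ Real.log 2 ≤ 4 * (2 ^ (m - 1) * g) := by
  have hl : 0 < Real.log 2 := Real.log_pos one_lt_two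
  have h1 := (div_le_iff₀ (by positivity)).1 hg.1
  have h2 := (le_div_iff₀ (by positivity)).1 hg.2
  have hg0 : 0 < g := lt_of_lt_of_le (by positivity) hg.1
  refine ⟨hg0, ?_⟩
  rcases m with _ | m
  · simp only [zero_add, pow_one, pow_zero] at h1 h2
    refine ⟨Or.inl rfl, ?_, ?_⟩ <;> simp <;> linarith
  · rw [Nat.add_sub_cancel]
    have h3 : 0 < (2 : ℝ) ^ m * g := by positivity
    rw [pow_succ] at h1 h2
    rw [pow_succ] at h1
    exact ⟨Or.inr ((lt_div_iff₀ (by positivity)).2 (by linarith)), by linarith, by linarith⟩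

lemma eight_pow_mul_le {k N : ℕ} (h : 26 * k < N) :
    (8 : ℝ) ^ k * (17 / 20) ^ N ≤ (17 / 20) ^ (N - 13 * k) := by
  have h8 : (8 : ℝ) * (17 / 20) ^ 13 ≤ 1 := by norm_num
  calc (8 : ℝ) ^ k * (17 / 20) ^ N = (8 * (17 / 20) ^ 13) ^ k * (17 / 20) ^ (N - 13 * k) := by
        rw [mul_pow, ← pow_mul, mul_assoc, ← pow_add]
        congr 2
        omega
    _ ≤ 1 * (17 / 20) ^ (N - 13 * k) := by
        gcongr
        exact pow_le_one₀ (by positivity) h8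
    _ = _ := one_mul _

theorem exists_growth_holder : ∃ C : ℝ, 0 < C ∧ ∃ α : ℝ, 0 < α ∧ ∀ m : ℕ,
    ∀ a ∈ Icc (-2 : ℝ) (1 / 4), ∀ b ∈ Icc (-2 : ℝ) (1 / 4),
    growth a ∈ Icc (Real.log 2 / 2 ^ (m + 1)) (Real.log 2 / 2 ^ m) →
    growth b ∈ Icc (Real.log 2 / 2 ^ (m + 1)) (Real.log 2 / 2 ^ m) →
    |growth a - growth b| ≤ C * |a - b| ^ α := by
  obtain ⟨J, C, hJ, hC, hmain⟩ := exists_growth_sub_pow_le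
  refine ⟨2 ^ 54 + C ^ 1000, by positivity, 1 / ((1000 * J : ℕ) : ℝ), by positivity,
    fun m a ha b hb hga hgb => ?_⟩
  obtain ⟨ha0, hak, hau, hal⟩ := window_bounds hga
  obtain ⟨hb0, hbk, hbu, hbl⟩ := window_bounds hgb
  set k := m - 1
  refine le_mul_rpow_of_pow_le (by positivity)
    (le_add_of_le_of_nonneg (by norm_num) (by positivity)) (abs_nonneg _) ?_
  rcases eq_or_ne a b with rfl | hne
  · rw [sub_self, abs_zero, zero_pow (by positivity)]
    positivity
  have hx : 0 < |a - b| := abs_pos.2 (sub_ne_zero.2 hne)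
  have htriv : |growth a - growth b| ≤ (1 / 2) ^ k := by
    have hl2 : Real.log 2 ≤ 1 := by
      have := Real.log_two_lt_d9
      linarith
    have h2 : 2 ^ k * |growth a - growth b| ≤ 1 := by
      have hp : (0 : ℝ) < 2 ^ k := by positivity
      rw [← abs_of_pos hp, ← abs_mul, mul_sub]
      have := mul_pos hp ha0
      have := mul_pos hp hb0
      exact abs_le.2 ⟨by linarith, by linarith⟩
    rw [one_div_pow, le_div_iff₀ (by positivity)]
    linarith
  by_cases hfar : |a - b| ≤ (1 / 272) ^ (6 * k + 4 * (26 * k + 1) + 2)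
  · obtain ⟨n, hn⟩ := exists_pow_lt_of_lt_one hx (show (1 / 272 : ℝ) < 1 by norm_num)
    have hex : ∃ N, 26 * k + 1 ≤ N ∧ ¬ |a - b| ≤ (1 / 272) ^ (6 * k + 4 * (N + 1) + 2) :=
      ⟨26 * k + 1 + n, by omega, not_le.2 <| lt_of_le_of_lt
        (pow_le_pow_of_le_one (by norm_num) (by norm_num) (by omega)) hn⟩
    classical
    obtain ⟨hN1, hN2⟩ := Nat.find_spec hex
    have hN3 : |a - b| ≤ (1 / 272) ^ (6 * k + 4 * Nat.find hex + 2) := by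
      rcases hN1.eq_or_lt with h | h
      · rwa [← h]
      · have hmin := Nat.find_min hex (show Nat.find hex - 1 < Nat.find hex by omega)
        rw [Nat.sub_add_cancel (by omega), not_and_not_right] at hmin
        exact hmin (by omega)
    set N := Nat.find hex
    have hpow := hmain a ha b hb k N (by omega) ha0 hb0 hak hbk (half_le_exp_pow hau)
      (half_le_exp_pow hbu) (exp_pow_le hal) (exp_pow_le hbl) (by rwa [abs_sub_comm])
    have hbase : ((17 : ℝ) / 20) ^ 1000 ≤ (1 / 272) ^ 22 := by
      have h35 : ((17 : ℝ) / 20) ^ 35 ≤ 1 / 272 := by norm_num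
      calc ((17 : ℝ) / 20) ^ 1000 ≤ (17 / 20) ^ (35 * 22) :=
            pow_le_pow_of_le_one (by norm_num) (by norm_num) (by norm_num)
        _ = ((17 / 20) ^ 35) ^ 22 := pow_mul _ _ _
        _ ≤ _ := pow_le_pow_left₀ (by positivity) h35 _
    calc |growth a - growth b| ^ (1000 * J) = (|growth a - growth b| ^ J) ^ 1000 := by
          rw [mul_comm, pow_mul]
      _ ≤ (C * (17 / 20) ^ (N - 13 * k)) ^ 1000 := by
          have h1 := hpow.trans (mul_le_mul_of_nonneg_left (eight_pow_mul_le hN1) hC.le)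
          exact pow_le_pow_left₀ (by positivity) h1 _
      _ = C ^ 1000 * ((17 / 20) ^ 1000) ^ (N - 13 * k) := by
          rw [mul_pow, ← pow_mul, ← pow_mul, mul_comm 1000]
      _ ≤ C ^ 1000 * ((1 / 272) ^ 22) ^ (N - 13 * k) :=
          mul_le_mul_of_nonneg_left (pow_le_pow_left₀ (by positivity) hbase _) (by positivity)
      _ ≤ C ^ 1000 * |a - b| := by
          refine mul_le_mul_of_nonneg_left ?_ (by positivity)
          rw [← pow_mul]
          exact (pow_le_pow_of_le_one (by norm_num) (by norm_num) (by omega)).trans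
            (not_le.1 hN2).le
      _ ≤ _ := mul_le_mul_of_nonneg_right (le_add_of_nonneg_left (by positivity)) hx.le
  · have h272 : ((1 : ℝ) / 2) ^ 9 ≤ 1 / 272 := by norm_num
    have hlow : ((1 : ℝ) / 2) ^ (990 * k + 54) ≤ |a - b| := by
      calc ((1 : ℝ) / 2) ^ (990 * k + 54) =
            ((1 / 2) ^ 9) ^ (6 * k + 4 * (26 * k + 1) + 2) := by
            rw [← pow_mul]
            congr 1
            ring
        _ ≤ (1 / 272) ^ (6 * k + 4 * (26 * k + 1) + 2) :=
            pow_le_pow_left₀ (by positivity) h272 _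
        _ ≤ _ := (not_le.1 hfar).le
    calc |growth a - growth b| ^ (1000 * J) ≤ ((1 / 2) ^ k) ^ (1000 * J) :=
          pow_le_pow_left₀ (abs_nonneg _) htriv _
      _ ≤ (1 / 2) ^ (990 * k) := by
          rw [← pow_mul]
          refine pow_le_pow_of_le_one (by norm_num) (by norm_num) ?_
          nlinarith
      _ = 2 ^ 54 * (1 / 2) ^ (990 * k + 54) := by
          rw [pow_add, mul_left_comm, ← mul_pow]
          norm_num
      _ ≤ 2 ^ 54 * |a - b| := by gcongr
      _ ≤ _ := mul_le_mul_of_nonneg_right (le_add_of_nonneg_right (by positivity)) hx.le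

end QuadraticEntropy

/-- Proposition: there are uniform constants `C₁, α₁ > 0` such that `h` is
`(C₁, α₁)`-Hölder on each set of parameters whose entropy lies in
`[2^{−m−1} log 2, 2^{−m} log 2]`. -/
theorem entropy_uniform_holder_on_renormalisation_windows :
    ∃ C₁ : ℝ, 0 < C₁ ∧ ∃ α₁ : ℝ, 0 < α₁ ∧ ∀ m : ℕ,
      ∀ a ∈ Set.Icc (-2 : ℝ) (1 / 4), ∀ a' ∈ Set.Icc (-2 : ℝ) (1 / 4),
      h a ∈ Set.Icc (Real.log 2 / 2 ^ (m + 1)) (Real.log 2 / 2 ^ m) →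
      h a' ∈ Set.Icc (Real.log 2 / 2 ^ (m + 1)) (Real.log 2 / 2 ^ m) →
      |h a - h a'| ≤ C₁ * |a - a'| ^ α₁ := by
  obtain ⟨C, hC, α, hα, hmain⟩ := QuadraticEntropy.exists_growth_holder
  refine ⟨C, hC, α, hα, fun m a ha b hb hga hgb => ?_⟩
  rw [QuadraticEntropy.h_eq_growth ha] at hga ⊢
  rw [QuadraticEntropy.h_eq_growth hb] at hgb ⊢
  exact hmain m a ha b hb hga hgb
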